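/- Let N(X) denote the number of primes ℓ ≤ X such that spt has a congruence at ℓ. Then N(X)·(log X)/X tends to 0 as the real number X tends to infinity. (Equivalently, the limsup w of N(X)/(X/log X) equals 0.) -/

import Mathlib

open Finset Filter

/-- `spt n`: the total number of smallest parts in the partitions of `n`. -/
def spt (n : ℕ) : ℕ :=
  ∑ p : Nat.Partition n, (p.parts.filter (fun j => ∀ i ∈ p.parts, j ≤ i)).card

/-- `spt` has a congruence at `ℓ` if `ℓ ≥ 5` and
`spt((ℓn+1)/24) ≡ 0 (mod ℓ)` whenever `24 ∣ ℓn + 1`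
(by convention `spt` has no congruence at `ℓ = 2, 3`). -/
def sptHasCongruenceAt (ℓ : ℕ) : Prop :=
  5 ≤ ℓ ∧ ∀ n : ℕ, 24 ∣ ℓ * n + 1 → ℓ ∣ spt ((ℓ * n + 1) / 24)

namespace SptRare

open PowerSeries

section Infrastructure

variable {R S : Type*} [CommRing R] [CommRing S]

/-- The Euler operator `q d/dq` on power series. -/
noncomputable def qD : Derivation R R⟦X⟧ R⟦X⟧ := (X : R⟦X⟧) • derivative R

@[simp] theorem coeff_qD (f : R⟦X⟧) (n : ℕ) : coeff n (qD f) = n * coeff n f := by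
  cases n with
  | zero => simp [qD]
  | succ n =>
    simp only [qD, Derivation.smul_apply, smul_eq_mul, coeff_succ_X_mul, coeff_derivative]
    push_cast; ring

theorem qD_mul (f g : R⟦X⟧) : qD (f * g) = qD f * g + f * qD g := by
  rw [Derivation.leibniz, smul_eq_mul, smul_eq_mul]; ring

theorem qD_X_pow (n : ℕ) : qD ((X : R⟦X⟧) ^ n) = (n : R⟦X⟧) * X ^ n := by
  ext m
  rw [coeff_qD, ← map_natCast (C : R →+* R⟦X⟧), coeff_C_mul, coeff_X_pow]
  split_ifs with h <;> simp [h]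

theorem qD_C (a : R) : qD (C a : R⟦X⟧) = 0 := by
  ext m
  rw [coeff_qD, coeff_C]
  split_ifs with h <;> simp [h]

theorem map_qD (φ : R →+* S) (f : R⟦X⟧) : map φ (qD f) = qD (map φ f) := by
  ext n; simp

/-- The sum of a sequence of power series whose `i`-th term is divisible by `X ^ i`. -/
noncomputable def psum (f : ℕ → R⟦X⟧) : R⟦X⟧ :=
  mk fun n => ∑ i ∈ range (n + 1), coeff n (f i)

/-- The `i`-th term is divisible by `X ^ i`. -/
def Small (f : ℕ → R⟦X⟧) : Prop := ∀ i n, n < i → coeff n (f i) = 0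

theorem coeff_psum {f : ℕ → R⟦X⟧} (hf : Small f) {n N : ℕ} (h : n < N) :
    coeff n (psum f) = ∑ i ∈ range N, coeff n (f i) := by
  rw [psum, coeff_mk]
  refine sum_subset (fun i hi => mem_range.2 ((mem_range.1 hi).trans_le h)) ?_
  intro i _ hi
  exact hf i n (by simpa using hi)

theorem Small.of_dvd {f : ℕ → R⟦X⟧} (h : ∀ i, (X : R⟦X⟧) ^ i ∣ f i) : Small f :=
  fun i n hn => (X_pow_dvd_iff.1 (h i)) n hn

theorem Small.dvd {f : ℕ → R⟦X⟧} (h : Small f) (i : ℕ) : X ^ i ∣ f i :=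
  X_pow_dvd_iff.2 (h i)

theorem small_mul_left {f : ℕ → R⟦X⟧} (hf : Small f) (a : ℕ → R⟦X⟧) :
    Small (fun i => a i * f i) :=
  Small.of_dvd fun i => (hf.dvd i).mul_left _

theorem small_X_pow {e : ℕ → ℕ} (he : ∀ i, i ≤ e i) (a : ℕ → R⟦X⟧) :
    Small (fun i => a i * X ^ e i) :=
  Small.of_dvd fun i => (pow_dvd_pow _ (he i)).mul_left _

theorem Small.map {f : ℕ → R⟦X⟧} (hf : Small f) (φ : R →+* S) :
    Small (fun i => PowerSeries.map φ (f i)) := by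
  intro i n h; rw [coeff_map, hf i n h, map_zero]

theorem psum_dvd_sub {f : ℕ → R⟦X⟧} (hf : Small f) (N : ℕ) :
    X ^ N ∣ psum f - ∑ i ∈ range N, f i := by
  rw [X_pow_dvd_iff]
  intro n hn
  rw [map_sub, coeff_psum hf hn, map_sum, sub_self]

theorem eq_of_forall_X_pow_dvd {f g : R⟦X⟧} (h : ∀ N, X ^ N ∣ f - g) : f = g := by
  ext n
  have := X_pow_dvd_iff.1 (h (n + 1)) n (Nat.lt_succ_self n)
  rwa [map_sub, sub_eq_zero] at this

theorem psum_add {f g : ℕ → R⟦X⟧} : psum (fun i => f i + g i) = psum f + psum g := by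
  ext n; simp [psum, sum_add_distrib]

theorem psum_sub {f g : ℕ → R⟦X⟧} : psum (fun i => f i - g i) = psum f - psum g := by
  ext n; simp [psum]

theorem psum_zero : psum (fun _ => (0 : R⟦X⟧)) = 0 := by
  ext n; simp [psum]

theorem psum_neg {f : ℕ → R⟦X⟧} : psum (fun i => -f i) = -psum f := by
  ext n; simp [psum]

theorem mul_psum {f : ℕ → R⟦X⟧} (hf : Small f) (a : R⟦X⟧) :
    a * psum f = psum (fun i => a * f i) := by
  refine eq_of_forall_X_pow_dvd fun N => ?_
  have h1 := psum_dvd_sub hf N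
  have h2 := psum_dvd_sub (small_mul_left hf fun _ => a) N
  rw [← mul_sum] at h2
  have := (h1.mul_left a).sub h2
  convert this using 1; ring

theorem qD_psum (f : ℕ → R⟦X⟧) : qD (psum f) = psum (fun i => qD (f i)) := by
  ext n; simp [psum, mul_sum]

theorem map_psum (φ : R →+* S) (f : ℕ → R⟦X⟧) :
    map φ (psum f) = psum (fun i => map φ (f i)) := by
  ext n; simp [psum]

theorem psum_succ {f : ℕ → R⟦X⟧} (hf : Small f) :
    psum f = f 0 + psum (fun i => f (i + 1)) := by
  ext n
  rw [map_add, coeff_psum hf (show n < n + 2 by omega), sum_range_succ', add_comm]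
  simp [psum]

theorem psum_congr {f g : ℕ → R⟦X⟧} (h : ∀ i, f i = g i) : psum f = psum g := by
  rw [funext h]

end Infrastructure

section Partitions

/-- The partitions of `n` with all parts at least `j`. -/
def partsGE (j n : ℕ) : Finset (Nat.Partition n) := univ.filter fun p => ∀ i ∈ p.parts, j ≤ i

/-- The number of parts equal to `j` in the partitions of `n` with all parts at least `j`. -/
def countMin (j n : ℕ) : ℕ := ∑ p ∈ partsGE j n, p.parts.count j

theorem sum_partsGE_with_part {M : Type*} [AddCommMonoid M] (j n : ℕ) (hj : 1 ≤ j)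
    (f : Multiset ℕ → M) :
    ∑ p ∈ (partsGE j (n + j)).filter (fun p => j ∈ p.parts), f p.parts
      = ∑ p ∈ partsGE j n, f (j ::ₘ p.parts) := by
  symm
  refine sum_bij (fun p _ => (⟨j ::ₘ p.parts, ?_, ?_⟩ : Nat.Partition (n + j))) ?_ ?_ ?_ ?_
  · intro i hi
    rcases Multiset.mem_cons.1 hi with h | h
    · omega
    · exact p.parts_pos h
  · simp [p.parts_sum, add_comm]
  · intro p hp
    simp only [partsGE, mem_filter, mem_univ, true_and] at hp ⊢
    simpa using hp
  · intro p _ q _ h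
    have := congrArg Nat.Partition.parts h
    simp only [Multiset.cons_inj_right] at this
    exact Nat.Partition.ext this
  · intro p hp
    simp only [partsGE, mem_filter, mem_univ, true_and] at hp
    refine ⟨⟨p.parts.erase j, ?_, ?_⟩, ?_, ?_⟩
    · intro i hi
      exact p.parts_pos (Multiset.mem_of_mem_erase hi)
    · have h1 := congrArg Multiset.sum (Multiset.cons_erase hp.2)
      rw [p.parts_sum, Multiset.sum_cons] at h1
      omega
    · simp only [partsGE, mem_filter, mem_univ, true_and]
      exact fun i hi => hp.1 i (Multiset.mem_of_mem_erase hi)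
    · exact Nat.Partition.ext (Multiset.cons_erase hp.2)
  · intro p _; rfl

theorem partsGE_filter_not (j n : ℕ) :
    (partsGE j n).filter (fun p => ¬ j ∈ p.parts) = partsGE (j + 1) n := by
  ext p
  simp only [partsGE, mem_filter, mem_univ, true_and]
  constructor
  · rintro ⟨h, h'⟩ i hi
    have := h i hi
    have : i ≠ j := fun e => h' (e ▸ hi)
    omega
  · intro h
    exact ⟨fun i hi => (Nat.le_succ j).trans (h i hi), fun hj => by have := h j hj; omega⟩

theorem card_partsGE_add (j n : ℕ) (hj : 1 ≤ j) :
    (partsGE j (n + j)).card = (partsGE (j + 1) (n + j)).card + (partsGE j n).card := by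
  rw [← card_filter_add_card_filter_not (fun p : Nat.Partition (n + j) => j ∈ p.parts),
    partsGE_filter_not, add_comm]
  congr 1
  have := sum_partsGE_with_part j n hj (fun _ => 1)
  simpa using this

theorem not_mem_parts_of_lt {j n : ℕ} (h : n < j) (p : Nat.Partition n) : j ∉ p.parts :=
  fun hj => absurd (p.le_of_mem_parts hj) (by omega)

theorem card_partsGE_of_lt (j n : ℕ) (h : n < j) :
    (partsGE j n).card = (partsGE (j + 1) n).card := by
  rw [← partsGE_filter_not, filter_true_of_mem]
  exact fun p _ => not_mem_parts_of_lt h p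

theorem countMin_of_lt (j n : ℕ) (h : n < j) : countMin j n = 0 :=
  sum_eq_zero fun p _ => Multiset.count_eq_zero_of_notMem (not_mem_parts_of_lt h p)

theorem countMin_add (j n : ℕ) (hj : 1 ≤ j) :
    countMin j (n + j) = countMin j n + (partsGE j n).card := by
  have h := sum_partsGE_with_part j n hj (fun s => s.count j)
  simp only [Multiset.count_cons_self, sum_add_distrib, sum_const, smul_eq_mul, mul_one] at h
  rw [countMin, countMin, ← h, sum_filter]
  refine sum_congr rfl fun p _ => ?_
  split_ifs with hp
  · rfl
  · exact Multiset.count_eq_zero_of_notMem hp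

theorem spt_eq_sum (n N : ℕ) (hN : n ≤ N) :
    spt n = ∑ j ∈ range N, countMin (j + 1) n := by
  have key : ∀ p : Nat.Partition n, (p.parts.filter (fun j => ∀ i ∈ p.parts, j ≤ i)).card
      = ∑ j ∈ range N, if ∀ i ∈ p.parts, j + 1 ≤ i then p.parts.count (j + 1) else 0 := by
    intro p
    rw [← Multiset.sum_count_eq_card (s := (range N).image (· + 1)),
      sum_image (fun a _ b _ h => by simpa using h)]
    · exact sum_congr rfl fun j _ => Multiset.count_filter
    · intro a ha
      have ha := (Multiset.mem_filter.1 ha).1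
      have h1 := p.parts_pos ha
      have h2 := p.le_of_mem_parts ha
      exact mem_image.2 ⟨a - 1, mem_range.2 (by omega), by omega⟩
  simp only [spt, key, countMin, partsGE]
  rw [sum_comm]
  exact sum_congr rfl fun j _ => (sum_filter _ _).symm

theorem card_partsGE_large (j n : ℕ) (h : n < j) : (partsGE j n).card = if n = 0 then 1 else 0 := by
  split_ifs with h0
  · subst h0
    rw [card_eq_one]
    refine ⟨default, ?_⟩
    ext p
    simp [partsGE, Subsingleton.elim p default]
  · rw [card_eq_zero, partsGE, filter_eq_empty_iff]
    intro p _ hp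
    have : p.parts ≠ 0 := by
      intro h; have := p.parts_sum; rw [h] at this; simp at this; omega
    obtain ⟨i, hi⟩ := Multiset.exists_mem_of_ne_zero this
    have := hp i hi
    have := p.le_of_mem_parts hi
    omega

theorem card_partsGE_one (n : ℕ) : (partsGE 1 n).card = Fintype.card (Nat.Partition n) := by
  rw [partsGE, filter_true_of_mem, Finset.card_univ]
  exact fun p _ i hi => p.parts_pos hi

end Partitions
section BaileyPair

variable {F : Type*} [Field F]

/-- The `q`-Pochhammer product `(1 - q) ⋯ (1 - q ^ n)`. -/
def qp (q : F) (n : ℕ) : F := ∏ i ∈ range n, (1 - q ^ (i + 1))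

theorem qp_succ (q : F) (n : ℕ) : qp q (n + 1) = qp q n * (1 - q ^ (n + 1)) := prod_range_succ _ _

theorem qp_zero (q : F) : qp q 0 = 1 := prod_range_zero _

theorem qp_ne_zero {q : F} (hq : ∀ n : ℕ, 1 - q ^ (n + 1) ≠ 0) (n : ℕ) : qp q n ≠ 0 :=
  prod_ne_zero_iff.2 fun i _ => hq i

/-- The pentagonal terms `(-1) ^ r * q ^ (r * (3 * r + 1) / 2)`. -/
def pe (q : F) : ℕ → F
  | 0 => 1
  | r + 1 => -pe q r * q ^ (3 * r + 2)

/-- The terms of the Bailey pair identity. -/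
def bailey (q : F) (n : ℕ) : ℕ → F
  | 0 => 1 / qp q n ^ 2
  | r + 1 => -pe q r * q ^ (2 * r + 1) * (1 + q ^ (r + 1)) / (qp q (n - (r + 1)) * qp q (n + (r + 1)))

theorem bailey_zero (q : F) (n : ℕ) : bailey q n 0 = 1 / qp q n ^ 2 := rfl

theorem bailey_succ (q : F) (n r : ℕ) : bailey q n (r + 1) = -pe q r * q ^ (2 * r + 1) *
    (1 + q ^ (r + 1)) / (qp q (n - (r + 1)) * qp q (n + (r + 1))) := rfl

theorem bailey_partial {q : F} (hq : ∀ n : ℕ, 1 - q ^ (n + 1) ≠ 0) (M : ℕ) : ∀ d : ℕ,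
    ∑ r ∈ range (M + 1), ((1 - q ^ (M + d + 1)) * bailey q (M + d + 1) r - bailey q (M + d) r)
      = q ^ (M + d + 1) * (q ^ M - q ^ (M + d + 1)) * pe q M /
          (qp q (d + 1) * qp q (2 * M + d + 1)) := by
  induction M with
  | zero =>
    intro d
    have h1 := qp_ne_zero hq d
    have h2 := hq d
    simp only [zero_add, range_one, sum_singleton, bailey, pe, qp_succ, mul_zero]
    field_simp
    ring
  | succ M ih =>
    intro d
    rw [sum_range_succ]
    have h := ih (d + 1)
    rw [show M + (d + 1) + 1 = M + 1 + d + 1 by ring, show M + (d + 1) = M + 1 + d by ring] at h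
    rw [h]
    simp only [bailey, pe]
    rw [show M + 1 + d + 1 - (M + 1) = d + 1 by omega, show M + 1 + d - (M + 1) = d by omega,
      show M + 1 + d + 1 + (M + 1) = 2 * M + d + 2 + 1 by ring,
      show M + 1 + d + (M + 1) = 2 * M + d + 2 by ring,
      show 2 * M + (d + 1) + 1 = 2 * M + d + 2 by ring,
      show 2 * (M + 1) + d + 1 = 2 * M + d + 2 + 1 by ring, qp_succ q (d + 1), qp_succ q d,
      qp_succ q (2 * M + d + 2)]
    have h1 := qp_ne_zero hq d
    have h2 := qp_ne_zero hq (2 * M + d + 2)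
    have h3 := hq d
    have h4 := hq (d + 1)
    have h5 := hq (2 * M + d + 2)
    field_simp
    ring

theorem bailey_sum {q : F} (hq : ∀ n : ℕ, 1 - q ^ (n + 1) ≠ 0) (n : ℕ) :
    ∑ r ∈ range (n + 1), bailey q n r = 1 / qp q n := by
  induction n with
  | zero => simp [bailey, qp_zero]
  | succ n ih =>
    have h := bailey_partial hq n 0
    rw [sum_sub_distrib, ← mul_sum, add_zero, ih] at h
    rw [sum_range_succ, bailey_succ]
    rw [show n + 1 - (n + 1) = 0 by omega, show n + 1 + (n + 1) = 2 * n + 1 + 1 by ring, qp_succ q n,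
      qp_zero, qp_succ q (2 * n + 1)]
    rw [show 2 * n + 0 + 1 = 2 * n + 1 by ring, zero_add, qp_succ q 0, qp_zero] at h
    have h1 := qp_ne_zero hq n
    have h2 := qp_ne_zero hq (2 * n + 1)
    have h3 := hq n
    have h4 := hq 0
    have h5 := hq (2 * n + 1)
    have h6 : (1 : F) - q ^ (2 * n + 1 + 1) = (1 - q ^ (n + 1)) * (1 + q ^ (n + 1)) := by ring
    have h7 : (1 : F) + q ^ (n + 1) ≠ 0 := fun h => h5 (by rw [h6, h, mul_zero])
    apply mul_left_cancel₀ h3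
    rw [mul_add, eq_add_of_sub_eq h, h6]
    rw [zero_add, pow_one] at h4 ⊢
    field_simp
    ring

theorem spt_finite_identity {q : F} (hq : ∀ n : ℕ, 1 - q ^ (n + 1) ≠ 0) (N : ℕ) :
    ∑ n ∈ range N, q ^ (n + 1) * qp q n ^ 2 / qp q (n + 1)
      = ∑ n ∈ range N, q ^ (n + 1) / (1 - q ^ (n + 1)) ^ 2
        + ∑ r ∈ range N, pe q (r + 1) * (1 + q ^ (r + 1)) / (1 - q ^ (r + 1)) ^ 2 *
          (qp q N ^ 2 / (qp q (N - (r + 1)) * qp q (N + (r + 1)))) := by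
  induction N with
  | zero => simp
  | succ N ih =>
    have hb := bailey_sum hq (N + 1)
    have hN := qp_ne_zero hq N
    have hN1 := hq N
    have step : ∀ r ∈ range N, pe q (r + 1) * (1 + q ^ (r + 1)) / (1 - q ^ (r + 1)) ^ 2 *
          (qp q (N + 1) ^ 2 / (qp q (N + 1 - (r + 1)) * qp q (N + 1 + (r + 1))))
        = pe q (r + 1) * (1 + q ^ (r + 1)) / (1 - q ^ (r + 1)) ^ 2 *
          (qp q N ^ 2 / (qp q (N - (r + 1)) * qp q (N + (r + 1))))
          + q ^ (N + 1) * qp q N ^ 2 * bailey q (N + 1) (r + 1) := by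
      intro r hr
      obtain ⟨d, rfl⟩ := Nat.exists_eq_add_of_lt (mem_range.1 hr)
      simp only [bailey, pe]
      rw [show r + d + 1 + 1 - (r + 1) = d + 1 by omega, show r + d + 1 - (r + 1) = d by omega,
        show r + d + 1 + 1 + (r + 1) = 2 * r + d + 2 + 1 by ring,
        show r + d + 1 + (r + 1) = 2 * r + d + 2 by ring, qp_succ q (r + d + 1), qp_succ q d,
        qp_succ q (2 * r + d + 2)]
      have h1 := qp_ne_zero hq d
      have h2 := qp_ne_zero hq (2 * r + d + 2)
      have h3 := hq d
      have h5 := hq (2 * r + d + 2)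
      have h6 := hq r
      field_simp
      ring
    have last : pe q (N + 1) * (1 + q ^ (N + 1)) / (1 - q ^ (N + 1)) ^ 2 *
          (qp q (N + 1) ^ 2 / (qp q (N + 1 - (N + 1)) * qp q (N + 1 + (N + 1))))
        = q ^ (N + 1) * qp q N ^ 2 * bailey q (N + 1) (N + 1) := by
      simp only [bailey, pe]
      rw [show N + 1 - (N + 1) = 0 by omega, qp_zero, qp_succ q N]
      have h2 := qp_ne_zero hq (N + 1 + (N + 1))
      field_simp
      ring
    rw [sum_range_succ' _ (N + 1)] at hb
    rw [sum_range_succ, sum_range_succ, sum_range_succ, sum_congr rfl step, sum_add_distrib, ih, last,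
      ← mul_sum]
    rw [sum_range_succ] at hb
    rw [eq_sub_of_add_eq (eq_sub_of_add_eq hb), bailey_zero, qp_succ]
    generalize ∑ x ∈ range N, q ^ (x + 1) / (1 - q ^ (x + 1)) ^ 2 = s₁
    generalize ∑ x ∈ range N, pe q (x + 1) * (1 + q ^ (x + 1)) / (1 - q ^ (x + 1)) ^ 2 *
          (qp q N ^ 2 / (qp q (N - (x + 1)) * qp q (N + (x + 1)))) = s₂
    field_simp
    ring

end BaileyPair

section QSeries

variable (k : Type*) [Field k]

/-- The partial theta series `∑ (-1) ^ n q ^ (n (3 n + 1) / 2 + n j)`. -/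
noncomputable def ptheta (j : ℕ) : k⟦X⟧ :=
  psum fun n => (-1) ^ n * X ^ (n * (3 * n + 1) / 2 + n * j)

/-- The Euler product `∏ (1 - q ^ n)`, in its pentagonal form. -/
noncomputable def euler : k⟦X⟧ := ptheta k 0 - X * ptheta k 2

/-- The generating function of the sum of divisors, as a logarithmic derivative. -/
noncomputable def sigmaSeries : k⟦X⟧ := -qD (euler k) * (euler k)⁻¹

/-- The crank-type correction `∑ (2 j + 1) (ptheta j - 1)`. -/
noncomputable def rankSeries : k⟦X⟧ := psum fun j => ((2 * j + 1 : ℕ) : k⟦X⟧) * (ptheta k j - 1)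

/-- The partial Euler products. -/
noncomputable def eulerProd (N : ℕ) : k⟦X⟧ := ∏ i ∈ range N, (1 - X ^ (i + 1))

theorem pent_succ (r : ℕ) : (r + 1) * (3 * (r + 1) + 1) / 2 = r * (3 * r + 1) / 2 + (3 * r + 2) := by
  rw [show (r + 1) * (3 * (r + 1) + 1) = r * (3 * r + 1) + 2 * (3 * r + 2) by ring]
  omega

theorem le_pent (r : ℕ) : 2 * r ≤ r * (3 * r + 1) / 2 := by
  induction r with
  | zero => simp
  | succ r ih => rw [pent_succ]; omega

theorem two_mul_pent (r : ℕ) : 2 * (r * (3 * r + 1) / 2) = r * (3 * r + 1) := by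
  induction r with
  | zero => simp
  | succ r ih => rw [pent_succ, mul_add, ih]; ring

theorem small_ptheta (j : ℕ) :
    Small (fun n => (-1) ^ n * X ^ (n * (3 * n + 1) / 2 + n * j) : ℕ → k⟦X⟧) :=
  small_X_pow (fun i => by have := le_pent i; omega) _

theorem ptheta_sub_one (j : ℕ) : ptheta k j - 1
    = psum fun r => (-1) ^ (r + 1) * X ^ ((r + 1) * (3 * (r + 1) + 1) / 2 + (r + 1) * j) := by
  rw [ptheta, psum_succ (small_ptheta k j)]
  simp

theorem ptheta_rec (j : ℕ) : ptheta k j = 1 - X ^ (j + 2) * ptheta k (j + 3) := by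
  have h := ptheta_sub_one k j
  rw [sub_eq_iff_eq_add'] at h
  rw [h, ptheta, mul_psum (small_ptheta k _), sub_eq_add_neg]
  congr 1
  rw [← psum_neg]
  refine psum_congr fun r => ?_
  rw [pent_succ, show r * (3 * r + 1) / 2 + (3 * r + 2) + (r + 1) * j
    = (j + 2) + (r * (3 * r + 1) / 2 + r * (j + 3)) by ring, pow_add _ (j + 2)]
  ring

theorem small_rankSeries :
    Small fun j => ((2 * j + 1 : ℕ) : k⟦X⟧) * (ptheta k j - 1) := by
  refine Small.of_dvd fun j => Dvd.dvd.mul_left ?_ _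
  rw [ptheta_rec, sub_sub_cancel_left, dvd_neg]
  exact Dvd.dvd.mul_right (pow_dvd_pow _ (by omega)) _

theorem eulerProd_succ (N : ℕ) : eulerProd k (N + 1) = eulerProd k N * (1 - X ^ (N + 1)) :=
  prod_range_succ _ _

theorem constantCoeff_eulerProd (N : ℕ) : constantCoeff (eulerProd k N) = 1 := by
  simp [eulerProd, map_prod]

theorem dvd_eulerProd_sub (N d : ℕ) : X ^ (N + 1) ∣ eulerProd k (N + d) - eulerProd k N := by
  induction d with
  | zero => simp
  | succ d ih =>
    rw [← add_assoc, eulerProd_succ]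
    have : (X : k⟦X⟧) ^ (N + 1) ∣ eulerProd k (N + d) * X ^ (N + d + 1) :=
      Dvd.dvd.mul_left (pow_dvd_pow _ (by omega)) _
    convert ih.sub this using 1
    ring

open scoped PowerSeries.WithPiTopology in
theorem euler_eq_pentagonalSeries : euler k = pentagonalSeries k := by
  let _ : TopologicalSpace k := ⊥
  have : DiscreteTopology k := ⟨rfl⟩
  have h := WithPiTopology.hasSum_pow_pentagonal_sub_pentagonalSeries k
  ext n
  have h2 := (h.map (coeff n) (WithPiTopology.continuous_coeff k n)).tsum_eq
  have pn : ∀ m : ℕ, pentagonal (-(m : ℤ)) = m * (3 * m + 1) / 2 := by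
    intro m
    have h1 := two_mul_natCast_pentagonal_neg (m : ℤ)
    have h2 := two_mul_pent m
    zify at h2 ⊢
    omega
  have pp : ∀ m : ℕ, pentagonal ((m : ℤ) + 1) = m * (3 * m + 1) / 2 + m * 2 + 1 := by
    intro m
    have := two_mul_natCast_pentagonal ((m : ℤ) + 1)
    have h3 : (m + 1 : ℤ) * (3 * (m + 1) - 1) = m * (3 * m + 1) + 2 * (2 * m + 1) := by ring
    rw [h3] at this
    have h2 := two_mul_pent m
    zify at h2 ⊢
    omega
  rw [← h2, tsum_eq_sum (s := range (n + 1))]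
  · have e : euler k = psum fun m => (-1) ^ m * X ^ (m * (3 * m + 1) / 2 + m * 0) -
        X * ((-1) ^ m * X ^ (m * (3 * m + 1) / 2 + m * 2)) := by
      rw [psum_sub, euler, ptheta, ptheta, mul_psum (small_ptheta k 2)]
    rw [e, psum, coeff_mk]
    refine sum_congr rfl fun m _ => ?_
    simp only [Function.comp, pn, pp]
    congr 1
    ring
  · intro m hm
    have hm : n < m := by simpa using hm
    have hd : (X : k⟦X⟧) ^ m ∣ (-1) ^ m * (X ^ pentagonal (-(m : ℤ)) - X ^ pentagonal ((m : ℤ) + 1)) := by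
      have := le_pent m
      refine Dvd.dvd.mul_left (dvd_sub (pow_dvd_pow _ ?_) (pow_dvd_pow _ ?_)) _
      · rw [pn]; omega
      · rw [pp]; omega
    exact X_pow_dvd_iff.1 hd n hm

theorem dvd_euler_sub (N : ℕ) : X ^ (N + 1) ∣ euler k - eulerProd k N := by
  rw [X_pow_dvd_iff]
  intro n hn
  rw [euler_eq_pentagonalSeries, map_sub, sub_eq_zero]
  have h := (coeff_prod_one_sub_X_pow_eventually_eq k n)
  rw [eventually_atTop] at h
  obtain ⟨s, hs⟩ := h
  obtain ⟨M, hM⟩ := s.exists_nat_subset_range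
  have h1 := hs (range (N + M)) (hM.trans (range_subset_range.2 (by omega)))
  rw [← h1]
  have := X_pow_dvd_iff.1 (dvd_eulerProd_sub k N M) n hn
  rw [map_sub, sub_eq_zero] at this
  exact this

theorem constantCoeff_euler : constantCoeff (euler k) = 1 := by
  have := X_pow_dvd_iff.1 (dvd_euler_sub k 0) 0 (by simp)
  simpa [eulerProd, sub_eq_zero] using this

theorem euler_mul_inv : euler k * (euler k)⁻¹ = 1 :=
  PowerSeries.mul_inv_cancel _ (by rw [constantCoeff_euler]; exact one_ne_zero)

theorem qD_euler : qD (euler k) = -(sigmaSeries k * euler k) := by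
  rw [sigmaSeries]
  linear_combination (-qD (euler k)) * euler_mul_inv k

/-- The generating function of the partition numbers. -/
noncomputable def partSeries : k⟦X⟧ := mk fun n => (Fintype.card (Nat.Partition n) : k)

/-- The generating function of `spt`. -/
noncomputable def sptSeries : k⟦X⟧ := mk fun n => (spt n : k)

/-- The generating function of the partitions with all parts at least `j`. -/
noncomputable def geSeries (j : ℕ) : k⟦X⟧ := mk fun n => ((partsGE j n).card : k)

/-- The generating function of `countMin`. -/
noncomputable def minSeries (j : ℕ) : k⟦X⟧ := mk fun n => (countMin j n : k)

theorem one_sub_mul_geSeries (j : ℕ) (hj : 1 ≤ j) :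
    (1 - X ^ j) * geSeries k j = geSeries k (j + 1) := by
  ext n
  rw [sub_mul, one_mul, map_sub, coeff_X_pow_mul']
  simp only [geSeries, coeff_mk]
  split_ifs with h
  · obtain ⟨m, rfl⟩ := Nat.exists_eq_add_of_le' h
    rw [Nat.add_sub_cancel, card_partsGE_add j m hj]
    push_cast; ring
  · rw [card_partsGE_of_lt j n (by omega), sub_zero]

theorem one_sub_mul_minSeries (j : ℕ) (hj : 1 ≤ j) :
    (1 - X ^ j) * minSeries k j = X ^ j * geSeries k j := by
  ext n
  rw [sub_mul, one_mul, map_sub, coeff_X_pow_mul', coeff_X_pow_mul']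
  simp only [geSeries, minSeries, coeff_mk]
  split_ifs with h
  · obtain ⟨m, rfl⟩ := Nat.exists_eq_add_of_le' h
    rw [Nat.add_sub_cancel, countMin_add j m hj]
    push_cast; ring
  · rw [countMin_of_lt j n (by omega)]; simp

theorem eulerProd_mul_geSeries (N : ℕ) : eulerProd k N * geSeries k 1 = geSeries k (N + 1) := by
  induction N with
  | zero => simp [eulerProd]
  | succ N ih =>
    rw [← one_sub_mul_geSeries k (N + 1) (by omega), ← ih, eulerProd_succ]
    ring

theorem geSeries_one : geSeries k 1 = partSeries k := by
  ext n; simp [geSeries, partSeries, card_partsGE_one]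

theorem euler_mul_partSeries : euler k * partSeries k = 1 := by
  refine eq_of_forall_X_pow_dvd fun N => ?_
  have h1 : X ^ N ∣ (euler k - eulerProd k N) * partSeries k :=
    ((pow_dvd_pow _ (Nat.le_succ N)).trans (dvd_euler_sub k N)).mul_right _
  have h2 : X ^ N ∣ geSeries k (N + 1) - 1 := by
    rw [X_pow_dvd_iff]
    intro n hn
    rw [map_sub, geSeries, coeff_mk, card_partsGE_large _ _ (by omega), coeff_one]
    split_ifs <;> simp
  have h3 := h1.add h2
  rw [← eulerProd_mul_geSeries, geSeries_one] at h3
  convert h3 using 1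
  ring

theorem one_sub_X_pow_mul_inv (n : ℕ) : (1 - X ^ (n + 1) : k⟦X⟧) * (1 - X ^ (n + 1))⁻¹ = 1 :=
  PowerSeries.mul_inv_cancel _ (by simp)

theorem euler_mul_minSeries (j : ℕ) :
    euler k * minSeries k (j + 1) = X ^ (j + 1) * eulerProd k j * (1 - X ^ (j + 1))⁻¹ := by
  have h1 := one_sub_mul_minSeries k (j + 1) (by omega)
  rw [← eulerProd_mul_geSeries, geSeries_one] at h1
  linear_combination (1 - X ^ (j + 1))⁻¹ * euler k * h1 - euler k * minSeries k (j + 1) *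
    one_sub_X_pow_mul_inv k j + X ^ (j + 1) * eulerProd k j * (1 - X ^ (j + 1))⁻¹ *
    euler_mul_partSeries k

theorem dvd_euler_mul_sptSeries (N : ℕ) : X ^ N ∣ euler k * sptSeries k -
    ∑ j ∈ range N, X ^ (j + 1) * eulerProd k j * (1 - X ^ (j + 1))⁻¹ := by
  have h : X ^ N ∣ sptSeries k - ∑ j ∈ range N, minSeries k (j + 1) := by
    rw [X_pow_dvd_iff]
    intro n hn
    rw [map_sub, map_sum, sptSeries, coeff_mk, spt_eq_sum n N hn.le]
    simp [minSeries]
  have := h.mul_left (euler k)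
  rw [mul_sub, mul_sum] at this
  rwa [sum_congr rfl fun j _ => (euler_mul_minSeries k j).symm]

theorem eulerProd_mul_inv (n : ℕ) : eulerProd k n * (eulerProd k n)⁻¹ = 1 :=
  PowerSeries.mul_inv_cancel _ (by rw [constantCoeff_eulerProd]; exact one_ne_zero)

end QSeries

section SptIdentity

variable (k : Type*) [Field k]

theorem map_powerSeries_inv {F : Type*} [Field F] (φ : k⟦X⟧ →+* F) {f : k⟦X⟧}
    (hf : constantCoeff f ≠ 0) : φ f⁻¹ = (φ f)⁻¹ := by
  have h : φ f * φ f⁻¹ = 1 := by rw [← map_mul, PowerSeries.mul_inv_cancel _ hf, map_one]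
  exact eq_inv_of_mul_eq_one_right h

theorem pe_eq {F : Type*} [Field F] (q : F) (r : ℕ) :
    pe q r = (-1) ^ r * q ^ (r * (3 * r + 1) / 2) := by
  induction r with
  | zero => simp [pe]
  | succ r ih => rw [pe, ih, pent_succ]; ring

theorem eulerProd_identity (N : ℕ) :
    ∑ n ∈ range N, X ^ (n + 1) * eulerProd k n * (1 - X ^ (n + 1) : k⟦X⟧)⁻¹
      = ∑ n ∈ range N, X ^ (n + 1) * ((1 - X ^ (n + 1) : k⟦X⟧)⁻¹) ^ 2
        + ∑ r ∈ range N, (-1) ^ (r + 1) * X ^ ((r + 1) * (3 * (r + 1) + 1) / 2) *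
          (1 + X ^ (r + 1)) * ((1 - X ^ (r + 1) : k⟦X⟧)⁻¹) ^ 2 *
          (eulerProd k N ^ 2 * ((eulerProd k (N - (r + 1)))⁻¹ * (eulerProd k (N + (r + 1)))⁻¹)) := by
  let φ : k⟦X⟧ →+* FractionRing k⟦X⟧ := algebraMap _ _
  have hφ : Function.Injective φ := IsFractionRing.injective _ _
  have hc : ∀ n : ℕ, constantCoeff (1 - X ^ (n + 1) : k⟦X⟧) ≠ 0 := by intro n; simp
  have hc' : ∀ n : ℕ, constantCoeff (eulerProd k n) ≠ 0 := by
    intro n; rw [constantCoeff_eulerProd]; exact one_ne_zero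
  have hq : ∀ n : ℕ, 1 - φ X ^ (n + 1) ≠ 0 := by
    intro n h
    have : φ (1 - X ^ (n + 1)) = φ 0 := by simpa using h
    exact hc n (by rw [hφ this]; simp)
  have hE : ∀ n, φ (eulerProd k n) = qp (φ X) n := by
    intro n; simp [eulerProd, qp, map_prod]
  apply hφ
  have h := spt_finite_identity hq N
  simp only [map_add, map_sum, map_mul, map_pow, map_powerSeries_inv k φ (hc _),
    map_powerSeries_inv k φ (hc' _), hE, map_sub, map_one, map_neg]
  have e : ∀ n, φ X ^ (n + 1) * qp (φ X) n * (1 - φ X ^ (n + 1))⁻¹ =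
      φ X ^ (n + 1) * qp (φ X) n ^ 2 / qp (φ X) (n + 1) := by
    intro n
    have h1 := qp_ne_zero hq n
    have h2 := hq n
    rw [qp_succ]
    field_simp
  simp only [e, h, pe_eq]
  congr 1
  · refine sum_congr rfl fun n _ => ?_
    rw [div_eq_mul_inv, inv_pow]
  · refine sum_congr rfl fun n _ => ?_
    have h1 := hq n
    have h2 := qp_ne_zero hq (N - (n + 1))
    have h3 := qp_ne_zero hq (N + (n + 1))
    field_simp

theorem dvd_eulerProd_ratio (N r : ℕ) (hr : r < N) :
    X ^ (N - r) ∣ eulerProd k N ^ 2 * ((eulerProd k (N - (r + 1)))⁻¹ * (eulerProd k (N + (r + 1)))⁻¹)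
      - 1 := by
  have h1 := dvd_eulerProd_sub k (N - (r + 1)) (r + 1)
  rw [show N - (r + 1) + (r + 1) = N by omega, show N - (r + 1) + 1 = N - r by omega] at h1
  have h2 := (pow_dvd_pow (X : k⟦X⟧) (show N - r ≤ N + 1 by omega)).trans
    (dvd_eulerProd_sub k N (r + 1))
  have e1 := eulerProd_mul_inv k (N - (r + 1))
  have e2 := eulerProd_mul_inv k (N + (r + 1))
  have := ((h1.mul_left (eulerProd k N)).sub (h2.mul_left (eulerProd k (N - (r + 1))))).mul_left
    ((eulerProd k (N - (r + 1)))⁻¹ * (eulerProd k (N + (r + 1)))⁻¹)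
  convert this using 1
  linear_combination (eulerProd k (N + (r + 1)))⁻¹ * eulerProd k (N + (r + 1)) * e1 + e2

theorem small_geom (n : ℕ) (a : ℕ → k⟦X⟧) : Small fun m => a m * X ^ ((n + 1) * m) :=
  small_X_pow (fun i => Nat.le_mul_of_pos_left i (Nat.succ_pos n)) _

theorem one_sub_mul_geom (n : ℕ) (a : ℕ → k⟦X⟧) :
    (1 - X ^ (n + 1)) * psum (fun m => a m * X ^ ((n + 1) * m))
      = a 0 + psum fun m => (a (m + 1) - a m) * X ^ (n + 1) * X ^ ((n + 1) * m) := by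
  rw [sub_mul, one_mul, mul_psum (small_geom k n _)]
  nth_rewrite 1 [psum_succ (small_geom k n _)]
  rw [add_sub_assoc, ← psum_sub]
  congr 1
  · ring
  · exact psum_congr fun i => by ring

theorem eq_mul_inv_of_one_sub_mul {n : ℕ} {f g : k⟦X⟧} (h : (1 - X ^ (n + 1)) * f = g) :
    f = g * (1 - X ^ (n + 1))⁻¹ := by
  linear_combination (1 - X ^ (n + 1))⁻¹ * h - f * one_sub_X_pow_mul_inv k n

theorem geom_series (n : ℕ) (b : k⟦X⟧) :
    psum (fun m => b * X ^ ((n + 1) * m)) = b * (1 - X ^ (n + 1) : k⟦X⟧)⁻¹ := by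
  apply eq_mul_inv_of_one_sub_mul
  rw [one_sub_mul_geom k n (fun _ => b)]
  simp [psum_zero]

theorem geom_series_linear (n : ℕ) (a b : k⟦X⟧) :
    psum (fun m : ℕ => (a + (m : k⟦X⟧) * b) * X ^ ((n + 1) * m))
      = a * (1 - X ^ (n + 1) : k⟦X⟧)⁻¹ + b * X ^ (n + 1) * ((1 - X ^ (n + 1) : k⟦X⟧)⁻¹) ^ 2 := by
  have h : (1 - X ^ (n + 1)) * psum (fun m : ℕ => (a + (m : k⟦X⟧) * b) * X ^ ((n + 1) * m))
      = a + b * X ^ (n + 1) * (1 - X ^ (n + 1) : k⟦X⟧)⁻¹ := by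
    rw [one_sub_mul_geom k n, ← geom_series]
    congr 1
    · simp
    · exact psum_congr fun i => by push_cast; ring
  rw [eq_mul_inv_of_one_sub_mul k h]
  ring

theorem dvd_rankSeries_sub (N : ℕ) : X ^ N ∣ rankSeries k -
    ∑ r ∈ range N, (-1) ^ (r + 1) * X ^ ((r + 1) * (3 * (r + 1) + 1) / 2) *
          (1 + X ^ (r + 1)) * ((1 - X ^ (r + 1) : k⟦X⟧)⁻¹) ^ 2 := by
  have h1 : ∀ r : ℕ, (-1) ^ (r + 1) * X ^ ((r + 1) * (3 * (r + 1) + 1) / 2) *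
      (1 + X ^ (r + 1)) * ((1 - X ^ (r + 1) : k⟦X⟧)⁻¹) ^ 2
      = psum fun j => ((2 * j + 1 : ℕ) : k⟦X⟧) *
        ((-1) ^ (r + 1) * X ^ ((r + 1) * (3 * (r + 1) + 1) / 2 + (r + 1) * j)) := by
    intro r
    have h := geom_series_linear k r ((-1) ^ (r + 1) * X ^ ((r + 1) * (3 * (r + 1) + 1) / 2))
      (2 * ((-1) ^ (r + 1) * X ^ ((r + 1) * (3 * (r + 1) + 1) / 2)))
    have e := one_sub_X_pow_mul_inv k r
    rw [psum_congr (g := fun m : ℕ => ((-1) ^ (r + 1) * X ^ ((r + 1) * (3 * (r + 1) + 1) / 2) +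
      (m : k⟦X⟧) * (2 * ((-1) ^ (r + 1) * X ^ ((r + 1) * (3 * (r + 1) + 1) / 2)))) * X ^ ((r + 1) * m))
      (fun j => by push_cast; ring), h]
    linear_combination (-1) ^ (r + 1) * X ^ ((r + 1) * (3 * (r + 1) + 1) / 2) *
      (1 - X ^ (r + 1))⁻¹ * e
  have hs : ∀ j : ℕ, Small (fun r => (-1) ^ (r + 1) *
      X ^ ((r + 1) * (3 * (r + 1) + 1) / 2 + (r + 1) * j) : ℕ → k⟦X⟧) := fun j =>
    small_X_pow (fun i => by have := le_pent (i + 1); omega) _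
  have hs' : ∀ r : ℕ, Small (fun j => ((2 * j + 1 : ℕ) : k⟦X⟧) *
        ((-1) ^ (r + 1) * X ^ ((r + 1) * (3 * (r + 1) + 1) / 2 + (r + 1) * j))) := fun r => by
    refine Small.of_dvd fun j => Dvd.dvd.mul_left (Dvd.dvd.mul_left (pow_dvd_pow _ ?_) _) _
    nlinarith [Nat.zero_le ((r + 1) * (3 * (r + 1) + 1) / 2)]
  rw [X_pow_dvd_iff]
  intro n hn
  rw [map_sub, map_sum, sub_eq_zero, rankSeries, coeff_psum (small_rankSeries k) hn]
  simp only [h1, coeff_psum (hs' _) hn, ptheta_sub_one, mul_psum (hs _)]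
  rw [sum_comm]
  exact sum_congr rfl fun j _ => coeff_psum (small_mul_left (hs j) _) hn

theorem dvd_lambert_sub (N : ℕ) : X ^ N ∣
    ∑ n ∈ range N, ((n + 1 : ℕ) : k⟦X⟧) * X ^ (n + 1) * (1 - X ^ (n + 1) : k⟦X⟧)⁻¹ -
      ∑ n ∈ range N, X ^ (n + 1) * ((1 - X ^ (n + 1) : k⟦X⟧)⁻¹) ^ 2 := by
  have h1 : ∀ n : ℕ, ((n + 1 : ℕ) : k⟦X⟧) * X ^ (n + 1) * (1 - X ^ (n + 1) : k⟦X⟧)⁻¹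
      = psum fun m => ((n + 1 : ℕ) : k⟦X⟧) * X ^ ((n + 1) * (m + 1)) := by
    intro n
    rw [← geom_series]
    exact psum_congr fun m => by ring
  have h2 : ∀ n : ℕ, X ^ (n + 1) * ((1 - X ^ (n + 1) : k⟦X⟧)⁻¹) ^ 2
      = psum fun m => ((m + 1 : ℕ) : k⟦X⟧) * X ^ ((n + 1) * (m + 1)) := by
    intro n
    have h := geom_series_linear k n (X ^ (n + 1)) (X ^ (n + 1))
    have e := one_sub_X_pow_mul_inv k n
    rw [psum_congr (g := fun m : ℕ => (X ^ (n + 1) + (m : k⟦X⟧) * X ^ (n + 1)) * X ^ ((n + 1) * m))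
      (fun m => by push_cast; ring), h]
    linear_combination X ^ (n + 1) * (1 - X ^ (n + 1))⁻¹ * e
  have hs : ∀ (n : ℕ) (a : ℕ → k⟦X⟧), Small (fun m => a m * X ^ ((n + 1) * (m + 1))) := fun n a =>
    small_X_pow (fun i => by nlinarith) _
  rw [X_pow_dvd_iff]
  intro n hn
  simp only [h1, h2, map_sub, map_sum, sub_eq_zero, coeff_psum (hs _ _) hn]
  rw [sum_comm]
  exact sum_congr rfl fun i _ => sum_congr rfl fun j _ => by rw [mul_comm (i + 1)]

theorem qD_eulerProd (N : ℕ) : qD (eulerProd k N) =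
    -(eulerProd k N * ∑ n ∈ range N, ((n + 1 : ℕ) : k⟦X⟧) * X ^ (n + 1) * (1 - X ^ (n + 1) : k⟦X⟧)⁻¹)
    := by
  induction N with
  | zero => simp [eulerProd]
  | succ N ih =>
    rw [eulerProd_succ, qD_mul, ih, sum_range_succ, map_sub, qD_X_pow, Derivation.map_one_eq_zero]
    linear_combination eulerProd k N * ((N + 1 : ℕ) : k⟦X⟧) * X ^ (N + 1) * one_sub_X_pow_mul_inv k N

theorem dvd_sigmaSeries_sub (N : ℕ) : X ^ N ∣ sigmaSeries k -
    ∑ n ∈ range N, X ^ (n + 1) * ((1 - X ^ (n + 1) : k⟦X⟧)⁻¹) ^ 2 := by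
  have h0 := (pow_dvd_pow (X : k⟦X⟧) (Nat.le_succ N)).trans (dvd_euler_sub k N)
  have h1 : (X : k⟦X⟧) ^ N ∣ qD (euler k - eulerProd k N) := by
    rw [X_pow_dvd_iff] at h0 ⊢
    intro n hn
    rw [coeff_qD, h0 n hn, mul_zero]
  rw [map_sub, qD_eulerProd, qD_euler] at h1
  have e := euler_mul_inv k
  have h2 := dvd_lambert_sub k N
  generalize ∑ n ∈ range N, ((n + 1 : ℕ) : k⟦X⟧) * X ^ (n + 1) * (1 - X ^ (n + 1) : k⟦X⟧)⁻¹ = s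
    at h1 h2
  have h3 := (((h1.add (h0.mul_right s)).mul_right (euler k)⁻¹).sub h2).neg_right
  convert h3 using 1
  linear_combination (s - sigmaSeries k) * e

/-- The Garvan-type identity expressing the generating function of `spt`. -/
theorem euler_mul_sptSeries : euler k * sptSeries k = sigmaSeries k + rankSeries k := by
  refine eq_of_forall_X_pow_dvd fun N => ?_
  have h1 := dvd_euler_mul_sptSeries k N
  rw [eulerProd_identity] at h1
  have h4 : X ^ N ∣ ∑ r ∈ range N, (-1) ^ (r + 1) * X ^ ((r + 1) * (3 * (r + 1) + 1) / 2) *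
          (1 + X ^ (r + 1)) * ((1 - X ^ (r + 1) : k⟦X⟧)⁻¹) ^ 2 *
          (eulerProd k N ^ 2 * ((eulerProd k (N - (r + 1)))⁻¹ * (eulerProd k (N + (r + 1)))⁻¹)) -
        ∑ r ∈ range N, (-1) ^ (r + 1) * X ^ ((r + 1) * (3 * (r + 1) + 1) / 2) *
          (1 + X ^ (r + 1)) * ((1 - X ^ (r + 1) : k⟦X⟧)⁻¹) ^ 2 := by
    rw [← sum_sub_distrib]
    refine dvd_sum fun r hr => ?_
    have h5 := dvd_eulerProd_ratio k N r (mem_range.1 hr)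
    have h6 : (X : k⟦X⟧) ^ r ∣ X ^ ((r + 1) * (3 * (r + 1) + 1) / 2) :=
      pow_dvd_pow _ (by have := le_pent (r + 1); omega)
    have h7 := mul_dvd_mul h6 h5
    rw [← pow_add, Nat.add_sub_cancel' (mem_range.1 hr).le] at h7
    have h8 := h7.mul_left ((-1) ^ (r + 1) * (1 + X ^ (r + 1)) * ((1 - X ^ (r + 1))⁻¹) ^ 2)
    convert h8 using 1
    ring
  have h9 := ((h1.add h4).sub (dvd_sigmaSeries_sub k N)).sub (dvd_rankSeries_sub k N)
  convert h9 using 1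
  ring

end SptIdentity

section Leibniz

variable {A : Type*} [CommRing A]

/-- An additive map satisfying the Leibniz rule. -/
def IsDeriv (d : A →+ A) : Prop := ∀ f g, d (f * g) = d f * g + f * d g

namespace IsDeriv

variable {d : A →+ A} 

theorem one (hd : IsDeriv d) : d 1 = 0 := by
  have := hd 1 1
  simpa using this

theorem natCast (hd : IsDeriv d) (n : ℕ) : d n = 0 := by
  rw [← nsmul_one, map_nsmul, hd.one, smul_zero]

theorem ofNat (hd : IsDeriv d) (n : ℕ) [n.AtLeastTwo] : d ofNat(n) = 0 := hd.natCast n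

theorem natCast_mul (hd : IsDeriv d) (n : ℕ) (f : A) : d (n * f) = n * d f := by
  rw [hd, hd.natCast, zero_mul, zero_add]

theorem ofNat_mul (hd : IsDeriv d) (n : ℕ) [n.AtLeastTwo] (f : A) : d (ofNat(n) * f) = ofNat(n) * d f :=
  hd.natCast_mul n f

theorem pow (hd : IsDeriv d) (f : A) (n : ℕ) : d (f ^ (n + 1)) = ((n + 1 : ℕ) : A) * f ^ n * d f := by
  induction n with
  | zero => simp
  | succ n ih => rw [pow_succ, hd, ih]; push_cast; ring

theorem sq (hd : IsDeriv d) (f : A) : d (f ^ 2) = 2 * f * d f := by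
  have := hd.pow f 1
  norm_num at this; exact this

theorem of_mul_eq_one (hd : IsDeriv d) {f g : A} (h : f * g = 1) : d g = -g ^ 2 * d f := by
  have := hd f g
  rw [h, hd.one] at this
  linear_combination (-g) * this - d g * h

end IsDeriv

end Leibniz

section Laurent

variable (k : Type*) [Field k]

/-- The operator `T d/dT` on Laurent series, as an additive map. -/
noncomputable def tDeriv : LaurentSeries k →+ LaurentSeries k where
  toFun f := ⟨fun j => (j : k) * f.coeff j, f.isPWO_support.mono fun j hj => by
    simp only [Function.mem_support, HahnSeries.mem_support] at hj ⊢
    exact right_ne_zero_of_mul hj⟩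
  map_zero' := by ext j; simp
  map_add' f g := by ext j; simp [mul_add]

theorem coeff_tDeriv (f : LaurentSeries k) (j : ℤ) :
    (tDeriv k f).coeff j = j * f.coeff j := rfl

theorem support_tDeriv (f : LaurentSeries k) : (tDeriv k f).support ⊆ f.support := by
  intro j hj
  simp only [HahnSeries.mem_support, coeff_tDeriv] at hj ⊢
  exact right_ne_zero_of_mul hj

theorem isDeriv_tDeriv : IsDeriv (tDeriv k) := fun f g => by
  ext j
  rw [coeff_tDeriv, HahnSeries.coeff_add,
    HahnSeries.coeff_mul_right' g.isPWO_support (support_tDeriv k g),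
    HahnSeries.coeff_mul_left' f.isPWO_support (support_tDeriv k f), HahnSeries.coeff_mul,
    mul_sum, ← sum_add_distrib]
  refine sum_congr rfl fun ij h => ?_
  have := (Finset.mem_antidiagonal.1 h).2.2
  rw [coeff_tDeriv, coeff_tDeriv, ← this]
  push_cast; ring

/-- The Laurent variable. -/
noncomputable def lT : LaurentSeries k := HahnSeries.single 1 1

/-- The inverse of the Laurent variable. -/
noncomputable def lT' : LaurentSeries k := HahnSeries.single (-1) 1

theorem lT_mul : lT k * lT' k = 1 := by
  rw [lT, lT', HahnSeries.single_mul_single]; simp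

theorem coeff_lT_mul (f : LaurentSeries k) (j : ℤ) : (lT k * f).coeff j = f.coeff (j - 1) := by
  rw [lT, HahnSeries.coeff_single_mul, one_mul]

theorem coeff_lT'_mul (f : LaurentSeries k) (j : ℤ) : (lT' k * f).coeff j = f.coeff (j + 1) := by
  rw [lT', HahnSeries.coeff_single_mul, one_mul, sub_neg_eq_add]

theorem tDeriv_lT : tDeriv k (lT k) = lT k := by
  ext j
  rw [coeff_tDeriv, lT, HahnSeries.coeff_single]
  split_ifs with h <;> simp [h]

theorem tDeriv_lT' : tDeriv k (lT' k) = -lT' k := by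
  ext j
  rw [coeff_tDeriv, lT', HahnSeries.coeff_neg, HahnSeries.coeff_single]
  split_ifs with h <;> simp [h]

/-- `T + T⁻¹ - 2`. -/
noncomputable def lv : LaurentSeries k := lT k + lT' k - 2

/-- The expansion of `1 / (1 - T)`. -/
noncomputable def lg : LaurentSeries k := HahnSeries.ofPowerSeries ℤ k (mk 1)

theorem coeff_lg (j : ℤ) : (lg k).coeff j = if 0 ≤ j then 1 else 0 := by
  rw [lg, HahnSeries.ofPowerSeries_apply]
  split_ifs with h
  · lift j to ℕ using h
    rw [← HahnSeries.ofPowerSeries_apply, HahnSeries.ofPowerSeries_apply_coeff]; simp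
  · apply HahnSeries.embDomain_of_notMem_range
    rintro ⟨n, hn⟩
    apply h; rw [← hn]; simp

theorem one_sub_lT_mul_lg : (1 - lT k) * lg k = 1 := by
  ext j
  rw [sub_mul, one_mul, HahnSeries.coeff_sub, coeff_lT_mul, coeff_lg, coeff_lg, HahnSeries.coeff_one]
  split_ifs <;> first | omega | simp

theorem lT_mul_lv : lT k * lv k = (1 - lT k) ^ 2 := by
  rw [lv]; linear_combination lT_mul k

theorem tDeriv_lv : tDeriv k (lv k) = lT k - lT' k := by
  rw [lv, map_sub, map_add, tDeriv_lT, tDeriv_lT', (isDeriv_tDeriv k).ofNat]; ring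

theorem tDeriv_tDeriv_lv : tDeriv k (tDeriv k (lv k)) = lv k + 2 := by
  rw [tDeriv_lv, map_sub, tDeriv_lT, tDeriv_lT', lv]; ring

theorem tDeriv_lv_sq : tDeriv k (lv k) ^ 2 = lv k ^ 2 + 4 * lv k := by
  rw [tDeriv_lv, lv]; linear_combination (-4 : LaurentSeries k) * lT_mul k

theorem lv_mul : lv k * (lT k * lg k ^ 2) = 1 := by
  have h := one_sub_lT_mul_lg k
  have : lv k * (lT k * lg k ^ 2) = ((1 - lT k) * lg k) ^ 2 := by
    rw [mul_pow, ← lT_mul_lv]; ring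
  rw [this, h, one_pow]

theorem tDeriv_lg : tDeriv k (lg k) = lT k * lg k ^ 2 := by
  have h := congrArg (tDeriv k) (one_sub_lT_mul_lg k)
  rw [isDeriv_tDeriv, map_sub, (isDeriv_tDeriv k).one, tDeriv_lT] at h
  linear_combination lg k * h - tDeriv k (lg k) * one_sub_lT_mul_lg k

/-- Substitution of `T + T⁻¹ - 2` in polynomials. -/
noncomputable def lE : Polynomial k →+* LaurentSeries k :=
  Polynomial.eval₂RingHom HahnSeries.C (lv k)

theorem lE_X : lE k Polynomial.X = lv k := by simp [lE]

theorem lE_C (a : k) : lE k (Polynomial.C a) = HahnSeries.C a := by simp [lE]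

theorem lE_monomial (n : ℕ) (a : k) :
    lE k (Polynomial.monomial n a) = HahnSeries.C a * lv k ^ n := by simp [lE]

theorem tDeriv_C (a : k) : tDeriv k (HahnSeries.C a) = 0 := by
  ext j
  rw [coeff_tDeriv, HahnSeries.C_apply, HahnSeries.coeff_single]
  split_ifs with h <;> simp [h]

theorem tDeriv_lE (f : Polynomial k) :
    tDeriv k (lE k f) = lE k (Polynomial.derivative f) * tDeriv k (lv k) := by
  induction f using Polynomial.induction_on' with
  | add p q hp hq => simp only [map_add, hp, hq, add_mul]
  | monomial n a =>
    rw [Polynomial.derivative_monomial, lE_monomial, lE_monomial, isDeriv_tDeriv, tDeriv_C]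
    cases n with
    | zero => simp [(isDeriv_tDeriv k).one]
    | succ n =>
      rw [(isDeriv_tDeriv k).pow]
      simp only [map_mul, map_natCast, Nat.add_sub_cancel]
      ring

theorem coeff_neg_lE (f : Polynomial k) (j : ℤ) : (lE k f).coeff (-j) = (lE k f).coeff j := by
  induction f using Polynomial.induction_on' generalizing j with
  | add p q hp hq => rw [map_add, HahnSeries.coeff_add, HahnSeries.coeff_add, hp, hq]
  | monomial n a =>
    rw [lE_monomial, HahnSeries.C_apply, HahnSeries.coeff_single_zero_mul,
      HahnSeries.coeff_single_zero_mul]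
    congr 1
    induction n generalizing j with
    | zero => simp [HahnSeries.coeff_one]
    | succ n ih =>
      have key : ∀ j, (lv k ^ (n + 1)).coeff j = (lv k ^ n).coeff (j - 1) + (lv k ^ n).coeff (j + 1)
          - 2 * (lv k ^ n).coeff j := by
        intro j
        have : lv k ^ (n + 1) = lT k * lv k ^ n + lT' k * lv k ^ n - (lv k ^ n + lv k ^ n) := by
          rw [pow_succ', lv]; ring
        rw [this, HahnSeries.coeff_sub, HahnSeries.coeff_add, HahnSeries.coeff_add, coeff_lT_mul,
          coeff_lT'_mul]; ring
      rw [key, key, ih, ← ih (j - 1), ← ih (j + 1), show -(j - 1) = -j + 1 by ring,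
        show -(j + 1) = -j - 1 by ring]
      ring

end Laurent

section Coefficientwise

variable {A : Type*} [CommRing A]

/-- An additive map applied to all coefficients of a power series. -/
noncomputable def mapD (d : A →+ A) : A⟦X⟧ →+ A⟦X⟧ where
  toFun f := mk fun n => d (coeff n f)
  map_zero' := by ext n; simp
  map_add' f g := by ext n; simp

@[simp] theorem coeff_mapD (d : A →+ A) (f : A⟦X⟧) (n : ℕ) :
    coeff n (mapD d f) = d (coeff n f) := by simp [mapD]

theorem IsDeriv.mapD {d : A →+ A} (hd : IsDeriv d) : IsDeriv (mapD d) := fun f g => by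
  ext n
  rw [coeff_mapD, map_add, coeff_mul, coeff_mul, coeff_mul, map_sum, ← sum_add_distrib]
  exact sum_congr rfl fun i _ => by rw [hd, coeff_mapD, coeff_mapD]

theorem mapD_C {d : A →+ A} (a : A) : mapD d (C a) = C (d a) := by
  ext n
  rw [coeff_mapD, coeff_C, coeff_C]
  split_ifs <;> simp

/-- The Euler operator as an additive map. -/
noncomputable def Dq : A⟦X⟧ →+ A⟦X⟧ := (qD (R := A)).toLinearMap.toAddMonoidHom

theorem Dq_apply (f : A⟦X⟧) : Dq f = qD f := rfl

theorem isDeriv_Dq : IsDeriv (Dq (A := A)) := fun f g => qD_mul f g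

theorem mapD_Dq {d : A →+ A} (hd : IsDeriv d) (f : A⟦X⟧) : mapD d (Dq f) = Dq (mapD d f) := by
  ext n
  rw [coeff_mapD, Dq_apply, Dq_apply, coeff_qD, coeff_qD, hd.natCast_mul, coeff_mapD]

theorem mapD_psum (d : A →+ A) (f : ℕ → A⟦X⟧) :
    mapD d (psum f) = psum (fun i => mapD d (f i)) := by
  ext n; simp [psum]

end Coefficientwise

section TwoVariables

variable (k : Type*) [Field k]

/-- Power series in `q` whose coefficients are Laurent series in `T`. -/
abbrev Omg := PowerSeries (LaurentSeries k)

/-- Power series in `q` whose coefficients are polynomials in `v = T + T⁻¹ - 2`. -/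
abbrev Evn := PowerSeries (Polynomial k)

/-- The derivation `T d/dT`. -/
noncomputable def dT : Omg k →+ Omg k := mapD (tDeriv k)

theorem isDeriv_dT : IsDeriv (dT k) := (isDeriv_tDeriv k).mapD

theorem dT_Dq (f : Omg k) : dT k (Dq f) = Dq (dT k f) := mapD_Dq (isDeriv_tDeriv k) f

/-- The embedding of power series in `q`. -/
noncomputable def kap : k⟦X⟧ →+* Omg k := map HahnSeries.C

/-- The embedding of power series in `q` in the even subring. -/
noncomputable def kev : k⟦X⟧ →+* Evn k := map Polynomial.C

/-- The substitution `v = T + T⁻¹ - 2`. -/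
noncomputable def evE : Evn k →+* Omg k := map (lE k)

/-- Evaluation at `v = 0`. -/
noncomputable def ev0 : Evn k →+* k⟦X⟧ := map Polynomial.constantCoeff

/-- The coefficient of `v`. -/
noncomputable def ev1 : Evn k →+ k⟦X⟧ where
  toFun f := mk fun n => (coeff n f).coeff 1
  map_zero' := by ext n; simp
  map_add' f g := by ext n; simp

theorem coeff_ev1 (f : Evn k) (n : ℕ) : coeff n (ev1 k f) = (coeff n f).coeff 1 := by simp [ev1]

/-- The coefficient of `T ^ j`. -/
noncomputable def cf (j : ℤ) : Omg k →+ k⟦X⟧ where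
  toFun f := mk fun n => (coeff n f).coeff j
  map_zero' := by ext n; simp
  map_add' f g := by ext n; simp

theorem coeff_cf (j : ℤ) (f : Omg k) (n : ℕ) : coeff n (cf k j f) = (coeff n f).coeff j := by
  simp [cf]

theorem cf_ext {f g : Omg k} (h : ∀ j, cf k j f = cf k j g) : f = g := by
  ext n j
  rw [← coeff_cf, h, coeff_cf]

theorem cf_kap_mul (j : ℤ) (a : k⟦X⟧) (f : Omg k) : cf k j (kap k a * f) = a * cf k j f := by
  ext n
  rw [coeff_cf, coeff_mul, coeff_mul, HahnSeries.coeff_sum]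
  refine sum_congr rfl fun i _ => ?_
  rw [kap, coeff_map, HahnSeries.C_apply, HahnSeries.coeff_single_zero_mul, coeff_cf]

theorem cf_Dq (j : ℤ) (f : Omg k) : cf k j (Dq f) = qD (cf k j f) := by
  ext n
  rw [coeff_cf, Dq_apply, coeff_qD, coeff_qD, coeff_cf, ← map_natCast HahnSeries.C,
    HahnSeries.C_apply, HahnSeries.coeff_single_zero_mul]

theorem cf_dT (j : ℤ) (f : Omg k) : cf k j (dT k f) = (j : k⟦X⟧) * cf k j f := by
  ext n
  rw [coeff_cf, dT, coeff_mapD, coeff_tDeriv, ← map_intCast (C : k →+* k⟦X⟧), coeff_C_mul, coeff_cf]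

theorem cf_C (j : ℤ) (a : LaurentSeries k) : cf k j (C a) = C (a.coeff j) := by
  ext n
  rw [coeff_cf, coeff_C, coeff_C]
  split_ifs <;> simp

theorem cf_T_mul (j : ℤ) (f : Omg k) : cf k j (C (lT k) * f) = cf k (j - 1) f := by
  ext n
  rw [coeff_cf, coeff_C_mul, coeff_lT_mul, coeff_cf]

theorem cf_T'_mul (j : ℤ) (f : Omg k) : cf k j (C (lT' k) * f) = cf k (j + 1) f := by
  ext n
  rw [coeff_cf, coeff_C_mul, coeff_lT'_mul, coeff_cf]

theorem cf_neg_evE (j : ℤ) (f : Evn k) : cf k (-j) (evE k f) = cf k j (evE k f) := by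
  ext n
  rw [coeff_cf, coeff_cf, evE, coeff_map, coeff_neg_lE]

theorem cf_kap (j : ℤ) (a : k⟦X⟧) : cf k j (kap k a) = if j = 0 then a else 0 := by
  rw [← mul_one (kap k a), cf_kap_mul, ← map_one (C : LaurentSeries k →+* _), cf_C,
    HahnSeries.coeff_one]
  split_ifs <;> simp

theorem dT_C (a : LaurentSeries k) : dT k (C a) = C (tDeriv k a) := mapD_C a

theorem Dq_C (a : LaurentSeries k) : Dq (C a : Omg k) = 0 := qD_C a

theorem dT_kap (a : k⟦X⟧) : dT k (kap k a) = 0 := by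
  ext n
  rw [dT, coeff_mapD, kap, coeff_map, tDeriv_C, map_zero]

theorem Dq_kap (a : k⟦X⟧) : Dq (kap k a) = kap k (qD a) := by
  rw [Dq_apply, kap, map_qD]

theorem evE_kev (a : k⟦X⟧) : evE k (kev k a) = kap k a := by
  ext1 n
  simp only [evE, kev, kap, coeff_map, lE_C]

theorem ev0_kev (a : k⟦X⟧) : ev0 k (kev k a) = a := by
  ext1 n
  simp [ev0, kev]

theorem ev1_kev (a : k⟦X⟧) : ev1 k (kev k a) = 0 := by
  ext1 n
  rw [coeff_ev1, kev, coeff_map, Polynomial.coeff_C]; simp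

theorem evE_C (f : Polynomial k) : evE k (C f) = C (lE k f) := by rw [evE, map_C]

theorem ev0_C (f : Polynomial k) : ev0 k (C f) = C (f.coeff 0) := by
  rw [ev0, map_C, Polynomial.constantCoeff_apply]

theorem ev1_mul (f g : Evn k) : ev1 k (f * g) = ev1 k f * ev0 k g + ev0 k f * ev1 k g := by
  ext n
  rw [coeff_ev1, map_add, coeff_mul, coeff_mul, coeff_mul, Polynomial.finsetSum_coeff,
    ← sum_add_distrib]
  refine sum_congr rfl fun i _ => ?_
  rw [Polynomial.mul_coeff_one, coeff_ev1, coeff_ev1, ev0, coeff_map, coeff_map,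
    Polynomial.constantCoeff_apply, Polynomial.constantCoeff_apply]
  ring

theorem exists_eq_add_X_mul (f : Evn k) :
    ∃ g, f = kev k (ev0 k f) + C Polynomial.X * g ∧ ev0 k g = ev1 k f := by
  refine ⟨mk fun n => (coeff n f).divX, ?_, ?_⟩
  · ext1 n
    rw [map_add, coeff_C_mul, coeff_mk, kev, ev0, coeff_map, coeff_map,
      Polynomial.constantCoeff_apply, add_comm, Polynomial.X_mul_divX_add]
  · ext1 n
    rw [coeff_ev1, ev0, coeff_map, coeff_mk, Polynomial.constantCoeff_apply, Polynomial.coeff_divX]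

/-- The derivation `d/dv`. -/
noncomputable def dv : Evn k →+ Evn k :=
  mapD (Polynomial.derivative (R := k)).toAddMonoidHom

theorem dT_evE (f : Evn k) : dT k (evE k f) = evE k (dv k f) * C (tDeriv k (lv k)) := by
  ext1 n
  rw [coeff_mul_C, dT, evE, coeff_mapD, coeff_map, coeff_map, tDeriv_lE, dv, coeff_mapD]; rfl

theorem ev0_dv (f : Evn k) : ev0 k (dv k f) = ev1 k f := by
  ext1 n
  rw [coeff_ev1, ev0, coeff_map, dv, coeff_mapD, Polynomial.constantCoeff_apply]
  simp [Polynomial.coeff_derivative]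

theorem cf_zero_evE_mul (f : Evn k) : cf k 0 (evE k f * C (tDeriv k (lv k))) = 0 := by
  rw [tDeriv_lv, map_sub, mul_sub, map_sub, mul_comm, cf_T_mul, mul_comm, cf_T'_mul,
    show (0 : ℤ) - 1 = -1 by rfl, show (0 : ℤ) + 1 = 1 by rfl, cf_neg_evE, sub_self]

end TwoVariables

section Theta

variable (k : Type*) [Field k]

/-- The polynomial in `v` representing `(T ^ (-i) - T ^ (i + 1)) / (1 - T)`. -/
noncomputable def chi : ℕ → Polynomial k
  | 0 => 1
  | 1 => Polynomial.X + 3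
  | n + 2 => (Polynomial.X + 2) * chi (n + 1) - chi n

theorem one_sub_lT_mul_chi (i : ℕ) :
    (1 - lT k) * lE k (chi k i) = lT' k ^ i - lT k ^ (i + 1) := by
  have h := lT_mul k
  induction i using Nat.twoStepInduction with
  | zero => simp [chi]
  | one => 
    rw [chi, map_add, lE_X, map_ofNat, lv]
    linear_combination (-1 : LaurentSeries k) * h
  | more n ih1 ih2 =>
    rw [chi, map_sub, map_mul, map_add, lE_X, map_ofNat, lv]
    linear_combination (lT k + lT' k) * ih2 - ih1 + (lT' k ^ n - lT k ^ (n + 1)) * h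

theorem chi_coeff_zero (i : ℕ) : (chi k i).coeff 0 = 2 * i + 1 := by
  induction i using Nat.twoStepInduction with
  | zero => simp [chi]
  | one => simp [chi]; norm_num
  | more n ih1 ih2 =>
    rw [chi, Polynomial.coeff_sub, Polynomial.mul_coeff_zero, ih1, ih2]
    simp; ring

theorem chi_coeff_one (i : ℕ) : 6 * (chi k i).coeff 1 = i * (i + 1) * (2 * i + 1) := by
  induction i using Nat.twoStepInduction with
  | zero => simp [chi, Polynomial.coeff_one]
  | one =>
    simp [chi]; norm_num
  | more n ih1 ih2 =>
    rw [chi, Polynomial.coeff_sub, Polynomial.mul_coeff_one, chi_coeff_zero]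
    simp
    push_cast at ih2
    linear_combination 2 * ih2 - ih1

/-- Triangular numbers. -/
def tri : ℕ → ℕ
  | 0 => 0
  | n + 1 => tri n + (n + 1)

theorem le_tri (n : ℕ) : n ≤ tri n := by
  cases n <;> simp [tri]

theorem two_mul_tri (n : ℕ) : 2 * tri n = n * (n + 1) := by
  induction n with
  | zero => rfl
  | succ n ih => rw [tri, mul_add, ih]; ring

/-- The theta series divided by `1 - T`. -/
noncomputable def pser : Evn k := psum fun i => C ((-1) ^ i * chi k i) * X ^ tri i

theorem small_pser : Small fun i => C ((-1) ^ i * chi k i) * X ^ tri i := small_X_pow le_tri _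

/-- The theta series `∑ (-1) ^ i q ^ (i (i + 1) / 2) (T ^ (-i) - T ^ (i + 1))`. -/
noncomputable def theta : Omg k := C (1 - lT k) * evE k (pser k)

theorem theta_eq : theta k = psum fun i =>
    C ((-1) ^ i * (lT' k ^ i - lT k ^ (i + 1))) * X ^ tri i := by
  rw [theta, pser, evE, map_psum, mul_psum ((small_pser k).map _)]
  refine psum_congr fun i => ?_
  rw [map_mul, map_C, map_pow, map_X, ← mul_assoc, ← map_mul, ← one_sub_lT_mul_chi,
    map_mul (lE k), map_pow, map_neg, map_one, mul_left_comm]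

theorem tDeriv_lT_pow (i : ℕ) : tDeriv k (lT k ^ i) = i * lT k ^ i := by
  cases i with
  | zero => simp [(isDeriv_tDeriv k).one]
  | succ i => rw [(isDeriv_tDeriv k).pow, tDeriv_lT]; ring

theorem tDeriv_lT'_pow (i : ℕ) : tDeriv k (lT' k ^ i) = -(i * lT' k ^ i) := by
  cases i with
  | zero => simp [(isDeriv_tDeriv k).one]
  | succ i => rw [(isDeriv_tDeriv k).pow, tDeriv_lT']; ring

theorem tDeriv_neg_one_pow_mul (i : ℕ) (f : LaurentSeries k) :
    tDeriv k ((-1) ^ i * f) = (-1) ^ i * tDeriv k f := by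
  rcases neg_one_pow_eq_or (LaurentSeries k) i with h | h <;> rw [h] <;> simp

theorem heat : 2 * Dq (theta k) = dT k (dT k (theta k)) - dT k (theta k) := by
  rw [theta_eq, Dq_apply, qD_psum, two_mul, ← psum_add, dT, mapD_psum, mapD_psum, ← psum_sub]
  refine psum_congr fun i => ?_
  have hX : ∀ a : LaurentSeries k, mapD (tDeriv k) (C a * X ^ tri i) = C (tDeriv k a) * X ^ tri i := by
    intro a
    ext1 n
    rw [coeff_mapD, coeff_C_mul_X_pow, coeff_C_mul_X_pow]
    split_ifs <;> simp
  have hN : (2 : LaurentSeries k) * tri i = i * (i + 1) := by exact_mod_cast congrArg _ (two_mul_tri i)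
  rw [qD_mul, qD_C, qD_X_pow, hX, hX, ← sub_mul, ← map_sub, ← map_natCast C (tri i),
    show ∀ a b c : Omg k, 0 * c + a * (b * c) + (0 * c + a * (b * c)) = (a * (2 * b)) * c from
      fun a b c => by ring, ← map_ofNat C 2, ← map_mul, ← map_mul, hN]
  congr 2
  simp only [tDeriv_neg_one_pow_mul, map_sub, tDeriv_lT_pow, tDeriv_lT'_pow, map_neg,
    (isDeriv_tDeriv k).natCast_mul]
  push_cast; ring

theorem six_mul_ev1_pser : 6 * ev1 k (pser k) = 2 * qD (ev0 k (pser k)) := by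
  ext n
  rw [← map_ofNat C 6, ← map_ofNat C 2, coeff_C_mul, coeff_C_mul, coeff_qD, coeff_ev1, ev0, coeff_map,
    Polynomial.constantCoeff_apply, pser, psum, coeff_mk, Polynomial.finsetSum_coeff,
    Polynomial.finsetSum_coeff, mul_sum, mul_sum, mul_sum]
  refine sum_congr rfl fun i _ => ?_
  rw [coeff_C_mul_X_pow]
  split_ifs with h
  · have h1 := chi_coeff_one k i
    have h0 := chi_coeff_zero k i
    have hN : (2 : k) * n = i * (i + 1) := by rw [h]; exact_mod_cast congrArg _ (two_mul_tri i)
    have key : (6 : k) * (chi k i).coeff 1 = 2 * (n * (chi k i).coeff 0) := by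
      rw [h1, h0, ← mul_assoc, hN]
    rcases Nat.even_or_odd i with hi | hi
    · simpa [hi.neg_one_pow] using key
    · simpa [hi.neg_one_pow] using key
  · simp

end Theta

section Swap

variable (k : Type*) [Field k]

/-- Exchange of the two variables. -/
noncomputable def sw (f : k⟦X⟧⟦X⟧) : k⟦X⟧⟦X⟧ := mk fun b => mk fun a => coeff b (coeff a f)

theorem coeff_sw (f : k⟦X⟧⟦X⟧) (a b : ℕ) : coeff a (coeff b (sw k f)) = coeff b (coeff a f) := by
  simp [sw]

theorem ext₂ {f g : k⟦X⟧⟦X⟧} (h : ∀ a b, coeff a (coeff b f) = coeff a (coeff b g)) : f = g := by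
  ext b a; exact h a b

theorem coeff_intCast_mul₂ (ε : ℤ) (f : k⟦X⟧⟦X⟧) (a b : ℕ) :
    coeff a (coeff b ((ε : k⟦X⟧⟦X⟧) * f)) = ε * coeff a (coeff b f) := by
  rw [← map_intCast (C : k⟦X⟧ →+* k⟦X⟧⟦X⟧), coeff_C_mul, ← map_intCast (C : k →+* k⟦X⟧), coeff_C_mul]

theorem sw_mul (f g : k⟦X⟧⟦X⟧) : sw k (f * g) = sw k f * sw k g := by
  refine ext₂ k fun a b => ?_
  rw [coeff_sw, coeff_mul, coeff_mul, map_sum, map_sum]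
  simp_rw [coeff_mul, coeff_sw]
  rw [sum_comm]

theorem sw_add (f g : k⟦X⟧⟦X⟧) : sw k (f + g) = sw k f + sw k g :=
  ext₂ k fun a b => by simp [coeff_sw]

theorem sw_neg (f : k⟦X⟧⟦X⟧) : sw k (-f) = -sw k f :=
  ext₂ k fun a b => by simp [coeff_sw]

theorem sw_one : sw k 1 = 1 := ext₂ k fun a b => by
  rw [coeff_sw, coeff_one, coeff_one]
  split_ifs with h1 h2 h2 <;> simp [coeff_one, h1, h2]

/-- The substitution `z = T`, `w = q / T`. -/
noncomputable def iot : k⟦X⟧⟦X⟧ →+* Omg k :=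
  (rescale (lT' k)).comp (map (HahnSeries.ofPowerSeries ℤ k))

theorem lT'_pow (n : ℕ) : lT' k ^ n = HahnSeries.single (-(n : ℤ)) 1 := by
  rw [lT', HahnSeries.single_pow]; simp

theorem coeff_coeff_iot (f : k⟦X⟧⟦X⟧) (n : ℕ) (j : ℤ) : (coeff n (iot k f)).coeff j
    = if 0 ≤ j + n then coeff (j + n).toNat (coeff n f) else 0 := by
  rw [iot, RingHom.comp_apply, coeff_rescale, coeff_map, lT'_pow, HahnSeries.coeff_single_mul,
    one_mul, sub_neg_eq_add]
  split_ifs with h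
  · obtain ⟨m, hm⟩ := Int.eq_ofNat_of_zero_le h
    rw [hm, HahnSeries.ofPowerSeries_apply_coeff]; rfl
  · rw [HahnSeries.ofPowerSeries_apply]
    apply HahnSeries.embDomain_of_notMem_range
    rintro ⟨m, hm⟩
    apply h; rw [← hm]; simp

/-- Series invariant, up to the sign `ε`, under the substitution `T ↦ q / T`. -/
def IsSym (ε : ℤ) (f : Omg k) : Prop := ∃ g : k⟦X⟧⟦X⟧, iot k g = f ∧ sw k g = ε * g

variable {k}

theorem IsSym.mul {ε ε' : ℤ} {f g : Omg k} (hf : IsSym k ε f) (hg : IsSym k ε' g) :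
    IsSym k (ε * ε') (f * g) := by
  obtain ⟨a, rfl, ha⟩ := hf
  obtain ⟨b, rfl, hb⟩ := hg
  exact ⟨a * b, map_mul _ _ _, by rw [sw_mul, ha, hb]; push_cast; ring⟩

theorem IsSym.add {ε : ℤ} {f g : Omg k} (hf : IsSym k ε f) (hg : IsSym k ε g) :
    IsSym k ε (f + g) := by
  obtain ⟨a, rfl, ha⟩ := hf
  obtain ⟨b, rfl, hb⟩ := hg
  exact ⟨a + b, map_add _ _ _, by rw [sw_add, ha, hb]; ring⟩

theorem IsSym.neg {ε : ℤ} {f : Omg k} (hf : IsSym k ε f) : IsSym k ε (-f) := by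
  obtain ⟨a, rfl, ha⟩ := hf
  exact ⟨-a, map_neg _ _, by rw [sw_neg, ha]; ring⟩

theorem IsSym.sub {ε : ℤ} {f g : Omg k} (hf : IsSym k ε f) (hg : IsSym k ε g) :
    IsSym k ε (f - g) := by
  rw [sub_eq_add_neg]; exact hf.add hg.neg

theorem IsSym.pow {f : Omg k} (hf : IsSym k 1 f) (n : ℕ) : IsSym k 1 (f ^ n) := by
  induction n with
  | zero => exact ⟨1, by simp, by simp [sw_one]⟩
  | succ n ih => rw [pow_succ]; simpa only [one_mul] using ih.mul hf

theorem isSym_kap (a : k⟦X⟧) : IsSym k 1 (kap k a) := by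
  have hc : ∀ i n, coeff i (coeff n (mk fun n => C (coeff n a) * X ^ n : k⟦X⟧⟦X⟧))
      = if i = n then coeff n a else 0 := fun i n => by rw [coeff_mk, coeff_C_mul_X_pow]
  refine ⟨mk fun n => C (coeff n a) * X ^ n, ?_, ext₂ k fun i n => ?_⟩
  · ext n j
    rw [coeff_coeff_iot, hc, kap, coeff_map, HahnSeries.C_apply, HahnSeries.coeff_single]
    split_ifs <;> first | rfl | omega
  · rw [coeff_sw, Int.cast_one, one_mul, hc, hc]
    split_ifs with h1 h2 h2 <;> first | rfl | omega | rw [h1]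

theorem isSym_natCast (n : ℕ) : IsSym k 1 (n : Omg k) := by
  rw [← map_natCast (kap k)]; exact isSym_kap _

theorem IsSym.dT {ε : ℤ} {f : Omg k} (hf : IsSym k ε f) : IsSym k (-ε) (SptRare.dT k f) := by
  obtain ⟨g, rfl, hg⟩ := hf
  refine ⟨mk fun b => mk fun a => ((a : k) - b) * coeff a (coeff b g), ?_, ext₂ k fun a b => ?_⟩
  · ext n j
    rw [coeff_coeff_iot, SptRare.dT, coeff_mapD, coeff_tDeriv, coeff_coeff_iot, coeff_mk, coeff_mk]
    split_ifs with h
    · congr 1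
      have : (((j + n).toNat : ℤ) : k) = ((j + n : ℤ) : k) := by rw [Int.toNat_of_nonneg h]
      push_cast at this
      rw [this]; ring
    · simp
  · have h := congrArg (fun f => coeff a (coeff b f)) hg
    simp only [coeff_sw] at h
    rw [coeff_intCast_mul₂] at h
    rw [coeff_sw, coeff_intCast_mul₂, coeff_mk, coeff_mk, coeff_mk, coeff_mk, h]
    push_cast; ring

theorem IsSym.of_mul_eq_one {f g : Omg k} (hf : IsSym k 1 f) (h : f * g = 1)
    (h0 : constantCoeff (cf k 0 f) ≠ 0) : IsSym k 1 g := by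
  obtain ⟨a, rfl, ha⟩ := hf
  rw [Int.cast_one, one_mul] at ha
  rw [← coeff_zero_eq_constantCoeff_apply, coeff_cf, coeff_coeff_iot] at h0
  have hu : IsUnit a := by
    rw [isUnit_iff_constantCoeff, isUnit_iff_constantCoeff, isUnit_iff_ne_zero]
    simpa using h0
  obtain ⟨b, hb⟩ := hu.exists_right_inv
  refine ⟨b, ?_, ?_⟩
  · have := congrArg (iot k) hb
    rw [map_mul, map_one] at this
    linear_combination g * this - iot k b * h
  · have := congrArg (sw k) hb
    rw [sw_mul, ha, sw_one] at this
    rw [Int.cast_one, one_mul]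
    linear_combination b * this - sw k b * hb

theorem IsSym.cf_neg {f : Omg k} (hf : IsSym k 1 f) (j : ℕ) :
    cf k (-j) f = X ^ j * cf k j f := by
  obtain ⟨g, rfl, hg⟩ := hf
  rw [Int.cast_one, one_mul] at hg
  ext n
  rw [coeff_cf, coeff_X_pow_mul', coeff_coeff_iot]
  split_ifs with h1 h2 h2
  · rw [coeff_cf, coeff_coeff_iot, if_pos (by omega)]
    conv_lhs => rw [← hg]
    rw [coeff_sw, show (-(j : ℤ) + n).toNat = n - j by omega,
      show ((j : ℤ) + (n - j : ℕ)).toNat = n by omega]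
  · omega
  · omega
  · rfl

/-- An even series which is invariant under `T ↦ q / T` is constant. -/
theorem IsSym.eq_kap {f : Evn k} (hf : IsSym k 1 (evE k f)) :
    evE k f = kap k (cf k 0 (evE k f)) := by
  have key : ∀ j : ℕ, cf k (j + 1 : ℕ) (evE k f) = 0 := by
    intro j
    have h := hf.cf_neg (j + 1)
    rw [cf_neg_evE] at h
    have h2 : (1 - X ^ (j + 1) : k⟦X⟧) * cf k (j + 1 : ℕ) (evE k f) = 0 := by
      linear_combination h
    have h3 := one_sub_X_pow_mul_inv k j
    linear_combination (1 - X ^ (j + 1) : k⟦X⟧)⁻¹ * h2 - cf k (j + 1 : ℕ) (evE k f) * h3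
  refine cf_ext k fun j => ?_
  rw [cf_kap]
  split_ifs with h
  · rw [h]
  · obtain ⟨n, rfl | rfl⟩ := j.eq_nat_or_neg
    · obtain ⟨m, rfl⟩ := Nat.exists_eq_succ_of_ne_zero (show n ≠ 0 by simpa using h)
      exact key m
    · obtain ⟨m, rfl⟩ := Nat.exists_eq_succ_of_ne_zero (show n ≠ 0 by simpa using h)
      rw [cf_neg_evE]
      exact key m

variable (k)

theorem tri_pred (i : ℕ) : tri (i + 1) - (i + 1) = tri i := by simp [tri]

theorem isSym_theta : IsSym k 1 (theta k) := by
  set th : ℕ → k⟦X⟧⟦X⟧ := fun i =>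
    C ((-1) ^ i * (X ^ (tri i - i) - X ^ tri (i + 1))) * X ^ tri i with hth
  have hs : Small th := small_X_pow le_tri _
  refine ⟨psum th, ?_, ext₂ k fun a b => ?_⟩
  · ext1 n
    rw [iot, RingHom.comp_apply, coeff_rescale, map_psum, theta_eq, psum, coeff_mk, psum, coeff_mk,
      mul_sum]
    refine sum_congr rfl fun i _ => ?_
    rw [hth]
    rw [map_mul, map_C, map_pow (PowerSeries.map _), map_X, coeff_C_mul_X_pow, coeff_C_mul_X_pow]
    split_ifs with h
    · have hT := lT_mul k
      have h1 : lT' k ^ n * lT k ^ (tri i - i) = lT' k ^ i := by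
        have : lT' k ^ n = lT' k ^ i * lT' k ^ (tri i - i) := by
          rw [h, ← pow_add]; congr 1; have := le_tri i; omega
        rw [this, mul_assoc, ← mul_pow, mul_comm (lT' k), hT, one_pow, mul_one]
      have h2 : lT' k ^ n * lT k ^ tri (i + 1) = lT k ^ (i + 1) := by
        rw [h, tri, pow_add, ← mul_assoc, ← mul_pow, mul_comm (lT' k), hT, one_pow, one_mul]
      rw [map_mul, map_sub, map_pow, map_pow, map_pow, map_neg, map_one, HahnSeries.ofPowerSeries_X,
        ← lT]
      linear_combination (-1) ^ i * h1 - (-1) ^ i * h2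
    · simp
  · set M := a + b + 1
    have hMa : a < M := by omega
    have hMb : b < M := by omega
    let I : ℕ → ℕ → k := fun x y => if x = y then 1 else 0
    let e : ℕ → ℕ → k := fun a b => ∑ i ∈ range M, (-1) ^ (i + 1) * (I b (tri i) * I a (tri (i + 1)))
    have key : ∀ a b, a < M → b < M → coeff a (coeff b (psum th)) =
        I a 0 * I b 0 + e b a + e a b := by
      intro a b hMa hMb
      rw [coeff_psum hs (show b < M + 1 by omega), map_sum]
      have h1 : ∀ i, coeff a (coeff b (th i)) = (-1) ^ i * (I b (tri i) * I a (tri i - i))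
          + (-1) ^ (i + 1) * (I b (tri i) * I a (tri (i + 1))) := by
        intro i
        rw [hth]
        simp only [I]
        rw [coeff_C_mul_X_pow]
        by_cases h : b = tri i
        · rw [if_pos h, if_pos h, ← coeff_X_pow, ← coeff_X_pow]
          rcases Nat.even_or_odd i with hi | hi
          · rw [hi.neg_one_pow, pow_succ, hi.neg_one_pow, one_mul, map_sub]; ring
          · rw [hi.neg_one_pow, pow_succ, hi.neg_one_pow, neg_one_mul, map_neg, map_sub]; ring
        · simp [h]
      have h2 : I b (tri M) = 0 := if_neg (by have := le_tri M; omega)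
      simp_rw [h1]
      rw [sum_add_distrib, sum_range_succ', sum_range_succ (n := M), h2]
      simp only [tri_pred, e]
      have h3 : ∑ x ∈ range M, (-1 : k) ^ (x + 1) * (I b (tri (x + 1)) * I a (tri x))
        = ∑ x ∈ range M, (-1 : k) ^ (x + 1) * (I a (tri x) * I b (tri (x + 1))) :=
        sum_congr rfl fun x _ => by ring
      rw [h3]
      simp only [tri, pow_zero, one_mul, Nat.zero_sub]
      ring
    rw [coeff_sw, Int.cast_one, one_mul, key b a hMb hMa, key a b hMa hMb]
    ring

end Swap

section InverseCube

variable (k : Type*) [Field k]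

theorem constantCoeff_pser : constantCoeff (pser k) = 1 := by
  rw [← coeff_zero_eq_constantCoeff_apply, pser, coeff_psum (small_pser k) zero_lt_one]
  simp [tri, chi]

/-- The inverse of `pser`. -/
noncomputable def pinv : Evn k := invOfUnit (pser k) 1

theorem pser_mul_pinv : pser k * pinv k = 1 :=
  mul_invOfUnit _ _ (by rw [constantCoeff_pser, Units.val_one])

/-- The value at `v = 0` of `pser`. -/
noncomputable def pi0 : k⟦X⟧ := ev0 k (pser k)

/-- The value at `v = 0` of `pinv`. -/
noncomputable def pi0' : k⟦X⟧ := ev0 k (pinv k)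

theorem pi0_mul : pi0 k * pi0' k = 1 := by
  rw [pi0, pi0', ← map_mul, pser_mul_pinv, map_one]

theorem ev1_pinv : ev1 k (pinv k) = -pi0' k ^ 2 * ev1 k (pser k) := by
  have h := congrArg (ev1 k) (pser_mul_pinv k)
  rw [ev1_mul, ← map_one (kev k), ev1_kev, ← pi0, ← pi0'] at h
  linear_combination pi0' k * h - ev1 k (pinv k) * pi0_mul k

/-- The inverse of the theta series. -/
noncomputable def thinv : Omg k := C (lg k) * evE k (pinv k)

theorem theta_mul_thinv : theta k * thinv k = 1 := by
  rw [theta, thinv, mul_mul_mul_comm, ← map_mul, ← map_mul, one_sub_lT_mul_lg, pser_mul_pinv,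
    map_one, map_one, one_mul]

theorem isSym_thinv : IsSym k 1 (thinv k) := by
  refine (isSym_theta k).of_mul_eq_one (theta_mul_thinv k) ?_
  rw [← coeff_zero_eq_constantCoeff_apply, coeff_cf, coeff_zero_eq_constantCoeff_apply, theta,
    map_mul, constantCoeff_C, evE, ← coeff_zero_eq_constantCoeff_apply, coeff_map,
    coeff_zero_eq_constantCoeff_apply, constantCoeff_pser, map_one, mul_one,
    HahnSeries.coeff_sub, HahnSeries.coeff_one, lT, HahnSeries.coeff_single]
  simp

/-- The product of `T` and the inverse cube of the theta series. -/
noncomputable def cube : Omg k := C (lT k) * thinv k ^ 3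

theorem cf_cube_zero : cf k 0 (cube k) = X * cf k 2 (cube k) := by
  have h := ((isSym_thinv k).pow 3).cf_neg 1
  rw [cube, cf_T_mul, cf_T_mul]
  simpa using h

theorem cf_cube_neg (j : ℕ) : cf k (Int.negSucc j) (cube k) = X ^ (j + 2) * cf k (j + 3 : ℕ) (cube k) := by
  have h := ((isSym_thinv k).pow 3).cf_neg (j + 2)
  rw [cube, cf_T_mul, cf_T_mul]
  convert h using 2
  · rw [Int.negSucc_eq]; push_cast; ring_nf
  · congr 1; push_cast; ring_nf

theorem lv_mul_lg : lv k * lg k = lT' k - 1 := by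
  linear_combination (lT' k * lg k) * lT_mul_lv k - (lv k * lg k) * lT_mul k
    + (lT' k * (1 - lT k)) * one_sub_lT_mul_lg k - lT_mul k

theorem two_mul_cube_coeff : 2 * (lT k * lg k ^ 3) = tDeriv k (tDeriv k (lg k)) + tDeriv k (lg k) := by
  rw [tDeriv_lg, isDeriv_tDeriv, tDeriv_lT, (isDeriv_tDeriv k).sq, tDeriv_lg]
  linear_combination (2 * lT k * lg k ^ 2) * one_sub_lT_mul_lg k

theorem cf_cube_add (j : ℕ) : 2 * (cf k j (cube k) + cf k (Int.negSucc j) (cube k)) =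
    pi0' k ^ 3 * (j * (j + 1)) + 2 * ev1 k (pinv k ^ 3) := by
  obtain ⟨g, hg, hg1⟩ := exists_eq_add_X_mul k (pinv k ^ 3)
  obtain ⟨h, hh, -⟩ := exists_eq_add_X_mul k g
  rw [hg1] at hh
  have e : 2 * cube k = kap k (pi0' k ^ 3) * C (2 * (lT k * lg k ^ 3))
      + 2 * (kap k (ev1 k (pinv k ^ 3)) * C (lg k)) + 2 * (C (lT' k) * evE k h - evE k h) := by
    have h1 : C (lg k) * C (lv k) = C (lT' k) - (1 : Omg k) := by
      rw [← map_mul, mul_comm, lv_mul_lg, map_sub, map_one]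
    have h2 : C (lT k) * C (lg k) ^ 2 * C (lv k) = (1 : Omg k) := by
      rw [← map_pow, ← map_mul, ← map_mul, mul_comm, lv_mul, map_one]
    have h3 := congrArg (evE k) hg
    have h4 : ev0 k (pinv k ^ 3) = pi0' k ^ 3 := map_pow _ _ _
    rw [hh, h4] at h3
    simp only [map_add, map_mul, evE_kev, evE_C, lE_X, map_pow] at h3
    rw [cube, thinv, mul_pow, h3]
    simp only [map_mul, map_ofNat, map_pow]
    linear_combination (2 * kap k (ev1 k (pinv k ^ 3)) * C (lg k)
      + 2 * C (lv k) * C (lg k) * evE k h) * h2 + (2 * evE k h) * h1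
  have e' : ∀ i : ℤ, 2 * cf k i (cube k) = pi0' k ^ 3 * ((i : k⟦X⟧) * (i + 1) * C ((lg k).coeff i))
      + 2 * (ev1 k (pinv k ^ 3) * C ((lg k).coeff i)) + 2 * (cf k (i + 1) (evE k h) - cf k i (evE k h)) := by
    intro i
    have := congrArg (cf k i) e
    simp only [two_mul (_ : Omg k), map_add, map_sub, cf_kap_mul, cf_C, cf_T'_mul,
      two_mul_cube_coeff, coeff_tDeriv, map_mul, map_intCast] at this
    linear_combination this
  rw [mul_add, e', e', coeff_lg, coeff_lg, if_pos (by positivity), if_neg (by simp)]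
  have h1 := cf_neg_evE k (j + 1 : ℕ) h
  have h2 := cf_neg_evE k j h
  rw [show -((j + 1 : ℕ) : ℤ) = Int.negSucc j by rfl] at h1
  rw [h1, show Int.negSucc j + 1 = -(j : ℤ) by rw [Int.negSucc_eq]; ring, h2]
  push_cast
  simp only [map_zero, map_one]
  ring

theorem two_mul_ev1_pinv_cube : 2 * ev1 k (pinv k ^ 3) = -6 * pi0' k ^ 4 * ev1 k (pser k) := by
  rw [pow_succ, sq, ev1_mul, ev1_mul, ev1_pinv, map_mul, ← pi0']
  ring

/-- The right hand side of the recursion satisfied by the Laurent coefficients. -/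
noncomputable def zser (j : ℕ) : k⟦X⟧ := pi0' k ^ 3 * (6 * qD (ptheta k j) + j * (j + 1) * ptheta k j)
  + 2 * ev1 k (pinv k ^ 3) * ptheta k j

theorem qD_ptheta (j : ℕ) : qD (ptheta k j)
    = -(X ^ (j + 2) * (((j : k⟦X⟧) + 2) * ptheta k (j + 3) + qD (ptheta k (j + 3)))) := by
  conv_lhs => rw [ptheta_rec, map_sub, qD_mul, qD_X_pow, Derivation.map_one_eq_zero]
  push_cast; ring

theorem two_mul_cf_cube (j : ℕ) : 2 * cf k j (cube k) = zser k j := by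
  set w : ℕ → k⟦X⟧ := fun j => 2 * cf k j (cube k) - zser k j with hw
  have hrec : ∀ j, w j = -(X ^ (j + 2) * w (j + 3)) := by
    intro j
    have h1 := cf_cube_add k j
    rw [cf_cube_neg] at h1
    have h2 := ptheta_rec k j
    have h3 := qD_ptheta k j
    simp only [hw, zser]
    push_cast at h1 ⊢
    linear_combination h1 - 6 * pi0' k ^ 3 * h3 - (pi0' k ^ 3 * (j * (j + 1)) + 2 * ev1 k (pinv k ^ 3)) * h2
  have hdiv : ∀ n j, X ^ n ∣ w j := by
    intro n
    induction n with
    | zero => intro j; simp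
    | succ n ih =>
      intro j
      rw [hrec, dvd_neg, pow_succ']
      exact mul_dvd_mul (dvd_pow_self _ (by omega)) (ih _)
  have : w j = 0 := eq_of_forall_X_pow_dvd fun N => by rw [sub_zero]; exact hdiv N j
  exact sub_eq_zero.1 this

variable (h6 : (6 : k) ≠ 0)
include h6

theorem six_ne_zero_ser : (6 : k⟦X⟧) ≠ 0 := by
  rw [← map_ofNat C 6]
  exact fun h => h6 (C_injective (by rw [h, map_zero]))

theorem ev1_pser : ev1 k (pser k) = -(sigmaSeries k * pi0 k) := by
  have h0 := two_mul_cf_cube k 0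
  have h2 := two_mul_cf_cube k 2
  have h := cf_cube_zero k
  have hc := qD_euler k
  have hc' : qD (euler k) = qD (ptheta k 0) - (X * ptheta k 2 + X * qD (ptheta k 2)) := by
    rw [euler, map_sub, qD_mul, ← pow_one (X : k⟦X⟧), qD_X_pow]; push_cast; ring
  have hF := two_mul_ev1_pinv_cube k
  have hp := pi0_mul k
  simp only [zser] at h0 h2
  push_cast at h0 h2
  rw [h] at h0
  have key : 6 * euler k * pi0' k ^ 4 * (ev1 k (pser k) + sigmaSeries k * pi0 k) = 0 := by
    have e : pi0' k ^ 3 * 6 * qD (euler k) + 2 * ev1 k (pinv k ^ 3) * euler k = 0 := by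
      rw [hc', euler]
      linear_combination (-1 : k⟦X⟧) * h0 + X * h2
    rw [hc, hF] at e
    linear_combination -e + 6 * euler k * sigmaSeries k * pi0' k ^ 3 * hp
  have hu : (6 : k⟦X⟧) * (ev1 k (pser k) + sigmaSeries k * pi0 k) = 0 := by
    have he := euler_mul_inv k
    have hp4 : pi0 k ^ 4 * pi0' k ^ 4 = 1 := by rw [← mul_pow, hp, one_pow]
    linear_combination (euler k)⁻¹ * pi0 k ^ 4 * key
      - 6 * (ev1 k (pser k) + sigmaSeries k * pi0 k) * (hp4 + pi0 k ^ 4 * pi0' k ^ 4 * he)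
  have := (mul_eq_zero.1 hu).resolve_left (six_ne_zero_ser k h6)
  linear_combination this

theorem qD_pi0 : qD (pi0 k) = -(3 * sigmaSeries k * pi0 k) := by
  have h := six_mul_ev1_pser k
  rw [ev1_pser k h6, ← pi0] at h
  have h2 : (2 : k⟦X⟧) ≠ 0 := fun h2 => six_ne_zero_ser k h6 (by linear_combination 3 * h2)
  apply mul_left_cancel₀ h2
  linear_combination -h

theorem two_mul_ev1_pinv_cube' : 2 * ev1 k (pinv k ^ 3) = 6 * pi0' k ^ 3 * sigmaSeries k := by
  rw [two_mul_ev1_pinv_cube, ev1_pser k h6]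
  linear_combination 6 * pi0' k ^ 3 * sigmaSeries k * pi0_mul k

end InverseCube

section Appell

variable (k : Type*) [Field k]

theorem psum_single {R : Type*} [CommRing R] (i : ℕ) (a : R⟦X⟧) (ha : X ^ i ∣ a) :
    psum (fun j => if j = i then a else 0) = a := by
  have hs : Small (fun j => if j = i then a else 0) := Small.of_dvd fun j => by
    split_ifs with h
    · rwa [h]
    · exact dvd_zero _
  ext n
  rw [coeff_psum hs (show n < n + i + 1 by omega), sum_eq_single i]
  · simp
  · intro j _ hj; simp [hj]
  · intro h; exact absurd (mem_range.2 (by omega)) h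

theorem cf_psum (j : ℤ) (f : ℕ → Omg k) : cf k j (psum f) = psum fun i => cf k j (f i) := by
  ext n
  simp only [coeff_cf, psum, coeff_mk, HahnSeries.coeff_sum]

theorem X_pow_dvd_one_sub_ptheta (j : ℕ) : X ^ (j + 2) ∣ 1 - ptheta k j :=
  ⟨ptheta k (j + 3), by rw [ptheta_rec k j]; ring⟩

theorem small_appell : Small fun j => kev k (1 - ptheta k j) * C (chi k j) := by
  refine Small.of_dvd fun j => ?_
  obtain ⟨g, hg⟩ := (pow_dvd_pow _ (by omega : j ≤ j + 2)).trans (X_pow_dvd_one_sub_ptheta k j)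
  rw [hg, map_mul, map_pow, mul_assoc]
  exact dvd_mul_of_dvd_left (by rw [kev, map_X]) _

/-- The even factor of the Appell series. -/
noncomputable def vser : Evn k :=
  1 + C Polynomial.X * psum fun j => kev k (1 - ptheta k j) * C (chi k j)

/-- The Appell series `∑ U_i T ^ i + ∑ (1 - U_i) T ^ (-i - 1)`. -/
noncomputable def appell : Omg k := C (lg k) * evE k (vser k)

theorem ev0_vser : ev0 k (vser k) = 1 := by
  rw [vser, map_add, map_mul, ev0_C, map_one]; simp

theorem ev1_vser : ev1 k (vser k) = -rankSeries k := by
  have h0 : ev1 k (C Polynomial.X) = 1 := by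
    ext n
    rw [coeff_ev1, coeff_C, coeff_one]
    split_ifs <;> simp
  have h1 : ev1 k 1 = 0 := by rw [← map_one (kev k), ev1_kev]
  rw [vser, map_add, ev1_mul, h0, h1, ev0_C, ev0, map_psum, rankSeries, ← psum_neg]
  simp only [Polynomial.coeff_X_zero, map_zero, zero_mul, add_zero, one_mul, zero_add]
  refine psum_congr fun j => ?_
  rw [← ev0, map_mul, ev0_kev, ev0_C, chi_coeff_zero]
  simp only [map_add, map_mul, map_natCast, map_ofNat, map_one]
  push_cast; ring

theorem lv_mul_lg_mul_chi (j : ℕ) : lv k * lg k * lE k (chi k j) = lT' k ^ (j + 1) - lT k ^ j := by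
  have h1 := one_sub_lT_mul_chi k j
  have h2 := lv_mul_lg k
  have h3 := lT_mul k
  linear_combination lE k (chi k j) * h2 + lT' k * h1 + (lE k (chi k j) - lT k ^ j) * h3

theorem appell_term (j : ℕ) (a : k⟦X⟧) : C (lg k) * C (lv k) * evE k (kev k a * C (chi k j))
    = kap k a * C (lT' k ^ (j + 1) - lT k ^ j) := by
  rw [map_mul, evE_kev, evE_C, ← lv_mul_lg_mul_chi, map_mul, map_mul]
  ring

theorem evE_psum (f : ℕ → Evn k) : evE k (psum f) = psum fun j => evE k (f j) := map_psum _ _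

theorem small_evE {f : ℕ → Evn k} (hf : Small f) : Small fun j => evE k (f j) := hf.map _

theorem appell_eq : appell k = C (lg k) + psum fun j =>
    kap k (1 - ptheta k j) * C (lT' k ^ (j + 1) - lT k ^ j) := by
  rw [appell, vser, map_add, map_one, mul_add, mul_one, map_mul (evE k), evE_C, lE_X, ← mul_assoc,
    evE_psum, mul_psum (small_evE k (small_appell k))]
  simp only [appell_term]

theorem lT_pow (n : ℕ) : lT k ^ n = HahnSeries.single (n : ℤ) 1 := by
  rw [lT, HahnSeries.single_pow]; simp

theorem cf_appell_term (i : ℤ) (j : ℕ) :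
    cf k i (kap k (1 - ptheta k j) * C (lT' k ^ (j + 1) - lT k ^ j))
      = (if i = Int.negSucc j then 1 - ptheta k j else 0) - if i = j then 1 - ptheta k j else 0 := by
  rw [cf_kap_mul, cf_C, lT'_pow, lT_pow, HahnSeries.coeff_sub, HahnSeries.coeff_single,
    HahnSeries.coeff_single, map_sub, mul_sub, show -((j + 1 : ℕ) : ℤ) = Int.negSucc j from rfl]
  congr 1 <;> split_ifs <;> simp

theorem cf_appell (i : ℕ) : cf k i (appell k) = ptheta k i := by
  rw [appell_eq, map_add, cf_C, coeff_lg, if_pos (by positivity), map_one, cf_psum,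
    psum_congr (fun j => show _ = -(if j = i then 1 - ptheta k i else 0) from ?_), psum_neg,
    psum_single]
  · ring
  · exact (pow_dvd_pow _ (by omega)).trans (X_pow_dvd_one_sub_ptheta k i)
  · rw [cf_appell_term]
    by_cases h : j = i
    · simp [h]
    · have : ¬ i = j := fun h' => h h'.symm
      simp [h, this]

theorem cf_appell_neg (i : ℕ) : cf k (Int.negSucc i) (appell k) = 1 - ptheta k i := by
  rw [appell_eq, map_add, cf_C, coeff_lg, if_neg (by simp), map_zero, cf_psum,
    psum_congr (fun j => show _ = (if j = i then 1 - ptheta k i else 0) from ?_), psum_single]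
  · ring
  · exact (pow_dvd_pow _ (by omega)).trans (X_pow_dvd_one_sub_ptheta k i)
  · rw [cf_appell_term]
    by_cases h : j = i
    · simp [h]
    · have : ¬ i = j := fun h' => h h'.symm
      simp [h, this]

theorem appell_pde (h6 : (6 : k) ≠ 0) : 6 * Dq (appell k) + dT k (dT k (appell k)) + dT k (appell k)
    + kap k (6 * sigmaSeries k) * appell k = 2 * (kap k (pi0 k ^ 3) * cube k) := by
  have hp : pi0 k ^ 3 * pi0' k ^ 3 = 1 := by rw [← mul_pow, pi0_mul, one_pow]
  have h1 := two_mul_ev1_pinv_cube' k h6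
  refine cf_ext k fun j => ?_
  rw [show (6 : Omg k) = kap k 6 by rw [map_ofNat], show (2 : Omg k) = kap k 2 by rw [map_ofNat]]
  simp only [map_add, cf_kap_mul, cf_Dq, cf_dT]
  cases j with
  | ofNat i =>
    have h2 := two_mul_cf_cube k i
    rw [zser] at h2
    rw [Int.ofNat_eq_natCast, cf_appell]
    push_cast
    linear_combination - pi0 k ^ 3 * h2 - pi0 k ^ 3 * ptheta k i * h1
      - (6 * qD (ptheta k i) + (i * (i + 1)) * ptheta k i + 6 * sigmaSeries k * ptheta k i) * hp
  | negSucc i =>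
    have h2 := two_mul_cf_cube k i
    have h3 := cf_cube_add k i
    rw [zser] at h2
    rw [cf_appell_neg, map_sub, Derivation.map_one_eq_zero]
    push_cast
    linear_combination pi0 k ^ 3 * h2 - pi0 k ^ 3 * h3 + pi0 k ^ 3 * (ptheta k i - 1) * h1
      + (6 * qD (ptheta k i) + (i * (i + 1)) * (ptheta k i - 1)
        + 6 * sigmaSeries k * (ptheta k i - 1)) * hp

end Appell

section TwoDerivations

variable {A : Type*} [CommRing A]

/-- The relations satisfied by the logarithmic derivative of the theta series with respect to the
two commuting derivations. -/
structure HeatSystem (d D : A →+ A) (J P Q x : A) : Prop where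
  d_isDeriv : IsDeriv d
  D_isDeriv : IsDeriv D
  comm : ∀ f, d (D f) = D (d f)
  d_P : d P = 0
  d_Q : d Q = 0
  d_J : 6 * d J = P - x
  D_J : 2 * D J = d (d J) + J * d J
  d_d_x : 2 * d (d x) = x ^ 2 - Q

theorem IsDeriv.pow' {d : A →+ A} (hd : IsDeriv d) (f : A) (n : ℕ) :
    d (f ^ n) = (n : A) * f ^ (n - 1) * d f := by
  cases n with
  | zero => simp [hd.one]
  | succ n => rw [hd.pow, Nat.add_sub_cancel]

namespace HeatSystem

variable {d D : A →+ A} {J P Q x : A} (h : HeatSystem d D J P Q x)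
include h

theorem D_x' : 12 * D x = 2 * x ^ 2 + 2 * P * x + 6 * J * d x + (12 * D P - 3 * Q - P ^ 2) := by
  have hd := h.d_isDeriv
  have h1 : 6 * d (d J) = -d x := by
    rw [← hd.ofNat_mul, h.d_J, map_sub, h.d_P, zero_sub]
  have h2 : 12 * D J = -d x + J * (P - x) := by
    linear_combination 6 * h.D_J + h1 + J * h.d_J
  have h3 := congrArg d h2
  rw [hd.ofNat_mul, h.comm, map_add, map_neg, hd, map_sub, h.d_P] at h3
  have h4 : 6 * D (d J) = D P - D x := by
    rw [← h.D_isDeriv.ofNat_mul, h.d_J, map_sub]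
  linear_combination (-6 : A) * h3 + 12 * h4 + 3 * h.d_d_x - (P - x) * h.d_J

variable [IsDomain A] (h2 : (2 : A) ≠ 0) (h3 : (3 : A) ≠ 0)

include h3 in
theorem D_d_x : 4 * D (d x) = x * d x + P * d x + J * (x ^ 2 - Q) := by
  have hd := h.d_isDeriv
  have h1 := congrArg d h.D_x'
  rw [hd.ofNat_mul, h.comm] at h1
  simp only [map_add, map_sub, hd.ofNat_mul, hd.sq, hd _ _, h.d_P, h.d_Q, h.comm, map_zero] at h1
  apply mul_left_cancel₀ h3
  linear_combination h1 + d x * h.d_J + 3 * J * h.d_d_x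

include h2 h3

theorem weierstrass' : 3 * d x ^ 2 = x ^ 3 + ((12 * D P - 3 * Q - P ^ 2) + Q) * x
    + 2 * P * Q - 6 * D Q := by
  have hd := h.d_isDeriv
  have hD := h.D_isDeriv
  have h1 := congrArg d (h.D_d_x h3)
  rw [hd.ofNat_mul, h.comm] at h1
  simp only [map_add, map_sub, hd.sq, hd _ _, h.d_P, h.d_Q] at h1
  have h4 := congrArg D h.d_d_x
  rw [hD.ofNat_mul, map_sub, hD.sq] at h4
  apply mul_left_cancel₀ h2
  linear_combination (-6 : A) * h1 + 12 * h4 + 2 * x * h.D_x' - (3 * x + 3 * P) * h.d_d_x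
    - (x ^ 2 - Q) * h.d_J

variable (hx : d x ≠ 0)
include hx

theorem D_P : 12 * D P = P ^ 2 - Q := by
  have hd := h.d_isDeriv
  have h1 := congrArg d (h.weierstrass' h2 h3)
  have hDP : d (D P) = 0 := by rw [h.comm, h.d_P, map_zero]
  have hDQ : d (D Q) = 0 := by rw [h.comm, h.d_Q, map_zero]
  rw [hd.ofNat_mul, hd.sq, map_sub, map_add, map_add, hd.pow, hd, map_add, map_sub, map_sub,
    hd.ofNat_mul, hd.ofNat_mul, hd.ofNat_mul, hd.sq, mul_assoc 2 P Q, hd.ofNat_mul, hd,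
    h.d_P, h.d_Q, hDP, hDQ] at h1
  push_cast at h1
  apply mul_left_cancel₀ hx
  linear_combination -h1 + 3 * d x * h.d_d_x

theorem D_x : 6 * D x = x ^ 2 + P * x + 3 * J * d x - 2 * Q := by
  apply mul_left_cancel₀ h2
  linear_combination h.D_x' + h.D_P h2 h3 hx

theorem weierstrass {R : A} (hR : R = P * Q - 3 * D Q) :
    3 * d x ^ 2 = x ^ 3 - 3 * Q * x + 2 * R := by
  linear_combination h.weierstrass' h2 h3 + x * h.D_P h2 h3 hx - 2 * hR

theorem D_R {R : A} (hR : R = P * Q - 3 * D Q) : 2 * D R = P * R - Q ^ 2 := by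
  have hD := h.D_isDeriv
  have h1 := congrArg D (h.weierstrass h2 h3 hx hR)
  rw [hD.ofNat_mul, hD.sq, map_add, map_sub, hD.pow, mul_assoc 3 Q x, hD.ofNat_mul, hD.ofNat_mul,
    hD] at h1
  push_cast at h1
  have h24 : (24 : A) ≠ 0 := by
    have : (24 : A) = 2 * 2 * 2 * 3 := by norm_num
    rw [this]
    exact mul_ne_zero (mul_ne_zero (mul_ne_zero h2 h2) h2) h3
  have h12 : (12 : A) ≠ 0 := fun h0 => h24 (by linear_combination 2 * h0)
  apply mul_left_cancel₀ h12
  linear_combination (-12 : A) * h1 + 18 * d x * h.D_d_x h3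
    - 6 * (x ^ 2 - Q) * h.D_x h2 h3 hx + 12 * x * hR + 6 * (x + P) * h.weierstrass h2 h3 hx hR

theorem adjoint_power {R : A} (hR : R = P * Q - 3 * D Q) (n : ℕ) :
    36 * D (d x * x ^ n) - 6 * d (d (d x * x ^ n)) - 18 * d (J * (d x * x ^ n))
      - 6 * (x + P) * (d x * x ^ n)
    = d x * (6 * n * P * x ^ n - n * (2 * n + 1) * x ^ (n + 1)
      + 3 * n * (2 * n - 3) * Q * x ^ (n - 1) - 4 * n * (n - 1) * R * x ^ (n - 2)) := by
  have hd := h.d_isDeriv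
  have hD := h.D_isDeriv
  have hW := h.weierstrass h2 h3 hx hR
  have hb : (n : A) * x ^ (n - 1) * x = n * x ^ n := by
    cases n with
    | zero => simp
    | succ n => rw [Nat.add_sub_cancel]; ring
  have he : (n : A) * (n - 1) * x ^ (n - 2) * x = n * (n - 1) * x ^ (n - 1) := by
    rcases n with _ | _ | n
    · simp
    · simp
    · rw [show n + 1 + 1 - 2 = n by omega, show n + 1 + 1 - 1 = n + 1 by omega]; ring
  have hdb : (n : A) * d (x ^ (n - 1)) = n * (n - 1) * x ^ (n - 2) * d x := by
    rw [hd.pow']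
    cases n with
    | zero => simp
    | succ n => rw [Nat.add_sub_cancel, show n + 1 - 2 = n - 1 by omega]; push_cast; ring
  have hda := hd.pow' x n
  have hDa := hD.pow' x n
  have hdR : d R = 0 := by
    rw [hR, map_sub, hd, hd.ofNat_mul, h.comm, h.d_P, h.d_Q, map_zero]; ring
  rw [pow_succ]
  generalize x ^ n = a at *
  generalize x ^ (n - 1) = b at *
  generalize x ^ (n - 2) = e at *
  have hA1 : 6 * d (d x * a) = 3 * (x ^ 2 - Q) * a + 2 * n * (x ^ 2 - 3 * Q) * a + 4 * n * (R * b) := by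
    rw [hd, hda]
    linear_combination 3 * a * h.d_d_x + 2 * n * b * hW + 2 * (x ^ 2 - 3 * Q) * hb
  have hA2 : 6 * d (d (d x * a)) = d x * ((3 + 2 * n) * (2 + n) * x * a - (3 + 6 * n) * n * Q * b
      + 4 * n * (n - 1) * R * e) := by
    have := congrArg d hA1
    rw [hd.ofNat_mul, map_add, map_add, hd (3 * (x ^ 2 - Q)), hd (2 * n * (x ^ 2 - 3 * Q)), mul_assoc 2 (n : A),
      mul_assoc 4 (n : A), hd.ofNat_mul, hd.ofNat_mul, hd.ofNat_mul, hd.natCast_mul, hd.natCast_mul,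
      map_sub, map_sub, hd.ofNat_mul, hd.sq, h.d_Q, hd R, hdR, hda] at this
    linear_combination this + 4 * R * hdb + (3 + 2 * n) * d x * x * hb
  have hA3 : 36 * D (d x * a) = 9 * (x + P) * d x * a + 9 * J * (x ^ 2 - Q) * a
      + 6 * d x * (n * (x * a + P * a - 2 * Q * b)) + 18 * J * n * b * d x ^ 2 := by
    rw [hD, hDa]
    linear_combination 9 * a * h.D_d_x h3 + 6 * d x * n * b * h.D_x h2 h3 hx
      + 6 * d x * (x + P) * hb
  have hA4 : 18 * d (J * (d x * a)) = 3 * (P - x) * d x * a + 9 * J * (x ^ 2 - Q) * a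
      + 18 * J * n * b * d x ^ 2 := by
    rw [hd, hd, hda]
    linear_combination 3 * d x * a * h.d_J + 9 * J * a * h.d_d_x
  linear_combination hA3 - hA2 - hA4

end HeatSystem

end TwoDerivations

section Weierstrass

variable (k : Type*) [Field k]

/-- The Eisenstein series of weight two. -/
noncomputable def eisP : k⟦X⟧ := 1 - 24 * sigmaSeries k

/-- The logarithmic derivative of the theta series. -/
noncomputable def tlog : Omg k := dT k (theta k) * thinv k

/-- A multiple of the Weierstrass function. -/
noncomputable def wp : Omg k := kap k (eisP k) - 12 * dT k (tlog k)

theorem tlog_mul_theta : tlog k * theta k = dT k (theta k) := by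
  rw [tlog]
  linear_combination dT k (theta k) * theta_mul_thinv k

theorem dT_thinv : dT k (thinv k) = -(thinv k * tlog k) := by
  rw [(isDeriv_dT k).of_mul_eq_one (theta_mul_thinv k), tlog]; ring

theorem two_mul_Dq_theta : 2 * Dq (theta k) = theta k * (dT k (tlog k) + tlog k ^ 2 - tlog k) := by
  have h := congrArg (dT k) (tlog_mul_theta k)
  rw [isDeriv_dT] at h
  linear_combination heat k - h - (tlog k - 1) * tlog_mul_theta k

theorem two_mul_Dq_thinv :
    2 * Dq (thinv k) = -(thinv k * (dT k (tlog k) + tlog k ^ 2 - tlog k)) := by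
  rw [isDeriv_Dq.of_mul_eq_one (theta_mul_thinv k)]
  linear_combination -thinv k ^ 2 * two_mul_Dq_theta k
    - thinv k * (dT k (tlog k) + tlog k ^ 2 - tlog k) * theta_mul_thinv k

theorem two_mul_Dq_tlog : 2 * Dq (tlog k) =
    dT k (dT k (tlog k)) + 2 * tlog k * dT k (tlog k) - dT k (tlog k) := by
  have hd := isDeriv_dT k
  have h := congrArg (dT k) (two_mul_Dq_theta k)
  rw [hd.ofNat_mul, dT_Dq, ← tlog_mul_theta, isDeriv_Dq, hd, map_sub, map_add, hd.sq,
    ← tlog_mul_theta] at h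
  linear_combination thinv k * h - tlog k * thinv k * two_mul_Dq_theta k
    + (dT k (dT k (tlog k)) + 2 * tlog k * dT k (tlog k) - dT k (tlog k) - 2 * Dq (tlog k))
      * theta_mul_thinv k

theorem isSym_wp : IsSym k 1 (wp k) := by
  have h1 : IsSym k (-1) (tlog k) := by simpa [tlog] using (isSym_theta k).dT.mul (isSym_thinv k)
  have h2 : IsSym k 1 (dT k (tlog k)) := by simpa using h1.dT
  rw [wp]
  refine (isSym_kap _).sub ?_
  simpa using (isSym_natCast 12).mul h2

/-- `T / (1 - T) ^ 2`, the inverse of `v`. -/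
noncomputable def lw : LaurentSeries k := lT k * lg k ^ 2

theorem tDeriv_lw : tDeriv k (lw k) = -lw k ^ 2 * tDeriv k (lv k) :=
  (isDeriv_tDeriv k).of_mul_eq_one (lv_mul k)

theorem tDeriv_tDeriv_lw : tDeriv k (tDeriv k (lw k)) = 6 * lw k ^ 2 + lw k := by
  have hd := isDeriv_tDeriv k
  have h1 : lv k * lw k = 1 := lv_mul k
  have h : tDeriv k (tDeriv k (lw k)) = -(2 * lw k * tDeriv k (lw k)) * tDeriv k (lv k)
      - lw k ^ 2 * (lv k + 2) := by
    rw [tDeriv_lw, hd, map_neg, hd.sq, tDeriv_tDeriv_lv, ← tDeriv_lw]; ring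
  rw [h, tDeriv_lw]
  linear_combination 2 * lw k ^ 3 * tDeriv_lv_sq k
    + (2 * lv k * lw k ^ 2 + 2 * lw k + 8 * lw k ^ 2 - lw k) * h1

theorem tDeriv_lT_mul_lg : tDeriv k (lT k * lg k) = lw k := by
  rw [isDeriv_tDeriv, tDeriv_lT, tDeriv_lg, lw]
  linear_combination -(lT k * lg k) * one_sub_lT_mul_lg k

theorem dT_C_tDeriv_lv (f : Evn k) : dT k (evE k f * C (tDeriv k (lv k))) =
    evE k (dv k f * C (Polynomial.X ^ 2 + 4 * Polynomial.X) + f * C (Polynomial.X + 2)) := by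
  rw [isDeriv_dT, dT_evE, dT_C, tDeriv_tDeriv_lv, mul_assoc, ← map_mul, ← sq, tDeriv_lv_sq]
  simp only [map_add, map_mul, evE_C, map_pow, lE_X, map_ofNat]

variable (h6 : (6 : k) ≠ 0)
include h6

/-- The Laurent expansion of `wp` has principal part `12 / v`. -/
theorem exists_wp_eq : ∃ g : Evn k, wp k = 12 * C (lw k) + 1 + C (lv k) * evE k g := by
  set f : Evn k := dv k (pser k) * pinv k with hf
  have ht : tlog k = -C (lT k * lg k) + evE k f * C (tDeriv k (lv k)) := by
    have h1 : C (1 - lT k) * C (lg k) = (1 : Omg k) := by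
      rw [← map_mul, one_sub_lT_mul_lg, map_one]
    have h2 : evE k (pser k) * evE k (pinv k) = 1 := by
      rw [← map_mul, pser_mul_pinv, map_one]
    rw [tlog, theta, thinv, isDeriv_dT, dT_C, map_sub, (isDeriv_tDeriv k).one, tDeriv_lT, dT_evE,
      zero_sub, map_neg, hf, map_mul, map_mul]
    linear_combination evE k (dv k (pser k)) * C (tDeriv k (lv k)) * evE k (pinv k) * h1
      - C (lT k) * C (lg k) * h2
  set ξ : Evn k := dv k f * C (Polynomial.X ^ 2 + 4 * Polynomial.X) + f * C (Polynomial.X + 2)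
  have hx : wp k = 12 * C (lw k) + evE k (kev k (eisP k) - 12 * ξ) := by
    rw [wp, ht, map_add, map_neg, dT_C, tDeriv_lT_mul_lg, dT_C_tDeriv_lv, map_sub, map_mul (evE k),
      evE_kev, map_ofNat]
    ring
  have hf0 : ev0 k f = -sigmaSeries k := by
    rw [hf, map_mul, ev0_dv, ev1_pser k h6, ← pi0']
    linear_combination -sigmaSeries k * pi0_mul k
  obtain ⟨g, hg, -⟩ := exists_eq_add_X_mul k (kev k (eisP k) - 12 * ξ)
  have h0 : ev0 k (kev k (eisP k) - 12 * ξ) = 1 := by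
    rw [map_sub, map_mul, ev0_kev, map_ofNat, map_add, map_mul (ev0 k), map_mul (ev0 k), ev0_C, ev0_C, hf0,
      eisP]
    simp only [Polynomial.coeff_add, Polynomial.mul_coeff_zero, Polynomial.coeff_X_zero,
      Polynomial.coeff_X_pow, Polynomial.coeff_ofNat_zero, mul_zero, add_zero, map_zero, zero_add,
      map_ofNat, OfNat.zero_ne_ofNat, ite_false]
    ring
  refine ⟨g, ?_⟩
  rw [hx, hg, h0, map_add, map_mul, map_one, map_one, evE_C, lE_X, add_assoc]

theorem exists_two_mul_dT_dT_wp : ∃ Q : k⟦X⟧, 2 * dT k (dT k (wp k)) = wp k ^ 2 - kap k Q := by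
  obtain ⟨g, hg⟩ := exists_wp_eq k h6
  have hd := isDeriv_dT k
  set η : Evn k := 1 + C Polynomial.X * g with hη
  have hη' : evE k η = 1 + C (lv k) * evE k g := by
    rw [hη, map_add, map_mul, map_one, evE_C, lE_X]
  have hw : C (lv k) * C (lw k) = (1 : Omg k) := by rw [← map_mul, lw, lv_mul, map_one]
  obtain ⟨ζ, hζ⟩ : ∃ ζ, dT k (dT k (evE k η)) = evE k ζ := ⟨_, by rw [dT_evE, dT_C_tDeriv_lv]⟩
  have e : 2 * dT k (dT k (wp k)) - wp k ^ 2 = evE k (2 * ζ - 24 * g - η ^ 2) := by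
    have h1 : wp k = 12 * C (lw k) + evE k η := by rw [hg, hη']; ring
    rw [h1, map_add, map_add, hd.ofNat_mul, hd.ofNat_mul, dT_C, dT_C, tDeriv_tDeriv_lw, hζ]
    simp only [map_sub, map_mul, map_pow, map_ofNat, map_add, hη']
    linear_combination (-24 * evE k g) * hw
  have hs : IsSym k 1 (evE k (2 * ζ - 24 * g - η ^ 2)) := by
    rw [← e]
    refine IsSym.sub ?_ ((isSym_wp k).pow 2)
    simpa using (isSym_natCast 2).mul (isSym_wp k).dT.dT
  refine ⟨-cf k 0 (evE k (2 * ζ - 24 * g - η ^ 2)), ?_⟩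
  rw [map_neg, ← hs.eq_kap, ← e]
  ring

/-- The Eisenstein series of weight four. -/
noncomputable def eisQ : k⟦X⟧ := (exists_two_mul_dT_dT_wp k h6).choose

theorem two_mul_dT_dT_wp : 2 * dT k (dT k (wp k)) = wp k ^ 2 - kap k (eisQ k h6) :=
  (exists_two_mul_dT_dT_wp k h6).choose_spec

theorem six_ne_zero_Omg : (6 : Omg k) ≠ 0 := by
  intro h
  have := congrArg (cf k 0) h
  rw [show (6 : Omg k) = kap k 6 by rw [map_ofNat], cf_kap, map_zero, if_pos rfl] at this
  exact six_ne_zero_ser k h6 this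

theorem two_ne_zero_Omg : (2 : Omg k) ≠ 0 := fun h => six_ne_zero_Omg k h6 (by linear_combination 3 * h)

theorem three_ne_zero_Omg : (3 : Omg k) ≠ 0 := fun h => six_ne_zero_Omg k h6 (by linear_combination 2 * h)

theorem dT_wp_ne_zero : dT k (wp k) ≠ 0 := by
  intro h0
  obtain ⟨g, hg⟩ := exists_wp_eq k h6
  have hd := isDeriv_dT k
  obtain ⟨ζ, hζ⟩ : ∃ ζ, dT k (dT k (1 + C (lv k) * evE k g)) = evE k ζ :=
    ⟨_, by rw [← lE_X, ← evE_C, ← map_mul, ← map_one (evE k), ← map_add, dT_evE, dT_C_tDeriv_lv]⟩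
  have h1 := congrArg (dT k) h0
  rw [hg, add_assoc, map_add, map_add, hd.ofNat_mul, hd.ofNat_mul, hζ, dT_C, dT_C, map_zero] at h1
  have h2 : 12 * C (tDeriv k (tDeriv k (tDeriv k (lg k)))) = -evE k ζ := by
    rw [tDeriv_lg, ← lw]; linear_combination h1
  have h3 : cf k (-1) (12 * C (tDeriv k (tDeriv k (tDeriv k (lg k))))) =
      cf k 1 (12 * C (tDeriv k (tDeriv k (tDeriv k (lg k))))) := by
    rw [h2, map_neg, map_neg, cf_neg_evE]
  rw [show (12 : Omg k) = kap k 12 by rw [map_ofNat]] at h3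
  simp only [cf_kap_mul, cf_C, coeff_tDeriv, coeff_lg] at h3
  norm_num at h3
  have : (6 : k⟦X⟧) * 6 = 0 := by linear_combination -3 * h3
  exact six_ne_zero_ser k h6 (mul_self_eq_zero.1 this)

theorem heatSystem : HeatSystem (dT k) Dq (2 * tlog k - 1) (kap k (eisP k)) (kap k (eisQ k h6)) (wp k) where
  d_isDeriv := isDeriv_dT k
  D_isDeriv := isDeriv_Dq
  comm := dT_Dq k
  d_P := dT_kap k _
  d_Q := dT_kap k _
  d_J := by rw [map_sub, (isDeriv_dT k).one, (isDeriv_dT k).ofNat_mul, wp]; ring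
  D_J := by
    have hd := isDeriv_dT k
    rw [map_sub, isDeriv_Dq.ofNat_mul, isDeriv_Dq.one, map_sub, hd.ofNat_mul, hd.one, sub_zero,
      sub_zero, hd.ofNat_mul]
    linear_combination 2 * two_mul_Dq_tlog k
  d_d_x := two_mul_dT_dT_wp k h6

omit h6 in
theorem kap_injective : Function.Injective (kap k) := fun a b h => by
  have := congrArg (cf k 0) h
  simpa [cf_kap] using this

/-- The Eisenstein series of weight six. -/
noncomputable def eisR : k⟦X⟧ := eisP k * eisQ k h6 - 3 * qD (eisQ k h6)

theorem kap_eisR : kap k (eisR k h6) = kap k (eisP k) * kap k (eisQ k h6) - 3 * Dq (kap k (eisQ k h6)) := by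
  rw [eisR, Dq_kap, map_sub, map_mul, map_mul, map_ofNat]

theorem qD_eisP : 12 * qD (eisP k) = eisP k ^ 2 - eisQ k h6 := by
  apply kap_injective k
  have h := (heatSystem k h6).D_P (two_ne_zero_Omg k h6) (three_ne_zero_Omg k h6) (dT_wp_ne_zero k h6)
  rw [Dq_kap] at h
  simpa only [map_mul, map_sub, map_pow, map_ofNat] using h

theorem qD_eisQ : 3 * qD (eisQ k h6) = eisP k * eisQ k h6 - eisR k h6 := by
  rw [eisR]; ring

theorem qD_eisR : 2 * qD (eisR k h6) = eisP k * eisR k h6 - eisQ k h6 ^ 2 := by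
  apply kap_injective k
  have h := (heatSystem k h6).D_R (two_ne_zero_Omg k h6) (three_ne_zero_Omg k h6) (dT_wp_ne_zero k h6)
    (kap_eisR k h6)
  rw [Dq_kap] at h
  simpa only [map_mul, map_sub, map_pow, map_ofNat] using h

end Weierstrass

section Moments

variable (k : Type*) [Field k]

/-- The ratio of the theta product and its leading term, multiplied by an even series. -/
noncomputable def quot (V : Evn k) : Evn k := kev k (pi0' k ^ 3) * pser k ^ 3 * V

/-- The normalised solution attached to an even series. -/
noncomputable def zsol (V : Evn k) : Omg k := C (lv k) * evE k (quot k V)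

/-- A multiple of the right hand side in `appell_pde`. -/
noncomputable def psi : Omg k := kap k (pi0 k ^ 3 * (euler k)⁻¹) * cube k

theorem ev0_quot (V : Evn k) : ev0 k (quot k V) = ev0 k V := by
  rw [quot, map_mul, map_mul, map_pow, map_pow, map_pow, ev0_kev, ← pi0, ← mul_pow, mul_comm (pi0' k), pi0_mul]
  ring

theorem psi_mul_zsol (V : Evn k) :
    psi k * zsol k V = kap k (euler k)⁻¹ * (C (lg k) * evE k V) := by
  have h1 : kap k (pi0 k) * kap k (pi0' k) = 1 := by rw [← map_mul, pi0_mul, map_one]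
  have h2 : evE k (pser k) * evE k (pinv k) = 1 := by rw [← map_mul, pser_mul_pinv, map_one]
  have h3 : C (lv k) * (C (lT k) * C (lg k) ^ 2) = (1 : Omg k) := by
    rw [← map_pow, ← map_mul, ← map_mul, lv_mul, map_one]
  have h1' : kap k (pi0 k) ^ 3 * kap k (pi0' k) ^ 3 = 1 := by rw [← mul_pow, h1, one_pow]
  have h2' : evE k (pser k) ^ 3 * evE k (pinv k) ^ 3 = 1 := by rw [← mul_pow, h2, one_pow]
  rw [psi, zsol, quot, cube, thinv]
  simp only [map_mul, map_pow, evE_kev]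
  linear_combination kap k (euler k)⁻¹ * C (lg k) * evE k V * (h1'
    + kap k (pi0 k) ^ 3 * kap k (pi0' k) ^ 3 * h2'
    + kap k (pi0 k) ^ 3 * kap k (pi0' k) ^ 3 * evE k (pser k) ^ 3 * evE k (pinv k) ^ 3 * h3)

theorem qD_euler_inv : qD (euler k)⁻¹ = sigmaSeries k * (euler k)⁻¹ := by
  have h := congrArg qD (euler_mul_inv k)
  rw [qD_mul, Derivation.map_one_eq_zero, qD_euler] at h
  linear_combination (euler k)⁻¹ * h - (qD (euler k)⁻¹ - sigmaSeries k * (euler k)⁻¹) * euler_mul_inv k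

theorem psi_ne_zero : psi k ≠ 0 := by
  intro h
  have h1 : kap k (pi0 k) * kap k (pi0' k) = 1 := by rw [← map_mul, pi0_mul, map_one]
  have h2 : kap k (euler k) * kap k (euler k)⁻¹ = 1 := by rw [← map_mul, euler_mul_inv, map_one]
  have h3 : C (lT k) * C (lT' k) = (1 : Omg k) := by rw [← map_mul, lT_mul, map_one]
  have h4 : (kap k (pi0' k) ^ 3 * kap k (euler k) * C (lT' k) * theta k ^ 3) * psi k
      = (kap k (pi0 k) * kap k (pi0' k)) ^ 3 * (kap k (euler k) * kap k (euler k)⁻¹)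
      * (C (lT k) * C (lT' k)) * (theta k * thinv k) ^ 3 := by
    rw [psi, cube, map_mul, map_pow]; ring
  rw [h, h1, h2, h3, theta_mul_thinv, mul_zero] at h4
  simp at h4

/-- The differential operator annihilating the functions `q ^ (-j (j + 1) / 6) T ^ j`. -/
noncomputable def heatOp (f : Omg k) : Omg k := 6 * Dq f + dT k (dT k f) + dT k f

theorem dT_psi : dT k (psi k) = psi k * (1 - 3 * tlog k) := by
  have hd := isDeriv_dT k
  rw [psi, hd, dT_kap, cube, hd, dT_C, tDeriv_lT, hd.pow, dT_thinv]
  push_cast; ring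

variable (h6 : (6 : k) ≠ 0)
include h6

theorem two_mul_Dq_psi : 2 * Dq (psi k) = psi k * (-16 * kap k (sigmaSeries k)
    - 3 * (dT k (tlog k) + tlog k ^ 2 - tlog k)) := by
  have h0 : qD (pi0 k ^ 3 * (euler k)⁻¹) = -(8 * sigmaSeries k * (pi0 k ^ 3 * (euler k)⁻¹)) := by
    have := (isDeriv_Dq (A := k)).pow (pi0 k) 2
    rw [Dq_apply, Dq_apply] at this
    rw [qD_mul, qD_euler_inv, this, qD_pi0 k h6]
    push_cast; ring
  rw [psi, isDeriv_Dq, Dq_kap, h0, cube, isDeriv_Dq, Dq_C, isDeriv_Dq.pow, map_neg, map_mul _ (8 * _),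
    map_mul _ 8, map_ofNat]
  push_cast
  linear_combination 3 * kap k (pi0 k ^ 3 * (euler k)⁻¹) * C (lT k) * thinv k ^ 2 * two_mul_Dq_thinv k

theorem heatOp_psi_mul (Z : Omg k) : heatOp k (psi k * Z) = psi k * (6 * Dq Z + dT k (dT k Z)
    - 3 * (2 * tlog k - 1) * dT k Z + (wp k + kap k (eisP k)) * Z) := by
  have hd := isDeriv_dT k
  have h1 : dT k (dT k (psi k)) = psi k * ((1 - 3 * tlog k) ^ 2 - 3 * dT k (tlog k)) := by
    rw [dT_psi k, hd, dT_psi k, map_sub, hd.ofNat_mul, hd.one]; ring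
  have h2 : kap k (eisP k) = 1 - 24 * kap k (sigmaSeries k) := by
    rw [eisP, map_sub, map_mul, map_one, map_ofNat]
  rw [heatOp, isDeriv_Dq, hd, map_add, hd, hd (psi k), h1, dT_psi k, wp, h2]
  linear_combination 3 * Z * two_mul_Dq_psi k h6

omit h6 in
theorem Dq_appell : heatOp k (kap k (euler k)⁻¹ * appell k) = kap k (euler k)⁻¹ *
    (6 * Dq (appell k) + dT k (dT k (appell k)) + dT k (appell k)
    + kap k (6 * sigmaSeries k) * appell k) := by
  have hd := isDeriv_dT k
  rw [heatOp, isDeriv_Dq, Dq_kap, qD_euler_inv, hd, dT_kap, zero_mul, zero_add, hd, dT_kap]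
  simp only [map_mul, map_ofNat]; ring

/-- The equation satisfied by a normalised solution. -/
def IsSol (ν : k⟦X⟧) (Z : Omg k) : Prop := 6 * Dq Z + dT k (dT k Z)
    - 3 * (2 * tlog k - 1) * dT k Z + (wp k + kap k (eisP k)) * Z = 2 * kap k ν

theorem isSol_zsol {ν : k⟦X⟧} {V : Evn k}
    (h : heatOp k (kap k (euler k)⁻¹ * (C (lg k) * evE k V)) = 2 * kap k ν * psi k) :
    IsSol k ν (zsol k V) := by
  rw [← psi_mul_zsol, heatOp_psi_mul k h6] at h
  exact mul_left_cancel₀ (psi_ne_zero k) (by rw [h]; ring)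

theorem isSol_vser : IsSol k 1 (zsol k (vser k)) := by
  apply isSol_zsol k h6
  rw [← appell, Dq_appell, appell_pde k h6, psi, map_mul _ (_ ^ 3), map_one]
  ring

/-- The even series attached to an elementary solution of the heat equation. -/
noncomputable def elem (N j : ℕ) : Evn k := -(kev k (euler k * X ^ N) * C (Polynomial.X * chi k j))

theorem isSol_elem (N j : ℕ) (hN : (6 * N + j * (j + 1) : k) = 0) :
    IsSol k 0 (zsol k (elem k N j)) := by
  apply isSol_zsol k h6
  have h1 := lv_mul_lg_mul_chi k j
  have h2 : kap k (euler k) * kap k (euler k)⁻¹ = 1 := by rw [← map_mul, euler_mul_inv, map_one]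
  have h3 : kap k (euler k)⁻¹ * (C (lg k) * evE k (elem k N j))
      = kap k (X ^ N) * C (lT k ^ j - lT' k ^ (j + 1)) := by
    rw [elem, map_neg, map_mul (evE k), evE_kev, evE_C, map_mul (lE k), lE_X, map_mul (kap k),
      ← neg_sub (lT' k ^ _), ← h1]
    simp only [map_neg, map_mul]
    linear_combination -(kap k (X ^ N) * C (lg k) * C (lv k) * C (lE k (chi k j))) * h2
  have hN' : (6 * N + j * (j + 1) : Omg k) = 0 := by
    have h := congrArg (fun x => kap k (C x)) hN
    simpa only [map_add, map_mul, map_natCast, map_ofNat, map_one, map_zero] using h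
  have hd := isDeriv_dT k
  rw [h3, heatOp, isDeriv_Dq, Dq_kap, Dq_C, qD_X_pow, hd, dT_kap, zero_mul, zero_add, hd, dT_kap,
    zero_mul, zero_add, dT_C, dT_C, map_sub (tDeriv k), tDeriv_lT_pow, tDeriv_lT'_pow,
    map_sub (tDeriv k), map_neg (tDeriv k),
    (isDeriv_tDeriv k).natCast_mul, (isDeriv_tDeriv k).natCast_mul, tDeriv_lT_pow, tDeriv_lT'_pow]
  simp only [map_mul, map_sub, map_neg, map_natCast, map_zero]
  push_cast
  linear_combination kap k (X ^ N) * (C (lT k ^ j) - C (lT' k ^ (j + 1))) * hN'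

/-- The moments of a normalised solution. -/
noncomputable def moment (Z : Omg k) (n : ℕ) : k⟦X⟧ := cf k 0 (dT k (wp k) * wp k ^ n * Z)

omit h6 in
theorem cf_zero_dT (f : Omg k) : cf k 0 (dT k f) = 0 := by rw [cf_dT]; simp

omit h6 in
theorem cf_zero_mul_dT (f g : Omg k) : cf k 0 (f * dT k g) = -cf k 0 (dT k f * g) := by
  have h := cf_zero_dT k (f * g)
  rw [isDeriv_dT, map_add] at h
  linear_combination h

theorem moment_rec {ν : k⟦X⟧} {Z : Omg k} (hZ : IsSol k ν Z) (n : ℕ) (hn : (n + 1 : k) ≠ 0) :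
    36 * qD (moment k Z n) = 6 * n * eisP k * moment k Z n - n * (2 * n + 1) * moment k Z (n + 1)
      + 3 * n * (2 * n - 3) * eisQ k h6 * moment k Z (n - 1)
      - 4 * n * (n - 1) * eisR k h6 * moment k Z (n - 2) := by
  rw [IsSol] at hZ
  have hd := isDeriv_dT k
  have hp := (heatSystem k h6).adjoint_power (two_ne_zero_Omg k h6) (three_ne_zero_Omg k h6)
    (dT_wp_ne_zero k h6) (kap_eisR k h6) n
  have h0 : cf k 0 (dT k (wp k) * wp k ^ n) = 0 := by
    have h1 := cf_zero_dT k (wp k ^ (n + 1))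
    rw [hd.pow, ← map_natCast (kap k), mul_assoc, cf_kap_mul, mul_comm (wp k ^ n)] at h1
    refine (mul_eq_zero.1 h1).resolve_left fun h => hn ?_
    rw [← map_natCast C] at h
    have := C_injective (h.trans (map_zero C).symm)
    push_cast at this
    exact this
  set a := dT k (wp k) * wp k ^ n with ha
  set J := 2 * tlog k - 1 with hJ
  have e1 : cf k 0 (a * dT k (dT k Z)) = cf k 0 (dT k (dT k a) * Z) := by
    rw [cf_zero_mul_dT, cf_zero_mul_dT, neg_neg]
  have e2 : cf k 0 (J * a * dT k Z) = -cf k 0 (dT k (J * a) * Z) := cf_zero_mul_dT k _ _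
  have e3 : cf k 0 (Dq (a * Z)) = qD (moment k Z n) := cf_Dq k _ _
  have hc : ∀ (c : ℕ) (f : Omg k), cf k 0 ((c : Omg k) * f) = c * cf k 0 f := fun c f => by
    rw [← map_natCast (kap k), cf_kap_mul]
  have key : 36 * Dq (a * Z) = ((36 : ℕ) : Omg k) * Dq a * Z + a * (12 * kap k ν)
      - (6 : ℕ) * (a * dT k (dT k Z)) + (18 : ℕ) * (J * a * dT k Z)
      - 6 * (wp k + kap k (eisP k)) * a * Z := by
    rw [isDeriv_Dq]
    push_cast
    linear_combination 6 * a * hZ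
  have e4 : cf k 0 (36 * Dq (a * Z)) = cf k 0 ((36 * Dq a - 6 * dT k (dT k a) - 18 * dT k (J * a)
      - 6 * (wp k + kap k (eisP k)) * a) * Z) := by
    have h12 : cf k 0 (a * (12 * kap k ν)) = 0 := by
      rw [show a * (12 * kap k ν) = kap k (12 * ν) * a by rw [map_mul, map_ofNat]; ring, cf_kap_mul,
        h0, mul_zero]
    rw [key, map_sub, map_add, map_sub, map_add, h12, hc, hc, e1, e2, ← hc, mul_neg, ← hc, add_zero,
      ← sub_eq_add_neg, ← map_sub, ← map_sub, ← map_sub]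
    refine congrArg _ ?_
    push_cast; ring
  rw [hp, show (36 : Omg k) = ((36 : ℕ) : Omg k) by norm_num, hc, e3] at e4
  push_cast at e4
  rw [e4]
  simp only [moment]
  have h3 : ∀ (u : k⟦X⟧) (f : Omg k), u * cf k 0 f = cf k 0 (kap k u * f) := fun u f =>
    (cf_kap_mul k 0 u f).symm
  rw [h3, h3, h3, h3, ← map_sub, ← map_add, ← map_sub]
  refine congrArg _ ?_
  simp only [map_mul, map_add, map_sub, map_natCast, map_ofNat, map_one]
  ring

omit h6 in
theorem exists_quot_eq (V : Evn k) : ∃ g, evE k (quot k V) = kap k (ev0 k V)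
    + C (lv k) * (kap k (ev1 k (quot k V)) + C (lv k) * evE k g) := by
  obtain ⟨g, hg, hg1⟩ := exists_eq_add_X_mul k (quot k V)
  obtain ⟨g', hg', -⟩ := exists_eq_add_X_mul k g
  refine ⟨g', ?_⟩
  conv_lhs => rw [hg, hg', hg1, ev0_quot]
  simp only [map_add, map_mul, evE_kev, evE_C, lE_X]

theorem ev1_quot (V : Evn k) : ev1 k (quot k V) = ev1 k V - 3 * sigmaSeries k * ev0 k V := by
  have h : pi0' k ^ 3 * pi0 k ^ 3 = 1 := by rw [← mul_pow, mul_comm, pi0_mul, one_pow]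
  rw [quot, ev1_mul, ev1_mul, ev1_kev, map_mul, ev0_kev, pow_succ, sq, ev1_mul, ev1_mul, map_mul,
    map_mul, ev1_pser k h6, ← pi0]
  linear_combination (ev1 k V - 3 * sigmaSeries k * ev0 k V) * h

omit h6 in
theorem lw_mul_tDeriv_lv : lw k * tDeriv k (lv k) = -(lg k + lT k * lg k) := by
  rw [lw, tDeriv_lv]
  linear_combination (-lg k ^ 2) * lT_mul k - (lg k + lT k * lg k) * one_sub_lT_mul_lg k

theorem moments_zero_one (V : Evn k) : moment k (zsol k V) 0 = 12 * ev0 k V ∧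
    moment k (zsol k V) 1 = 144 * (ev1 k V - 3 * sigmaSeries k * ev0 k V) + 12 * ev0 k V := by
  obtain ⟨g, hg⟩ := exists_wp_eq k h6
  obtain ⟨q, hq⟩ := exists_quot_eq k V
  rw [ev1_quot k h6] at hq
  set f0 := ev0 k V
  set f1 := ev1 k V - 3 * sigmaSeries k * f0
  have hd := isDeriv_dT k
  have hw : C (lv k) * C (lw k) = (1 : Omg k) := by rw [← map_mul, lw, lv_mul, map_one]
  set u : Omg k := C (tDeriv k (lv k)) with hu
  have hX : evE k (C Polynomial.X) = C (lv k) := by rw [evE_C, lE_X]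
  obtain ⟨η, hη⟩ : ∃ η, dT k (1 + C (lv k) * evE k g) = evE k η * u :=
    ⟨dv k (1 + C Polynomial.X * g), by rw [← dT_evE, map_add (evE k), map_one, map_mul, hX]⟩
  have hY : dT k (wp k) = -12 * C (lw k) ^ 2 * u + evE k η * u := by
    rw [hg, add_assoc, map_add, hd.ofNat_mul, dT_C, tDeriv_lw, hη, hu, map_mul, map_neg, map_pow]
    ring
  have c1 : cf k 0 (C (lw k) * u) = -1 := by
    rw [hu, ← map_mul, lw_mul_tDeriv_lv, cf_C, HahnSeries.coeff_neg, HahnSeries.coeff_add,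
      coeff_lT_mul, coeff_lg, coeff_lg]
    simp
  have c2 : cf k 0 (C (lw k) ^ 2 * u) = 0 := by
    have h := cf_zero_dT k (C (lw k))
    rw [dT_C, tDeriv_lw, map_mul, map_neg, map_pow, ← hu, neg_mul, map_neg, neg_eq_zero] at h
    exact h
  have c3 : ∀ f : Evn k, cf k 0 (evE k f * u) = 0 := cf_zero_evE_mul k
  refine ⟨?_, ?_⟩
  · have h : dT k (wp k) * wp k ^ 0 * zsol k V = kap k (-12 * f0) * (C (lw k) * u)
        + evE k (-12 * (kev k f1 + C Polynomial.X * q) + η * (C Polynomial.X * quot k V)) * u := by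
      rw [hY, zsol, map_add (evE k), map_mul (evE k), map_mul (evE k), map_mul (evE k), map_add (evE k), evE_kev,
        map_mul (evE k), hX, hq, map_mul (kap k)]
      simp only [map_neg, map_ofNat]
      linear_combination (-12 * C (lw k) * u * (kap k f0 + C (lv k) * (kap k f1 + C (lv k) * evE k q))
        - 12 * u * (kap k f1 + C (lv k) * evE k q)) * hw
    rw [moment, h, map_add, cf_kap_mul, c1, c3]
    ring
  · have h : dT k (wp k) * wp k ^ 1 * zsol k V = kap k (-144 * f0) * (C (lw k) ^ 2 * u)
        + kap k (-144 * f1 - 12 * f0) * (C (lw k) * u)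
        + evE k (-144 * q - 12 * g * quot k V - 12 * (kev k f1 + C Polynomial.X * q)
          + η * quot k V * (12 + C Polynomial.X + C Polynomial.X * C Polynomial.X * g)) * u := by
      simp only [zsol, map_add (evE k), map_sub (evE k), map_mul (evE k), evE_kev, hX, map_neg, map_ofNat,
        map_mul (kap k), map_sub (kap k)]
      rw [hY, hg, hq]
      set Q := kap k f0 + C (lv k) * (kap k f1 + C (lv k) * evE k q)
      linear_combination (-144 * C (lw k) ^ 2 * u * Q
        - 144 * C (lw k) * u * (kap k f1 + C (lv k) * evE k q) - 144 * u * evE k q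
        - 12 * C (lw k) * u * Q * (1 + C (lv k) * evE k g) + 12 * u * evE k η * Q
        - 12 * u * (kap k f1 + C (lv k) * evE k q) - 12 * u * evE k g * Q) * hw
    rw [moment, h, map_add, map_add, cf_kap_mul, cf_kap_mul, c1, c2, c3]
    ring

theorem moment_vser : moment k (zsol k (vser k)) 0 = 12 ∧ moment k (zsol k (vser k)) 1
    = 12 * (1 - 36 * sigmaSeries k - 12 * rankSeries k) := by
  have h := moments_zero_one k h6 (vser k)
  rw [ev0_vser, ev1_vser] at h
  exact ⟨by rw [h.1]; ring, by rw [h.2]; ring⟩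

theorem moment_elem (N j : ℕ) : moment k (zsol k (elem k N j)) 0 = 0 ∧
    moment k (zsol k (elem k N j)) 1 = -144 * (2 * (j : k⟦X⟧) + 1) * (euler k * X ^ N) := by
  have h := moments_zero_one k h6 (elem k N j)
  have h0 : ev0 k (elem k N j) = 0 := by
    rw [elem, map_neg, map_mul, ev0_C]; simp
  have h1 : ev1 k (elem k N j) = -((2 * (j : k⟦X⟧) + 1) * (euler k * X ^ N)) := by
    have : ev1 k (C (Polynomial.X * chi k j)) = 2 * (j : k⟦X⟧) + 1 := by
      have e := chi_coeff_zero k j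
      ext n
      rw [coeff_ev1, coeff_C, ← map_natCast C, ← map_ofNat C, ← map_mul, ← map_one C, ← map_add, coeff_C]
      split_ifs <;> simp [e]
    rw [elem, map_neg, ev1_mul, ev1_kev, ev0_kev, this]
    ring
  rw [h0, h1] at h
  exact ⟨by rw [h.1]; ring, by rw [h.2]; ring⟩

end Moments

section ModularForms

variable (k : Type*) [Field k] (h6 : (6 : k) ≠ 0)

/-- The space of forms of weight `K`, spanned by the monomials in the Eisenstein series. -/
noncomputable def Mf (K : ℕ) : Submodule k k⟦X⟧ :=
  Submodule.span k {f | ∃ a b : ℕ, 4 * a + 6 * b = K ∧ f = eisQ k h6 ^ a * eisR k h6 ^ b}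

theorem monomial_mem_Mf {a b K : ℕ} (h : 4 * a + 6 * b = K) :
    eisQ k h6 ^ a * eisR k h6 ^ b ∈ Mf k h6 K := Submodule.subset_span ⟨a, b, h, rfl⟩

theorem one_mem_Mf : 1 ∈ Mf k h6 0 := by
  simpa using monomial_mem_Mf k h6 (a := 0) (b := 0) rfl

theorem eisQ_mem_Mf : eisQ k h6 ∈ Mf k h6 4 := by
  simpa using monomial_mem_Mf k h6 (a := 1) (b := 0) rfl

theorem eisR_mem_Mf : eisR k h6 ∈ Mf k h6 6 := by
  simpa using monomial_mem_Mf k h6 (a := 0) (b := 1) rfl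

variable {k} {h6}

theorem C_mul_mem_Mf (a : k) {f : k⟦X⟧} {K : ℕ} (hf : f ∈ Mf k h6 K) : C a * f ∈ Mf k h6 K := by
  rw [← smul_eq_C_mul]; exact (Mf k h6 K).smul_mem a hf

theorem mul_mem_Mf {f g : k⟦X⟧} {K K' : ℕ} (hf : f ∈ Mf k h6 K) (hg : g ∈ Mf k h6 K') :
    f * g ∈ Mf k h6 (K + K') := by
  refine Submodule.span_induction (p := fun f _ => f * g ∈ Mf k h6 (K + K')) ?_ ?_ ?_ ?_ hf
  · rintro _ ⟨a, b, hab, rfl⟩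
    refine Submodule.span_induction (p := fun g _ => _ * g ∈ Mf k h6 (K + K')) ?_ ?_ ?_ ?_ hg
    · rintro _ ⟨a', b', hab', rfl⟩
      rw [mul_mul_mul_comm, ← pow_add, ← pow_add]
      exact monomial_mem_Mf k h6 (by omega)
    · rw [mul_zero]; exact Submodule.zero_mem _
    · intro x y _ _ hx hy; rw [mul_add]; exact Submodule.add_mem _ hx hy
    · intro a x _ hx; rw [mul_smul_comm]; exact Submodule.smul_mem _ _ hx
  · rw [zero_mul]; exact Submodule.zero_mem _
  · intro x y _ _ hx hy; rw [add_mul]; exact Submodule.add_mem _ hx hy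
  · intro a x _ hx; rw [smul_mul_assoc]; exact Submodule.smul_mem _ _ hx

theorem qD_smul (a : k) (f : k⟦X⟧) : qD (a • f) = a • qD f := by
  rw [smul_eq_C_mul, qD_mul, qD_C, smul_eq_C_mul]; ring

theorem serre_mem_Mf {f : k⟦X⟧} {K : ℕ} (hf : f ∈ Mf k h6 K) :
    12 * qD f - (K : k⟦X⟧) * eisP k * f ∈ Mf k h6 (K + 2) := by
  refine Submodule.span_induction
    (p := fun f _ => 12 * qD f - (K : k⟦X⟧) * eisP k * f ∈ Mf k h6 (K + 2)) ?_ ?_ ?_ ?_ hf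
  · rintro _ ⟨a, b, hab, rfl⟩
    have hK : (K : k⟦X⟧) = 4 * a + 6 * b := by rw [← hab]; push_cast; ring
    have hQ := qD_eisQ k h6
    have hR := qD_eisR k h6
    have hD := isDeriv_Dq (A := k)
    have ha : (a : k⟦X⟧) * eisQ k h6 ^ a = a * eisQ k h6 ^ (a - 1) * eisQ k h6 := by
      cases a with
      | zero => simp
      | succ a => rw [Nat.add_sub_cancel]; ring
    have hb : (b : k⟦X⟧) * eisR k h6 ^ b = b * eisR k h6 ^ (b - 1) * eisR k h6 := by
      cases b with
      | zero => simp
      | succ a => rw [Nat.add_sub_cancel]; ring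
    have e : 12 * qD (eisQ k h6 ^ a * eisR k h6 ^ b) - (K : k⟦X⟧) * eisP k * (eisQ k h6 ^ a * eisR k h6 ^ b)
        = C (-4 * a : k) * (eisQ k h6 ^ (a - 1) * eisR k h6 ^ (b + 1))
          + C (-6 * b : k) * (eisQ k h6 ^ (a + 2) * eisR k h6 ^ (b - 1)) := by
      have h1 := hD.pow' (eisQ k h6) a
      have h2 := hD.pow' (eisR k h6) b
      rw [Dq_apply, Dq_apply] at h1 h2
      rw [qD_mul, h1, h2, hK]
      simp only [map_mul, map_neg, map_ofNat, map_natCast]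
      linear_combination 4 * (a : k⟦X⟧) * eisQ k h6 ^ (a - 1) * eisR k h6 ^ b * hQ
        + 6 * (b : k⟦X⟧) * eisR k h6 ^ (b - 1) * eisQ k h6 ^ a * hR
        - 4 * eisP k * eisR k h6 ^ b * ha - 6 * eisP k * eisQ k h6 ^ a * hb
    rw [e]
    refine Submodule.add_mem _ ?_ ?_
    · cases a with
      | zero => simp
      | succ a => exact C_mul_mem_Mf _ (monomial_mem_Mf k h6 (by omega))
    · cases b with
      | zero => simp
      | succ b => exact C_mul_mem_Mf _ (monomial_mem_Mf k h6 (by omega))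
  · simp
  · intro x y _ _ hx hy
    rw [map_add, mul_add, mul_add, add_sub_add_comm]; exact Submodule.add_mem _ hx hy
  · intro a x _ hx
    rw [qD_smul, mul_smul_comm, mul_smul_comm, ← smul_sub]; exact Submodule.smul_mem _ _ hx

end ModularForms

section Operators

variable (k : Type*) [Field k]

/-- Differential operators of order less than `n` with power series coefficients. -/
noncomputable def Low (n : ℕ) : Submodule k⟦X⟧ (k⟦X⟧ → k⟦X⟧) :=
  Submodule.span k⟦X⟧ {L | ∃ i < n, L = (qD (R := k))^[i]}

variable {k}

theorem Low.mono {n n' : ℕ} (h : n ≤ n') {L : k⟦X⟧ → k⟦X⟧} (hL : L ∈ Low k n) : L ∈ Low k n' :=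
  Submodule.span_mono (by rintro _ ⟨i, hi, rfl⟩; exact ⟨i, by omega, rfl⟩) hL

theorem iterate_mem_Low {i n : ℕ} (h : i < n) : (qD (R := k))^[i] ∈ Low k n :=
  Submodule.subset_span ⟨i, h, rfl⟩

theorem Low.qD {n : ℕ} {L : k⟦X⟧ → k⟦X⟧} (hL : L ∈ Low k n) :
    (fun α => SptRare.qD (L α)) ∈ Low k (n + 1) := by
  refine Submodule.span_induction
    (p := fun L _ => (fun α => SptRare.qD (L α)) ∈ Low k (n + 1)) ?_ ?_ ?_ ?_ hL
  · rintro _ ⟨i, hi, rfl⟩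
    convert iterate_mem_Low (k := k) (show i + 1 < n + 1 by omega) using 1
    funext α
    rw [Function.iterate_succ_apply']
  · convert Submodule.zero_mem _ using 1
    funext α; simp
  · intro x y _ _ hx hy
    convert Submodule.add_mem _ hx hy using 1
    funext α; simp
  · intro a x hx' hx
    convert Submodule.add_mem _ (Submodule.smul_mem _ a hx)
      (Submodule.smul_mem _ (SptRare.qD a) (Low.mono (Nat.le_succ n) hx')) using 1
    funext α
    simp only [Pi.smul_apply, Pi.add_apply, smul_eq_mul, qD_mul]
    ring

/-- A polynomial in the Euler operator with power series coefficients. -/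
noncomputable def opEval (e : Polynomial k⟦X⟧) (α : k⟦X⟧) : k⟦X⟧ :=
  e.sum fun i a => a * (qD (R := k))^[i] α

theorem degree_C_mul_le' (a : k⟦X⟧) (e : Polynomial k⟦X⟧) :
    (Polynomial.C a * e).degree ≤ e.degree := by
  rw [← Polynomial.smul_eq_C_mul]; exact Polynomial.degree_smul_le _ _

theorem opEval_add (e e' : Polynomial k⟦X⟧) (α : k⟦X⟧) :
    opEval (e + e') α = opEval e α + opEval e' α :=
  Polynomial.sum_add_index _ _ _ (by simp) (by intros; ring)

theorem opEval_monomial (n : ℕ) (a α : k⟦X⟧) :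
    opEval (Polynomial.monomial n a) α = a * (qD (R := k))^[n] α :=
  Polynomial.sum_monomial_index _ _ (by simp)

theorem opEval_C_mul (a : k⟦X⟧) (e : Polynomial k⟦X⟧) (α : k⟦X⟧) :
    opEval (Polynomial.C a * e) α = a * opEval e α := by
  induction e using Polynomial.induction_on' with
  | add p q hp hq => rw [mul_add, opEval_add, opEval_add, hp, hq, mul_add]
  | monomial n b => rw [Polynomial.C_mul_monomial, opEval_monomial, opEval_monomial, mul_assoc]

theorem iterate_qD_X_pow (n N : ℕ) :
    (qD (R := k))^[n] (X ^ N) = (N : k⟦X⟧) ^ n * X ^ N := by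
  induction n with
  | zero => simp
  | succ n ih =>
    rw [Function.iterate_succ_apply', ih, qD_mul, qD_X_pow, ← map_natCast C, ← map_pow, qD_C]
    simp only [map_pow]; ring

theorem opEval_X_pow (e : Polynomial k⟦X⟧) (N : ℕ) :
    opEval e (X ^ N) = e.eval (N : k⟦X⟧) * X ^ N := by
  induction e using Polynomial.induction_on' with
  | add p q hp hq => rw [opEval_add, hp, hq, Polynomial.eval_add, add_mul]
  | monomial n b => rw [opEval_monomial, iterate_qD_X_pow, Polynomial.eval_monomial, mul_assoc]

theorem coeff_iterate_qD (i n : ℕ) (α : k⟦X⟧) :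
    coeff n ((qD (R := k))^[i] α) = (n : k) ^ i * coeff n α := by
  induction i with
  | zero => simp
  | succ i ih => rw [Function.iterate_succ_apply', coeff_qD, ih]; ring

theorem coeff_opEval_map (p : Polynomial k) (α : k⟦X⟧) (n : ℕ) :
    coeff n (opEval (p.map C) α) = p.eval (n : k) * coeff n α := by
  induction p using Polynomial.induction_on' with
  | add p q hp hq => rw [Polynomial.map_add, opEval_add, map_add, hp, hq, Polynomial.eval_add, add_mul]
  | monomial i b =>
    rw [Polynomial.map_monomial, opEval_monomial, Polynomial.eval_monomial, coeff_C_mul,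
      coeff_iterate_qD, mul_assoc]

theorem exists_opEval {n : ℕ} {L : k⟦X⟧ → k⟦X⟧} (hL : L ∈ Low k n) :
    ∃ e : Polynomial k⟦X⟧, e.degree < n ∧ ∀ α, L α = opEval e α := by
  refine Submodule.span_induction (p := fun L _ => ∃ e : Polynomial k⟦X⟧, e.degree < n ∧
    ∀ α, L α = opEval e α) ?_ ?_ ?_ ?_ hL
  · rintro _ ⟨i, hi, rfl⟩
    refine ⟨Polynomial.monomial i 1, ?_, fun α => by rw [opEval_monomial, one_mul]⟩
    exact (Polynomial.degree_monomial_le _ _).trans_lt (by exact_mod_cast hi)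
  · exact ⟨0, by simp, fun α => by simp [opEval]⟩
  · rintro x y _ _ ⟨e, he, hx⟩ ⟨f, hf, hy⟩
    refine ⟨e + f, (Polynomial.degree_add_le _ _).trans_lt (max_lt he hf), fun α => ?_⟩
    rw [opEval_add, Pi.add_apply, hx, hy]
  · rintro a x _ ⟨e, he, hx⟩
    refine ⟨Polynomial.C a * e, ?_, fun α => ?_⟩
    · exact (degree_C_mul_le' _ _).trans_lt he
    · rw [opEval_C_mul, Pi.smul_apply, smul_eq_mul, hx]

/-- An operator of order `m` with constant leading coefficient, annihilating the powers of `q` with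
`m` prescribed exponents, has constant coefficients. -/
theorem opEval_eq_of_roots {m : ℕ} {e : Polynomial k⟦X⟧} (he : e.degree < m) (a : k) (N : ℕ → ℕ)
    (hN : Set.InjOn (fun j => (N j : k)) (range m))
    (h : ∀ j < m, opEval e (X ^ N j) + C a * (qD (R := k))^[m] (X ^ N j) = 0) (α : k⟦X⟧) :
    opEval e α + C a * (qD (R := k))^[m] α
      = C a * mk fun n => (∏ j ∈ range m, ((n : k) - N j)) * coeff n α := by
  set p : Polynomial k := ∏ j ∈ range m, (Polynomial.X - Polynomial.C (N j : k)) with hp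
  have hpm : p.Monic := Polynomial.monic_prod_of_monic _ _ fun j _ => Polynomial.monic_X_sub_C _
  have hpd : p.natDegree = m := by
    rw [hp, Polynomial.natDegree_prod_of_monic _ _ fun j _ => Polynomial.monic_X_sub_C _]
    simp only [Polynomial.natDegree_X_sub_C, sum_const, card_range, smul_eq_mul, mul_one]
  set E : Polynomial k⟦X⟧ := e + Polynomial.monomial m (C a) with hE
  have hEα : ∀ α, opEval E α = opEval e α + C a * (qD (R := k))^[m] α := fun α => by
    rw [hE, opEval_add, opEval_monomial]
  have hEp : E = Polynomial.C (C a) * p.map C := by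
    have hinj : Set.InjOn (fun j => (N j : k⟦X⟧)) (range m) := fun i hi j hj hij => by
      refine hN hi hj (C_injective (R := k) ?_)
      simpa using hij
    have hd : (E - Polynomial.C (C a) * p.map C).degree < m := by
      have e1 : (Polynomial.monomial m (C a) - Polynomial.C (C a) * p.map C : Polynomial k⟦X⟧)
          = Polynomial.C (C a) * (Polynomial.X ^ m - p.map C) := by
        rw [← Polynomial.C_mul_X_pow_eq_monomial]; ring
      have e2 : (Polynomial.X ^ m - p.map C : Polynomial k⟦X⟧).degree < m := by
        have hdeg : (Polynomial.X ^ m : Polynomial k⟦X⟧).degree = (p.map C : Polynomial k⟦X⟧).degree := by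
          rw [Polynomial.degree_X_pow, hpm.degree_map, Polynomial.degree_eq_natDegree hpm.ne_zero, hpd]
        have := Polynomial.degree_sub_lt_left hdeg (Polynomial.monic_X_pow m).ne_zero
          (by rw [(Polynomial.monic_X_pow m).leadingCoeff, (hpm.map C).leadingCoeff])
        rwa [Polynomial.degree_X_pow] at this
      rw [hE, add_sub_assoc, e1]
      exact (Polynomial.degree_add_le _ _).trans_lt
        (max_lt he ((degree_C_mul_le' _ _).trans_lt e2))
    refine sub_eq_zero.1 (Polynomial.eq_zero_of_degree_lt_of_eval_index_eq_zero
      (s := range m) (v := fun j => (N j : k⟦X⟧)) hinj (by rwa [card_range]) fun j hj => ?_)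
    have h1 := h j (mem_range.1 hj)
    rw [← hEα, opEval_X_pow] at h1
    have h2 : E.eval (N j : k⟦X⟧) = 0 := (mul_eq_zero.1 h1).resolve_right (pow_ne_zero _ X_ne_zero)
    rw [Polynomial.eval_sub, h2, Polynomial.eval_mul, ← map_natCast C, Polynomial.eval_map,
      Polynomial.eval₂_at_apply, hp, Polynomial.eval_prod, prod_eq_zero hj (by simp)]
    simp
  rw [← hEα, hEp, opEval_C_mul]
  congr 1
  ext n
  rw [coeff_opEval_map, coeff_mk, hp, Polynomial.eval_prod]
  simp

end Operators

section Recursion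

variable (k : Type*) [Field k] (h6 : (6 : k) ≠ 0)

/-- The pairs `(α, ν)` are mapped to power series by an operator of order less than `n` in `α`,
up to multiples of a form of weight `K`. -/
def HasForm (n K : ℕ) (F : k⟦X⟧ → k → k⟦X⟧) : Prop :=
  ∃ L ∈ Low k n, ∃ μ ∈ Mf k h6 K, ∀ α ν, F α ν = euler k * L α + C ν * μ

/-- The same as `HasForm (n + 1) K`, with constant leading coefficient `a`. -/
def HasTop (n K : ℕ) (a : k) (F : k⟦X⟧ → k → k⟦X⟧) : Prop :=
  ∃ L ∈ Low k n, ∃ μ ∈ Mf k h6 K, ∀ α ν,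
    F α ν = euler k * (L α + C a * (qD (R := k))^[n] α) + C ν * μ

variable {k} {h6}

theorem HasTop.hasForm {n n' K : ℕ} {a : k} {F : k⟦X⟧ → k → k⟦X⟧} (h : HasTop k h6 n K a F)
    (hn : n < n') : HasForm k h6 n' K F := by
  obtain ⟨L, hL, μ, hμ, hF⟩ := h
  refine ⟨L + C a • (qD (R := k))^[n], Submodule.add_mem _ (Low.mono hn.le hL)
    (Submodule.smul_mem _ _ (iterate_mem_Low hn)), μ, hμ, fun α ν => ?_⟩
  rw [hF, Pi.add_apply, Pi.smul_apply, smul_eq_mul]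

theorem HasForm.mul {n K K' : ℕ} {F : k⟦X⟧ → k → k⟦X⟧} (h : HasForm k h6 n K F)
    {f : k⟦X⟧} (hf : f ∈ Mf k h6 K') : HasForm k h6 n (K + K') fun α ν => f * F α ν := by
  obtain ⟨L, hL, μ, hμ, hF⟩ := h
  refine ⟨f • L, Submodule.smul_mem _ _ hL, μ * f, mul_mem_Mf hμ hf, fun α ν => ?_⟩
  beta_reduce
  rw [hF, Pi.smul_apply, smul_eq_mul]; ring

theorem HasForm.zero (n K : ℕ) : HasForm k h6 n K fun _ _ => 0 :=
  ⟨0, Submodule.zero_mem _, 0, Submodule.zero_mem _, fun α ν => by simp⟩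

theorem HasTop.add {n K : ℕ} {a : k} {F G : k⟦X⟧ → k → k⟦X⟧} (h : HasTop k h6 n K a F)
    (h' : HasForm k h6 n K G) : HasTop k h6 n K a fun α ν => F α ν + G α ν := by
  obtain ⟨L, hL, μ, hμ, hF⟩ := h
  obtain ⟨L', hL', μ', hμ', hG⟩ := h'
  refine ⟨L + L', Submodule.add_mem _ hL hL', μ + μ', Submodule.add_mem _ hμ hμ', fun α ν => ?_⟩
  beta_reduce
  rw [hF, hG, Pi.add_apply]; ring

theorem HasTop.C_mul {n K : ℕ} {a : k} {F : k⟦X⟧ → k → k⟦X⟧} (h : HasTop k h6 n K a F) (c : k) :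
    HasTop k h6 n K (c * a) fun α ν => C c * F α ν := by
  obtain ⟨L, hL, μ, hμ, hF⟩ := h
  refine ⟨C c • L, Submodule.smul_mem _ _ hL, C c * μ, C_mul_mem_Mf _ hμ, fun α ν => ?_⟩
  beta_reduce
  rw [hF, Pi.smul_apply, smul_eq_mul, map_mul]; ring

theorem two_mul_qD_euler : 24 * qD (euler k) = (eisP k - 1) * euler k := by
  rw [qD_euler, eisP]; ring

theorem HasTop.serre {n N : ℕ} {a : k} {F : k⟦X⟧ → k → k⟦X⟧} (h : HasTop k h6 n (2 * N) a F) :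
    HasTop k h6 (n + 1) (2 * N + 2) (-36 * a)
      fun α ν => -36 * qD (F α ν) + 6 * N * eisP k * F α ν := by
  obtain ⟨L, hL, μ, hμ, hF⟩ := h
  have h2 : (2 : k⟦X⟧) * C (2⁻¹ : k) = 1 := by
    rw [← map_ofNat C, ← map_mul, mul_inv_cancel₀, map_one]
    intro h; apply h6; linear_combination 3 * h
  have h3 := two_mul_qD_euler (k := k)
  set w : k⟦X⟧ := -3 * C (2⁻¹ : k) * (eisP k - 1) + 6 * N * eisP k with hw
  refine ⟨(-36 : k⟦X⟧) • (fun α => qD (L α)) + w • (L + C a • (qD (R := k))^[n]),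
    Submodule.add_mem _ (Submodule.smul_mem _ _ (Low.qD hL)) (Submodule.smul_mem _ _
      (Submodule.add_mem _ (Low.mono (Nat.le_succ n) hL)
        (Submodule.smul_mem _ _ (iterate_mem_Low (Nat.lt_succ_self n))))),
    C (-3) * (12 * qD μ - ((2 * N : ℕ) : k⟦X⟧) * eisP k * μ), C_mul_mem_Mf _ (serre_mem_Mf hμ),
    fun α ν => ?_⟩
  beta_reduce
  rw [hF, map_add, qD_mul, qD_mul, map_add, qD_mul, qD_C, qD_C, Function.iterate_succ_apply']
  simp only [Pi.add_apply, Pi.smul_apply, smul_eq_mul, map_mul, map_neg, map_ofNat, Nat.cast_mul,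
    Nat.cast_ofNat, hw]
  linear_combination (-3 * C (2⁻¹ : k) * (L α + C a * (qD (R := k))^[n] α)) * h3
    + 36 * qD (euler k) * (L α + C a * (qD (R := k))^[n] α) * h2

variable (k)

/-- One step of the recursion for the moments. -/
noncomputable def recStep (N : ℕ) (F G H : k⟦X⟧) : k⟦X⟧ :=
  (-36 * qD F + 6 * N * eisP k * F) + (C (3 * N * (2 * N - 3) : k) * eisQ k h6 * G
    + C (-4 * N * (N - 1) : k) * eisR k h6 * H)

variable (h6)

/-- The moments in terms of the first two of them. -/
noncomputable def phi : ℕ → k⟦X⟧ → k → k⟦X⟧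
  | 0, _, ν => C ν
  | 1, α, _ => euler k * α
  | 2, α, ν => C (((1 : ℕ) : k) * (2 * (1 : ℕ) + 1))⁻¹ * recStep k (h6 := h6) 1 (phi 1 α ν) (phi 0 α ν) (phi 0 α ν)
  | n + 3, α, ν => C (((n + 2 : ℕ) : k) * (2 * (n + 2 : ℕ) + 1))⁻¹ *
      recStep k (h6 := h6) (n + 2) (phi (n + 2) α ν) (phi (n + 1) α ν) (phi n α ν)

theorem phi_succ {n : ℕ} (hn : 1 ≤ n) (α : k⟦X⟧) (ν : k) :
    phi k h6 (n + 1) α ν = C ((n : k) * (2 * n + 1))⁻¹ *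
      recStep k (h6 := h6) n (phi k h6 n α ν) (phi k h6 (n - 1) α ν) (phi k h6 (n - 2) α ν) := by
  match n, hn with
  | 1, _ => rfl
  | n + 2, _ => rw [phi]; rfl

variable {k} {h6}

theorem HasForm.add {n K : ℕ} {F G : k⟦X⟧ → k → k⟦X⟧} (h : HasForm k h6 n K F)
    (h' : HasForm k h6 n K G) : HasForm k h6 n K fun α ν => F α ν + G α ν := by
  obtain ⟨L, hL, μ, hμ, hF⟩ := h
  obtain ⟨L', hL', μ', hμ', hG⟩ := h'
  refine ⟨L + L', Submodule.add_mem _ hL hL', μ + μ', Submodule.add_mem _ hμ hμ', fun α ν => ?_⟩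
  beta_reduce
  rw [hF, hG, Pi.add_apply]; ring

theorem hasTop_recStep {N : ℕ} (hN : 1 ≤ N) {a : k}
    (h1 : HasTop k h6 (N - 1) (2 * N) a (phi k h6 N))
    (h2 : HasForm k h6 N (2 * (N - 1)) (phi k h6 (N - 1)))
    (h3 : 2 ≤ N → HasForm k h6 N (2 * (N - 2)) (phi k h6 (N - 2))) :
    HasTop k h6 N (2 * N + 2) (-36 * a) fun α ν =>
      recStep k (h6 := h6) N (phi k h6 N α ν) (phi k h6 (N - 1) α ν) (phi k h6 (N - 2) α ν) := by
  have e1 := h1.serre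
  rw [Nat.sub_add_cancel hN] at e1
  refine e1.add (HasForm.add ?_ ?_)
  · have := h2.mul (C_mul_mem_Mf (3 * N * (2 * N - 3) : k) (eisQ_mem_Mf k h6))
    rwa [show 2 * (N - 1) + 4 = 2 * N + 2 by omega] at this
  · by_cases h : 2 ≤ N
    · have := (h3 h).mul (C_mul_mem_Mf (-4 * N * (N - 1) : k) (eisR_mem_Mf k h6))
      rwa [show 2 * (N - 2) + 6 = 2 * N + 2 by omega] at this
    · obtain rfl : N = 1 := by omega
      simpa using HasForm.zero (k := k) (h6 := h6) 1 _

theorem hasTop_phi (N : ℕ) (hN : 1 ≤ N) (h : ∀ n < N, 1 ≤ n → (n : k) * (2 * n + 1) ≠ 0) :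
    ∃ a ≠ 0, HasTop k h6 (N - 1) (2 * N) a (phi k h6 N) := by
  induction N using Nat.strong_induction_on with
  | _ N ih =>
  obtain rfl | hN' := hN.eq_or_lt
  · exact ⟨1, one_ne_zero, 0, Submodule.zero_mem _, 0, Submodule.zero_mem _, fun α ν => by simp [phi]⟩
  obtain ⟨n, rfl⟩ : ∃ n, N = n + 1 := ⟨N - 1, by omega⟩
  have hform : ∀ i < n, HasForm k h6 n (2 * i) (phi k h6 i) := fun i hi => by
    obtain rfl | hi0 := i.eq_zero_or_pos
    · exact ⟨0, Submodule.zero_mem _, 1, one_mem_Mf k h6, fun α ν => by simp [phi]⟩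
    · obtain ⟨a, -, h'⟩ := ih i (by omega) hi0 fun j hj => h j (by omega)
      exact h'.hasForm (by omega)
  obtain ⟨a, ha, h'⟩ := ih n (by omega) (by omega) fun j hj => h j (by omega)
  have := (hasTop_recStep (by omega) h' (hform (n - 1) (by omega))
    fun h => hform (n - 2) (by omega)).C_mul ((n : k) * (2 * n + 1))⁻¹
  refine ⟨_, mul_ne_zero (inv_ne_zero (h n (by omega) (by omega))) (mul_ne_zero (a := -36) ?_ ha), ?_⟩
  · rw [show (-36 : k) = -(6 * 6) by norm_num]
    exact neg_ne_zero.2 (mul_ne_zero h6 h6)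
  · obtain ⟨L, hL, μ, hμ, hF⟩ := this
    exact ⟨L, hL, μ, hμ, fun α ν => (phi_succ k h6 (by omega) α ν).trans (hF α ν)⟩

/-- When the recursion breaks down, the first two moments satisfy a differential equation. -/
theorem exists_recStep {m : ℕ} (hm : 1 ≤ m) (h : ∀ n < m, 1 ≤ n → (n : k) * (2 * n + 1) ≠ 0) :
    ∃ a ≠ 0, HasTop k h6 m (2 * m + 2) a fun α ν =>
      recStep k (h6 := h6) m (phi k h6 m α ν) (phi k h6 (m - 1) α ν) (phi k h6 (m - 2) α ν) := by
  obtain ⟨a, ha, h'⟩ := hasTop_phi (h6 := h6) m hm h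
  have hform : ∀ i < m, HasForm k h6 m (2 * i) (phi k h6 i) := fun i hi => by
    obtain rfl | hi0 := i.eq_zero_or_pos
    · exact ⟨0, Submodule.zero_mem _, 1, one_mem_Mf k h6, fun α ν => by simp [phi]⟩
    · obtain ⟨a, -, h'⟩ := hasTop_phi (h6 := h6) i hi0 fun j hj => h j (by omega)
      exact h'.hasForm (by omega)
  refine ⟨_, mul_ne_zero ?_ ha, hasTop_recStep hm h' (hform (m - 1) (by omega))
    fun h => hform (m - 2) (by omega)⟩
  rw [show (-36 : k) = -(6 * 6) by norm_num]
  exact neg_ne_zero.2 (mul_ne_zero h6 h6)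

theorem moment_rec' {ν : k⟦X⟧} {Z : Omg k} (hZ : IsSol k ν Z) (n : ℕ) (hn : (n + 1 : k) ≠ 0) :
    (n : k⟦X⟧) * (2 * n + 1) * moment k Z (n + 1) = recStep k (h6 := h6) n (moment k Z n)
      (moment k Z (n - 1)) (moment k Z (n - 2)) := by
  have h := moment_rec k h6 hZ n hn
  rw [recStep]
  simp only [map_mul, map_sub, map_neg, map_one, map_ofNat, map_natCast]
  linear_combination h

theorem moment_eq_phi {ν : k⟦X⟧} {Z : Omg k} (hZ : IsSol k ν Z) {α : k⟦X⟧} {c : k}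
    (h0 : moment k Z 0 = C c) (h1 : moment k Z 1 = euler k * α) {m : ℕ}
    (h : ∀ n < m, 1 ≤ n → (n : k) * (2 * n + 1) ≠ 0) (hn : ∀ n < m, (n + 1 : k) ≠ 0) (N : ℕ)
    (hN : N ≤ m) : moment k Z N = phi k h6 N α c := by
  induction N using Nat.strong_induction_on with
  | _ N ih =>
  match N with
  | 0 => rw [h0, phi]
  | 1 => rw [h1, phi]
  | n + 2 =>
    rw [phi_succ k h6 (by omega), ← ih (n + 1) (by omega) (by omega),
      ← ih (n + 1 - 1) (by omega) (by omega), ← ih (n + 1 - 2) (by omega) (by omega),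
      ← moment_rec' hZ (n + 1) (hn _ (by omega)), ← mul_assoc]
    have e : (((n + 1 : ℕ) : k⟦X⟧) * (2 * (n + 1 : ℕ) + 1))
        = C (((n + 1 : ℕ) : k) * (2 * (n + 1 : ℕ) + 1)) := by
      simp only [map_mul, map_add, map_natCast, map_ofNat, map_one]
    rw [e, ← map_mul, inv_mul_cancel₀ (h (n + 1) (by omega) (by omega)), map_one, one_mul]

theorem opEval_C_mul_right (e : Polynomial k⟦X⟧) (c : k) (α : k⟦X⟧) :
    opEval e (C c * α) = C c * opEval e α := by
  have hi : ∀ i : ℕ, (qD (R := k))^[i] (C c * α) = C c * (qD (R := k))^[i] α := fun i => by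
    induction i with
    | zero => rfl
    | succ i ih =>
      rw [Function.iterate_succ_apply', ih, qD_mul, qD_C, zero_mul, zero_add,
        Function.iterate_succ_apply']
  rw [opEval, opEval, Polynomial.sum, Polynomial.sum, mul_sum]
  exact sum_congr rfl fun i _ => by rw [hi]; ring

/-- The differential equation for the first moments in the case that there are sufficiently many
elementary solutions. -/
theorem form_of_moment {m : ℕ} (hm : 1 ≤ m) (h : ∀ n < m, 1 ≤ n → (n : k) * (2 * n + 1) ≠ 0)
    (hm' : (2 * m + 1 : k) = 0) (hn : ∀ n ≤ m, (n + 1 : k) ≠ 0)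
    (N : ℕ → ℕ) (hN : ∀ j < m, (6 * N j + j * (j + 1) : k) = 0)
    (hNi : Set.InjOn (fun j => (N j : k)) (range m)) {ν : k⟦X⟧} {Z : Omg k} (hZ : IsSol k ν Z)
    {α : k⟦X⟧} {c : k} (h0 : moment k Z 0 = C c) (h1 : moment k Z 1 = euler k * α) :
    euler k * (mk fun n => (∏ j ∈ range m, ((n : k) - N j)) * coeff n α)
      ∈ Mf k h6 (2 * m + 2) := by
  obtain ⟨a, ha, L, hL, μ, hμ, hF⟩ := exists_recStep (h6 := h6) hm h
  obtain ⟨e, he, hLe⟩ := exists_opEval hL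
  have key : ∀ {ν : k⟦X⟧} {Z : Omg k} (_ : IsSol k ν Z) {α : k⟦X⟧} {c : k}
      (_ : moment k Z 0 = C c) (_ : moment k Z 1 = euler k * α),
      euler k * (opEval e α + C a * (qD (R := k))^[m] α) + C c * μ = 0 := by
    intro ν Z hZ α c h0 h1
    have hM := moment_eq_phi (h6 := h6) hZ h0 h1 h fun n h => hn n h.le
    rw [← hLe, ← hF]
    beta_reduce
    rw [← hM m le_rfl, ← hM (m - 1) (by omega), ← hM (m - 2) (by omega),
      ← moment_rec' hZ m (hn m le_rfl)]
    have : (2 * m + 1 : k⟦X⟧) = 0 := by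
      have := congrArg (C (R := k)) hm'
      simpa only [map_mul, map_add, map_natCast, map_ofNat, map_one, map_zero] using this
    rw [this]; ring
  have hu : euler k ≠ 0 := fun h => by simpa [h] using euler_mul_inv k
  have hroot : ∀ j < m, opEval e (X ^ N j) + C a * (qD (R := k))^[m] (X ^ N j) = 0 := by
    intro j hj
    obtain ⟨e0, e1⟩ := moment_elem k h6 (N j) j
    set c : k := -144 * (2 * j + 1) with hc
    have hc0 : c ≠ 0 := by
      rw [hc]
      refine mul_ne_zero ?_ ?_
      · intro h0; apply h6
        have : (6 : k) * (6 * (6 * 6)) = 0 := by linear_combination -9 * h0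
        simp [h6] at this
      · obtain rfl | hj0 := j.eq_zero_or_pos
        · simp
        · exact right_ne_zero_of_mul (h j hj hj0)
    have e1' : moment k (zsol k (elem k (N j) j)) 1 = euler k * (C c * X ^ N j) := by
      rw [e1, hc]; simp only [map_mul, map_add, map_neg, map_one, map_ofNat, map_natCast]; ring
    have := key (isSol_elem k h6 (N j) j (hN j hj)) (c := 0) (by rw [e0, map_zero]) e1'
    rw [map_zero, zero_mul, add_zero, opEval_C_mul_right] at this
    have e2 : (qD (R := k))^[m] (C c * X ^ N j) = C c * (qD (R := k))^[m] (X ^ N j) := by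
      have := opEval_C_mul_right (k := k) (Polynomial.monomial m 1) c (X ^ N j)
      simpa only [opEval_monomial, one_mul] using this
    rw [e2] at this
    have e3 : (euler k * C c) * (opEval e (X ^ N j) + C a * (qD (R := k))^[m] (X ^ N j)) = 0 := by
      linear_combination this
    exact (mul_eq_zero.1 e3).resolve_left
      (mul_ne_zero hu (by simpa using (C_injective (R := k)).ne hc0))
  have hmain := key hZ h0 h1
  rw [opEval_eq_of_roots he a N hNi hroot α] at hmain
  have hCa : (C a⁻¹ * C a : k⟦X⟧) = 1 := by rw [← map_mul, inv_mul_cancel₀ ha, map_one]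
  have : euler k * (mk fun n => (∏ j ∈ range m, ((n : k) - N j)) * coeff n α)
      = C (-a⁻¹ * c) * μ := by
    rw [map_mul, map_neg]
    linear_combination C a⁻¹ * hmain
      - euler k * (mk fun n => (∏ j ∈ range m, ((n : k) - N j)) * coeff n α) * hCa
  rw [this]
  exact C_mul_mem_Mf _ hμ

end Recursion

section Existence

/-- The generating function of `12 spt(n) + (24 n - 1) p(n)`. -/
noncomputable def aSeries (k : Type*) [Field k] : k⟦X⟧ :=
  12 * sptSeries k + 24 * qD (partSeries k) - partSeries k

theorem euler_mul_aSeries (k : Type*) [Field k] :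
    euler k * aSeries k = 36 * sigmaSeries k + 12 * rankSeries k - 1 := by
  have h1 := euler_mul_partSeries k
  have h2 := congrArg qD h1
  rw [qD_mul, Derivation.map_one_eq_zero, qD_euler] at h2
  rw [aSeries]
  linear_combination 12 * euler_mul_sptSeries k + (24 * sigmaSeries k - 1) * h1 + 24 * h2

variable (l : ℕ) [hl : Fact l.Prime]

/-- The polynomial whose values are nonzero exactly if `1 - 24 n` is not a nonzero square. -/
def resPoly (n : ZMod l) : ZMod l := ∏ j ∈ range (l / 2), (n + j * (j + 1) / 6)

/-- The part of `aSeries` supported on nonresidues, twisted by `resPoly` and multiplied by the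
Euler product. -/
noncomputable def gform : (ZMod l)⟦X⟧ :=
  euler (ZMod l) * mk fun n => resPoly l n * coeff n (aSeries (ZMod l))

variable {l}

theorem natCast_ne_zero_of_lt {n : ℕ} (h0 : 0 < n) (h : n < l) : (n : ZMod l) ≠ 0 := by
  rw [Ne, ZMod.natCast_eq_zero_iff]; exact fun h' => absurd (Nat.le_of_dvd h0 h') (by omega)

theorem six_ne_zero_of_le (h5 : 5 ≤ l) : (6 : ZMod l) ≠ 0 := by
  intro h
  have h' : ((2 * 3 : ℕ) : ZMod l) = 0 := by push_cast; linear_combination h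
  rw [Nat.cast_mul] at h'
  exact mul_ne_zero (natCast_ne_zero_of_lt (by omega) (by omega))
    (natCast_ne_zero_of_lt (by omega) (by omega)) h'

theorem two_mul_half (h5 : 5 ≤ l) : 2 * (l / 2) + 1 = l :=
  Nat.two_mul_div_two_add_one_of_odd (hl.out.odd_of_ne_two (by omega))

theorem gform_mem_Mf (h5 : 5 ≤ l) (h6 : (6 : ZMod l) ≠ 0) : gform l ∈ Mf (ZMod l) h6 (l + 1) := by
  have hm := two_mul_half h5
  set m := l / 2 with hmdef
  set N : ℕ → ℕ := fun j => (-((j : ZMod l) * (j + 1) / 6)).val with hN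
  have hNc : ∀ j, (N j : ZMod l) = -((j : ZMod l) * (j + 1) / 6) := fun j =>
    ZMod.natCast_zmod_val _
  have h12 : (12 : ZMod l) ≠ 0 := by
    intro h; apply h6
    have : (6 : ZMod l) * 6 = 0 := by linear_combination 3 * h
    exact mul_self_eq_zero.1 this
  obtain ⟨e0, e1⟩ := moment_vser (ZMod l) h6
  have key := form_of_moment (k := ZMod l) (h6 := h6) (m := m) (by omega)
    (fun n hn h1 => by
      have := natCast_ne_zero_of_lt (l := l) (n := 2 * n + 1) (by omega) (by omega)
      push_cast at this
      exact mul_ne_zero (natCast_ne_zero_of_lt (by omega) (by omega)) this)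
    (by
      have : ((2 * m + 1 : ℕ) : ZMod l) = 0 := by rw [hm]; exact ZMod.natCast_self l
      exact_mod_cast this)
    (fun n hn => by
      have := natCast_ne_zero_of_lt (l := l) (n := n + 1) (by omega) (by omega)
      exact_mod_cast this)
    N (fun j _ => by rw [hNc]; field_simp; ring)
    (fun i hi j hj hij => by
      simp only [coe_range, Set.mem_Iio] at hi hj
      simp only [hNc, neg_inj, div_left_inj' h6] at hij
      have h : ((i : ZMod l) - j) * ((i + j + 1 : ℕ) : ZMod l) = 0 := by
        push_cast; linear_combination hij
      have h' := (mul_eq_zero.1 h).resolve_right (natCast_ne_zero_of_lt (by omega) (by omega))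
      rw [sub_eq_zero, ZMod.natCast_eq_natCast_iff] at h'
      exact Nat.ModEq.eq_of_lt_of_lt h' (by omega) (by omega))
    (isSol_vser (ZMod l) h6) (α := C (-12) * aSeries (ZMod l)) (c := 12) (by rw [e0, map_ofNat])
    (by
      rw [e1, map_neg, map_ofNat]
      linear_combination 12 * euler_mul_aSeries (ZMod l))
  rw [show 2 * m + 2 = l + 1 by omega] at key
  have h2 := C_mul_mem_Mf (-12 : ZMod l)⁻¹ key
  convert h2 using 1
  rw [gform, mul_left_comm]
  congr 1
  ext n
  rw [coeff_mk, coeff_C_mul, coeff_mk, coeff_C_mul, resPoly, ← hmdef]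
  simp only [hNc, sub_neg_eq_add]
  field_simp

theorem constantCoeff_gform (h5 : 5 ≤ l) : constantCoeff (gform l) = 0 := by
  have hm := two_mul_half h5
  rw [gform, map_mul, ← coeff_zero_eq_constantCoeff_apply (mk _), coeff_mk, resPoly,
    prod_eq_zero (mem_range.2 (show 0 < l / 2 by omega)) (by simp), zero_mul, mul_zero]

end Existence

section Hasse

variable (k : Type*) [Field k] (h6 : (6 : k) ≠ 0)

/-- The polynomials of weight `2 n` in `wp` with modular forms as coefficients. -/
noncomputable def wpForms (n : ℕ) : AddSubmonoid (Omg k) :=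
  AddSubmonoid.closure {F | ∃ j K : ℕ, K + 2 * j = 2 * n ∧ ∃ f ∈ Mf k h6 K, F = kap k f * wp k ^ j}

variable {k} {h6}

theorem mem_wpForms {n j K : ℕ} (h : K + 2 * j = 2 * n) {f : k⟦X⟧} (hf : f ∈ Mf k h6 K) :
    kap k f * wp k ^ j ∈ wpForms k h6 n :=
  AddSubmonoid.subset_closure ⟨j, K, h, f, hf, rfl⟩

theorem exists_sum_of_mem_wpForms {n : ℕ} {F : Omg k} (hF : F ∈ wpForms k h6 n) :
    ∃ c : ℕ → k⟦X⟧, (∀ j ≤ n, c j ∈ Mf k h6 (2 * (n - j))) ∧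
      F = ∑ j ∈ range (n + 1), kap k (c j) * wp k ^ j := by
  refine AddSubmonoid.closure_induction (motive := fun F _ => ∃ c : ℕ → k⟦X⟧,
    (∀ j ≤ n, c j ∈ Mf k h6 (2 * (n - j))) ∧
      F = ∑ j ∈ range (n + 1), kap k (c j) * wp k ^ j) ?_ ?_ ?_ hF
  · rintro _ ⟨j, K, h, f, hf, rfl⟩
    refine ⟨fun i => if i = j then f else 0, fun i hi => ?_, ?_⟩
    · dsimp only
      split_ifs with hij
      · subst hij
        rwa [show 2 * (n - i) = K by omega]
      · exact Submodule.zero_mem _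
    · rw [sum_eq_single_of_mem j (mem_range.2 (by omega)) fun i _ hij => by
        beta_reduce
        rw [if_neg hij, map_zero, zero_mul]]
      beta_reduce
      rw [if_pos rfl]
  · exact ⟨0, fun _ _ => Submodule.zero_mem _, by simp⟩
  · rintro _ _ _ _ ⟨c, hc, rfl⟩ ⟨c', hc', rfl⟩
    refine ⟨c + c', fun j hj => Submodule.add_mem _ (hc j hj) (hc' j hj), ?_⟩
    rw [← sum_add_distrib]
    exact sum_congr rfl fun j _ => by rw [Pi.add_apply, map_add, add_mul]

theorem three_mul_dT_wp_sq : 3 * dT k (wp k) ^ 2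
    = wp k ^ 3 - 3 * kap k (eisQ k h6) * wp k + 2 * kap k (eisR k h6) :=
  (heatSystem k h6).weierstrass (two_ne_zero_Omg k h6) (three_ne_zero_Omg k h6)
    (dT_wp_ne_zero k h6) (kap_eisR k h6)

theorem six_mul_dT_dT_wp_pow (j : ℕ) : 6 * dT k (dT k (wp k ^ j)) =
    (2 * j * (j - 1) + 3 * j) * wp k ^ (j + 1)
    - 3 * (2 * j * (j - 1) + j) * kap k (eisQ k h6) * wp k ^ (j - 1)
    + 4 * j * (j - 1) * kap k (eisR k h6) * wp k ^ (j - 2) := by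
  have hd := isDeriv_dT k
  have hW := three_mul_dT_wp_sq (h6 := h6)
  have hdd := two_mul_dT_dT_wp k h6
  rw [hd.pow', hd, hd.natCast_mul, hd.pow']
  rcases j with _ | _ | j
  · simp
  · simp only [zero_add, Nat.sub_self, pow_zero, Nat.zero_sub]
    push_cast
    linear_combination 3 * hdd
  · simp only [show j + 1 + 1 - 1 = j + 1 by omega, show j + 1 - 1 = j by omega,
      show j + 1 + 1 - 2 = j by omega]
    push_cast
    linear_combination (2 * (j + 2) * (j + 1) * wp k ^ j : Omg k) * hW
      + 3 * (j + 2) * wp k ^ (j + 1) * hdd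

theorem dT_dT_mem_wpForms {n : ℕ} {F : Omg k} (hF : F ∈ wpForms k h6 n) :
    dT k (dT k F) ∈ wpForms k h6 (n + 1) := by
  refine AddSubmonoid.closure_induction
    (motive := fun F _ => dT k (dT k F) ∈ wpForms k h6 (n + 1)) ?_ ?_ ?_ hF
  · rintro _ ⟨j, K, h, f, hf, rfl⟩
    have hd := isDeriv_dT k
    have e : dT k (dT k (kap k f * wp k ^ j)) = kap k f * dT k (dT k (wp k ^ j)) := by
      rw [hd, dT_kap, zero_mul, zero_add, hd, dT_kap, zero_mul, zero_add]
    have h1 : kap k (C (6⁻¹ : k)) * 6 = 1 := by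
      rw [← map_ofNat (kap k), ← map_mul, ← map_ofNat C, ← map_mul, inv_mul_cancel₀ h6, map_one,
        map_one]
    have e2 : dT k (dT k (kap k f * wp k ^ j)) =
        kap k (C (6⁻¹ * (2 * j * (j - 1) + 3 * j) : k) * f) * wp k ^ (j + 1)
        + kap k (C (-3 * 6⁻¹ * (2 * j * (j - 1) + j) : k) * (f * eisQ k h6)) * wp k ^ (j - 1)
        + kap k (C (4 * 6⁻¹ * j * (j - 1) : k) * (f * eisR k h6)) * wp k ^ (j - 2) := by
      rw [e]
      simp only [map_mul, map_add, map_sub, map_neg, map_one, map_ofNat, map_natCast]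
      linear_combination kap k (C (6⁻¹ : k)) * kap k f * six_mul_dT_dT_wp_pow (h6 := h6) j
        - kap k f * dT k (dT k (wp k ^ j)) * h1
    rw [e2]
    refine add_mem (add_mem ?_ ?_) ?_
    · exact mem_wpForms (by omega) (C_mul_mem_Mf _ hf)
    · obtain rfl | hj := j.eq_zero_or_pos
      · simp
      · refine mem_wpForms ?_ (C_mul_mem_Mf _ (mul_mem_Mf hf (eisQ_mem_Mf k h6)))
        omega
    · obtain hj | hj := lt_or_ge j 2
      · interval_cases j <;> simp
      · refine mem_wpForms ?_ (C_mul_mem_Mf _ (mul_mem_Mf hf (eisR_mem_Mf k h6)))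
        omega
  · simp
  · intro x y _ _ hx hy
    rw [map_add, map_add]; exact add_mem hx hy

theorem iterate_dT_wp_mem (i : ℕ) : (dT k)^[2 * i] (wp k) ∈ wpForms k h6 (i + 1) := by
  induction i with
  | zero => simpa using mem_wpForms (n := 1) (j := 1) (by norm_num) (one_mem_Mf k h6)
  | succ i ih =>
    rw [show 2 * (i + 1) = 2 * i + 1 + 1 by ring, Function.iterate_succ_apply',
      Function.iterate_succ_apply']
    exact dT_dT_mem_wpForms ih

include h6 in
/-- Powers of `wp` of degree less than the characteristic are independent. -/
theorem wp_pow_indep (n : ℕ) (hn : ∀ j, 0 < j → j < n → (j : k) ≠ 0) (b : ℕ → k⟦X⟧)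
    (h : ∑ j ∈ range n, kap k (b j) * wp k ^ j = 0) : ∀ j < n, b j = 0 := by
  induction n generalizing b with
  | zero => intro j hj; omega
  | succ n ih =>
    have hd := isDeriv_dT k
    have h1 := congrArg (dT k) h
    rw [sum_range_succ', map_add, map_zero, map_sum, hd _ (wp k ^ 0), dT_kap, pow_zero, hd.one,
      zero_mul, mul_zero, add_zero, add_zero] at h1
    have h2 : (∑ j ∈ range n, kap k ((j + 1 : ℕ) * b (j + 1)) * wp k ^ j) * dT k (wp k) = 0 := by
      rw [← h1, sum_mul]
      refine sum_congr rfl fun j _ => ?_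
      rw [hd, dT_kap, hd.pow, map_mul, map_natCast]
      ring
    have h3 := ih (fun j h0 hj => hn j h0 (by omega)) _
      ((mul_eq_zero.1 h2).resolve_right (dT_wp_ne_zero k h6))
    have h4 : ∀ j < n, b (j + 1) = 0 := fun j hj => by
      have h5 := h3 j hj
      rw [← map_natCast C] at h5
      exact (mul_eq_zero.1 h5).resolve_left fun h0 => hn (j + 1) (by omega) (by omega)
        (by rwa [map_eq_zero_iff _ C_injective] at h0)
    rw [sum_range_succ', sum_eq_zero fun j hj => by
      rw [h4 j (mem_range.1 hj), map_zero, zero_mul], zero_add, pow_zero, mul_one,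
      map_eq_zero_iff _ (kap_injective k)] at h
    rintro (_ | j) hj
    · exact h
    · exact h4 j (by omega)

theorem iterate_dT_char (l : ℕ) [Fact l.Prime] (F : Omg (ZMod l)) :
    (dT (ZMod l))^[l] F = dT (ZMod l) F := by
  have h1 : ∀ i n, coeff n ((dT (ZMod l))^[i] F) = (tDeriv (ZMod l))^[i] (coeff n F) := by
    intro i n
    induction i with
    | zero => rfl
    | succ i ih => rw [Function.iterate_succ_apply', dT, coeff_mapD, ← dT, ih,
        Function.iterate_succ_apply']
  have h2 : ∀ (i : ℕ) (j : ℤ) (f : LaurentSeries (ZMod l)),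
      ((tDeriv (ZMod l))^[i] f).coeff j = (j : ZMod l) ^ i * f.coeff j := by
    intro i j f
    induction i with
    | zero => simp
    | succ i ih => rw [Function.iterate_succ_apply', coeff_tDeriv, ih]; ring
  ext n j
  rw [h1, h2, ZMod.pow_card, dT, coeff_mapD, coeff_tDeriv]

theorem one_mem_Mf_sub_one {l : ℕ} [Fact l.Prime] (h5 : 5 ≤ l) (h6 : (6 : ZMod l) ≠ 0) :
    1 ∈ Mf (ZMod l) h6 (l - 1) := by
  have hm := two_mul_half h5
  set m := l / 2 with hmdef
  obtain ⟨c, hc, hs⟩ := exists_sum_of_mem_wpForms (iterate_dT_wp_mem (k := ZMod l) (h6 := h6) m)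
  have hd := isDeriv_dT (ZMod l)
  have h1 := congrArg (dT (ZMod l)) hs
  rw [← Function.iterate_succ_apply' (dT (ZMod l)), Nat.succ_eq_add_one, hm, iterate_dT_char, map_sum,
    sum_range_succ', hd _ (wp (ZMod l) ^ 0), dT_kap, pow_zero, hd.one,
      zero_mul, mul_zero, add_zero, add_zero] at h1
  have h2 : (∑ j ∈ range (m + 1), kap (ZMod l) ((j + 1 : ℕ) * c (j + 1) - if j = 0 then 1 else 0)
      * wp (ZMod l) ^ j) * dT (ZMod l) (wp (ZMod l)) = 0 := by
    have : ∀ j, kap (ZMod l) ((j + 1 : ℕ) * c (j + 1) - if j = 0 then 1 else 0) * wp (ZMod l) ^ j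
        = kap (ZMod l) ((j + 1 : ℕ) * c (j + 1)) * wp (ZMod l) ^ j - if j = 0 then 1 else 0 := by
      intro j
      split_ifs with hj
      · subst hj; simp
      · simp
    simp only [this]
    rw [sum_sub_distrib, sum_ite_eq' (range (m + 1)) 0, if_pos (mem_range.2 (by omega)), sub_mul,
      one_mul, sub_eq_zero]
    rw [sum_mul]
    refine (sum_congr rfl fun j _ => ?_).trans h1.symm
    rw [hd, dT_kap, hd.pow, map_mul, map_natCast]
    ring
  have h3 := wp_pow_indep (h6 := h6) _ (fun j h0 hj => natCast_ne_zero_of_lt h0 (by omega)) _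
    ((mul_eq_zero.1 h2).resolve_right (dT_wp_ne_zero _ h6)) 0 (by omega)
  have h4 : c 1 = 1 := by simpa [sub_eq_zero] using h3
  have h5 := hc 1 (by omega)
  rwa [h4, show 2 * (m + 1 - 1) = l - 1 by omega] at h5

end Hasse

section Uniformize

theorem exists_sq_eq {k : Type*} [Field k] (h2 : (2 : k) ≠ 0) {f : k⟦X⟧}
    (hf : constantCoeff f = 1) : ∃ g : k⟦X⟧, g ^ 2 = f ∧ constantCoeff g = 1 := by
  obtain ⟨g, hg, hg1⟩ := HenselianRing.is_henselian (R := k⟦X⟧) (I := Ideal.span {X})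
    (Polynomial.X ^ 2 - Polynomial.C f) (Polynomial.monic_X_pow_sub_C _ two_ne_zero) 1
    (by rw [Ideal.mem_span_singleton, X_dvd_iff]; simp [hf])
    (by
      refine IsUnit.map _ (isUnit_iff_constantCoeff.2 ?_)
      simpa [Polynomial.derivative_X_pow, one_add_one_eq_two, map_ofNat] using h2)
  refine ⟨g, ?_, ?_⟩
  · simpa [Polynomial.IsRoot, sub_eq_zero] using hg
  · rw [Ideal.mem_span_singleton, X_dvd_iff, map_sub, map_one, sub_eq_zero] at hg1
    exact hg1

variable (k : Type*) [Field k] (h6 : (6 : k) ≠ 0)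

theorem constantCoeff_sigmaSeries : constantCoeff (sigmaSeries k) = 0 := by
  have h : constantCoeff (qD (euler k)) = 0 := by
    rw [← coeff_zero_eq_constantCoeff_apply, coeff_qD]; simp
  rw [sigmaSeries, map_mul, map_neg, h]; simp

theorem constantCoeff_qD (f : k⟦X⟧) : constantCoeff (qD f) = 0 := by
  rw [← coeff_zero_eq_constantCoeff_apply, coeff_qD]; simp

theorem constantCoeff_eisP : constantCoeff (eisP k) = 1 := by
  rw [eisP, map_sub, map_mul, constantCoeff_sigmaSeries]; simp

theorem constantCoeff_eisQ : constantCoeff (eisQ k h6) = 1 := by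
  have h := congrArg constantCoeff (qD_eisP k h6)
  rw [map_mul, constantCoeff_qD, map_sub, map_pow, constantCoeff_eisP] at h
  linear_combination h

theorem constantCoeff_eisR : constantCoeff (eisR k h6) = 1 := by
  rw [eisR, map_sub, map_mul, map_mul, constantCoeff_qD, constantCoeff_eisP, constantCoeff_eisQ]
  simp

theorem coeff_one_mul' (f g : k⟦X⟧) :
    coeff 1 (f * g) = constantCoeff f * coeff 1 g + coeff 1 f * constantCoeff g := by
  rw [coeff_mul, Nat.antidiagonal_succ]; simp

theorem coeff_one_sigmaSeries : coeff 1 (sigmaSeries k) = 1 := by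
  have h1 := congrArg (coeff 1) (euler_mul_partSeries k)
  have h2 := congrArg (coeff 1) (qD_euler k)
  have h3 : coeff 1 (partSeries k) = 1 := by simp [partSeries]
  have h4 : constantCoeff (partSeries k) = 1 := by
    rw [← coeff_zero_eq_constantCoeff_apply]; simp [partSeries]
  rw [coeff_one_mul', h3, h4, constantCoeff_euler, coeff_one] at h1
  rw [coeff_qD, map_neg, coeff_one_mul', constantCoeff_sigmaSeries, constantCoeff_euler] at h2
  simp at h1 h2
  linear_combination h2 - h1

theorem eisR_sq_ne : eisR k h6 ^ 2 ≠ eisQ k h6 ^ 3 := by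
  intro h
  have hP1 : coeff 1 (eisP k) = -24 := by
    rw [eisP, map_sub, coeff_one_mul', coeff_one_sigmaSeries, constantCoeff_sigmaSeries, coeff_one, map_ofNat]
    simp
  have e1 := congrArg (coeff 1) (qD_eisP k h6)
  have e2 := congrArg (coeff 1) (qD_eisQ k h6)
  have e3 := congrArg (coeff 1) h
  have c12 : coeff 1 (12 : k⟦X⟧) = 0 := by
    rw [← map_ofNat (C (R := k)), coeff_C]; simp
  have c3 : coeff 1 (3 : k⟦X⟧) = 0 := by
    rw [← map_ofNat (C (R := k)), coeff_C]; simp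
  simp only [map_sub, pow_succ, pow_zero, one_mul, coeff_one_mul', map_mul, coeff_qD, hP1,
    constantCoeff_eisP, constantCoeff_eisQ, constantCoeff_eisR, constantCoeff_qD, map_ofNat,
    c12, c3, Nat.cast_one] at e1 e2 e3
  have : (6 : k) * 6 * 6 * 8 = 0 := by linear_combination -e3 + 2 * e2 - 7 * e1
  have h8 : (8 : k) ≠ 0 := fun h8 => h6 (pow_eq_zero_iff (n := 3) (by norm_num) |>.1
    (by linear_combination 27 * h8))
  simp [h6, h8] at this

/-- A square root of `eisQ`. -/
noncomputable def kqr : k⟦X⟧ :=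
  (exists_sq_eq (fun h => h6 (by linear_combination 3 * h)) (constantCoeff_eisQ k h6)).choose

theorem kqr_sq : kqr k h6 ^ 2 = eisQ k h6 :=
  (exists_sq_eq (fun h => h6 (by linear_combination 3 * h)) (constantCoeff_eisQ k h6)).choose_spec.1

theorem constantCoeff_kqr : constantCoeff (kqr k h6) = 1 :=
  (exists_sq_eq (fun h => h6 (by linear_combination 3 * h)) (constantCoeff_eisQ k h6)).choose_spec.2

theorem kqr_ne_zero : kqr k h6 ≠ 0 := fun h => by simpa [h] using constantCoeff_kqr k h6

/-- The normalised form `eisR / eisQ ^ (3 / 2)`. -/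
noncomputable def ssr : k⟦X⟧ := eisR k h6 * ((kqr k h6)⁻¹) ^ 3

theorem kqr_mul_inv : kqr k h6 * (kqr k h6)⁻¹ = 1 :=
  PowerSeries.mul_inv_cancel _ (by rw [constantCoeff_kqr]; exact one_ne_zero)

theorem kqr_pow_mul_ssr : kqr k h6 ^ 3 * ssr k h6 = eisR k h6 := by
  rw [ssr, mul_left_comm, ← mul_pow, kqr_mul_inv]; ring

theorem constantCoeff_ssr : constantCoeff (ssr k h6) = 1 := by
  have h := congrArg constantCoeff (kqr_pow_mul_ssr k h6)
  rw [map_mul, map_pow, constantCoeff_kqr, constantCoeff_eisR] at h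
  simpa using h

theorem qD_pow (f : k⟦X⟧) (n : ℕ) : qD (f ^ n) = n * f ^ (n - 1) * qD f := by
  rw [Derivation.leibniz_pow, smul_eq_mul, nsmul_eq_mul, mul_assoc]

theorem six_mul_qD_kqr : 6 * qD (kqr k h6) = kqr k h6 * (eisP k - ssr k h6 * kqr k h6) := by
  refine mul_left_cancel₀ (kqr_ne_zero k h6) ?_
  have h := qD_eisQ k h6
  rw [← kqr_pow_mul_ssr, ← kqr_sq, qD_pow] at h
  norm_num at h
  linear_combination h

theorem two_mul_qD_ssr : 2 * qD (ssr k h6) = kqr k h6 * (ssr k h6 ^ 2 - 1) := by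
  refine mul_left_cancel₀ (pow_ne_zero 3 (kqr_ne_zero k h6)) ?_
  have h := qD_eisR k h6
  rw [← kqr_pow_mul_ssr, ← kqr_sq, qD_mul, qD_pow] at h
  norm_num at h
  linear_combination h - kqr k h6 ^ 2 * ssr k h6 * six_mul_qD_kqr k h6

theorem ssr_sub_one_ne_zero : ssr k h6 - 1 ≠ 0 := by
  intro h
  refine eisR_sq_ne k h6 ?_
  rw [← kqr_pow_mul_ssr, ← kqr_sq, sub_eq_zero.1 h]; ring

/-- Evaluation of polynomials at `ssr`. -/
noncomputable def evs : Polynomial k →ₐ[k] k⟦X⟧ := Polynomial.aeval (ssr k h6)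

theorem evs_X : evs k h6 Polynomial.X = ssr k h6 := Polynomial.aeval_X _

theorem evs_C (a : k) : evs k h6 (Polynomial.C a) = C a := Polynomial.aeval_C _ _

theorem constantCoeff_evs (f : Polynomial k) : constantCoeff (evs k h6 f) = f.eval 1 := by
  rw [evs, Polynomial.aeval_def, Polynomial.hom_eval₂, constantCoeff_ssr,
    show (constantCoeff (R := k)).comp (algebraMap k k⟦X⟧) = RingHom.id k by ext; simp]
  rfl

theorem evs_injective : Function.Injective (evs k h6) := by
  rw [injective_iff_map_eq_zero]
  intro f hf
  by_contra h0
  obtain ⟨g, hg, hnd⟩ := Polynomial.exists_eq_pow_rootMultiplicity_mul_and_not_dvd f h0 1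
  rw [hg, map_mul, map_pow, mul_eq_zero] at hf
  rcases hf with hf | hf
  · refine ssr_sub_one_ne_zero k h6 ?_
    have := by_contra fun h => pow_ne_zero _ h hf
    simpa [evs_X] using this
  · refine hnd (Polynomial.dvd_iff_isRoot.2 ?_)
    rw [Polynomial.IsRoot, ← constantCoeff_evs k h6, hf, map_zero]

theorem two_mul_qD_evs (f : Polynomial k) : 2 * qD (evs k h6 f) =
    kqr k h6 * evs k h6 ((Polynomial.X ^ 2 - 1) * f.derivative) := by
  have h : qD (evs k h6 f) = evs k h6 f.derivative * qD (ssr k h6) := by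
    rw [evs, Derivation.map_aeval]; rfl
  rw [h, map_mul, map_sub, map_pow, evs_X, map_one]
  linear_combination evs k h6 f.derivative * two_mul_qD_ssr k h6

/-- `f` is `kqr ^ w` times a polynomial in `ssr` of the shape of a form of weight `2 w`. -/
def IsForm (w : ℕ) (f : k⟦X⟧) (p : Polynomial k) : Prop :=
  f = kqr k h6 ^ w * evs k h6 p ∧ 3 * p.natDegree ≤ w ∧ p.comp (-Polynomial.X) = (-1) ^ w * p

theorem exists_isForm {w : ℕ} {f : k⟦X⟧} (hf : f ∈ Mf k h6 (2 * w)) :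
    ∃ p, IsForm k h6 w f p := by
  induction hf using Submodule.span_induction with
  | mem x hx =>
    obtain ⟨a, b, hab, rfl⟩ := hx
    refine ⟨Polynomial.X ^ b, ?_, ?_, ?_⟩
    · rw [map_pow, evs_X, show w = 2 * a + 3 * b by omega, pow_add, pow_mul, pow_mul, kqr_sq,
        ← kqr_pow_mul_ssr]
      ring
    · rw [Polynomial.natDegree_X_pow]; omega
    · rw [Polynomial.X_pow_comp, neg_pow, show w = 2 * (a + b) + b by omega, pow_add _ (2 * _),
        pow_mul]
      simp
  | zero => exact ⟨0, by simp [IsForm]⟩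
  | add x y _ _ hx hy =>
    obtain ⟨p, rfl, hp, hp'⟩ := hx
    obtain ⟨p', rfl, hq, hq'⟩ := hy
    refine ⟨p + p', by rw [map_add]; ring, ?_, ?_⟩
    · have := Polynomial.natDegree_add_le p p'
      omega
    · rw [Polynomial.add_comp, hp', hq']; ring
  | smul a x _ hx =>
    obtain ⟨p, rfl, hp, hp'⟩ := hx
    refine ⟨a • p, by rw [map_smul, mul_smul_comm], ?_, ?_⟩
    · have := Polynomial.natDegree_smul_le a p
      omega
    · rw [Polynomial.smul_comp, hp', mul_smul_comm]

end Uniformize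

section HassePoly

open Polynomial in
theorem coeff_X_mul_derivative {R : Type*} [CommRing R] (p : R[X]) (n : ℕ) :
    (Polynomial.X * derivative p).coeff n = n * p.coeff n := by
  cases n with
  | zero => simp
  | succ n => rw [Polynomial.coeff_X_mul, Polynomial.coeff_derivative]; push_cast; ring

open Polynomial in
theorem coeff_succ_sq_sub_one_mul_derivative {R : Type*} [CommRing R] {p : R[X]} {n : ℕ}
    (h : p.natDegree ≤ n) : ((Polynomial.X ^ 2 - 1) * derivative p).coeff (n + 1) = n * p.coeff n := by
  rw [show (Polynomial.X ^ 2 - 1) * derivative p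
    = Polynomial.X * (Polynomial.X * derivative p) - derivative p by ring,
    Polynomial.coeff_sub, Polynomial.coeff_X_mul, coeff_X_mul_derivative,
    Polynomial.coeff_derivative, Polynomial.coeff_eq_zero_of_natDegree_lt (n := n + 1 + 1) (by omega)]
  ring

theorem isCoprime_X_sub_C_of_eval_ne_zero {k : Type*} [Field k] {p : Polynomial k} {a : k}
    (h : p.eval a ≠ 0) : IsCoprime p (Polynomial.X - Polynomial.C a) := by
  refine (((Polynomial.irreducible_X_sub_C a).coprime_iff_not_dvd).2 fun hd => ?_).symm
  exact h (Polynomial.dvd_iff_isRoot.1 hd)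

/-- Solutions of the first order system satisfied by the Hasse polynomial are coprime. -/
theorem isCoprime_of_system {k : Type*} [Field k] (h6 : (6 : k) ≠ 0) {A B : Polynomial k}
    (hA : B = Polynomial.X * A + 6 * (Polynomial.X ^ 2 - 1) * A.derivative)
    (hB : 6 * (Polynomial.X ^ 2 - 1) * B.derivative = Polynomial.X * B - A)
    (h1 : A.eval 1 ≠ 0) (h1' : A.eval (-1) ≠ 0)
    (hd : ∀ n : ℕ, 0 < n → n ≤ A.natDegree → (n : k) ≠ 0) : IsCoprime A B := by
  classical
  have hA0 : A ≠ 0 := by rintro rfl; simp at h1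
  set g := EuclideanDomain.gcd A B with hg
  have hg0 : g ≠ 0 := fun h => hA0 (EuclideanDomain.gcd_eq_zero_iff.1 h).1
  obtain ⟨A1, hA1⟩ := EuclideanDomain.gcd_dvd_left A B
  obtain ⟨B1, hB1⟩ := EuclideanDomain.gcd_dvd_right A B
  rw [← hg] at hA1 hB1
  have hcop : IsCoprime A1 B1 := by
    obtain ⟨x, y, hxy⟩ : ∃ x y, g = A * x + B * y := ⟨_, _, EuclideanDomain.gcd_eq_gcd_ab A B⟩
    refine ⟨x, y, mul_left_cancel₀ hg0 ?_⟩
    linear_combination -hxy - x * hA1 - y * hB1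
  have hgA : IsCoprime g (6 * (Polynomial.X ^ 2 - 1)) := by
    have e : (6 * (Polynomial.X ^ 2 - 1) : Polynomial k) = 6 *
        ((Polynomial.X - Polynomial.C 1) * (Polynomial.X - Polynomial.C (-1))) := by
      simp only [map_neg, map_one]; ring
    have hu : IsUnit (6 : Polynomial k) := by
      rw [← map_ofNat (Polynomial.C (R := k))]; exact Polynomial.isUnit_C.2 h6.isUnit
    rw [e, isCoprime_mul_unit_left_right hu]
    exact ((isCoprime_X_sub_C_of_eval_ne_zero h1).mul_right
      (isCoprime_X_sub_C_of_eval_ne_zero h1')).of_isCoprime_of_dvd_left ⟨A1, hA1⟩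
  have d1 : g ∣ A.derivative := hgA.dvd_of_dvd_mul_left
    ⟨B1 - Polynomial.X * A1, by linear_combination -hA + hB1 - Polynomial.X * hA1⟩
  have d2 : g ∣ B.derivative := hgA.dvd_of_dvd_mul_left
    ⟨Polynomial.X * B1 - A1, by linear_combination hB + Polynomial.X * hB1 - hA1⟩
  obtain ⟨a, ha⟩ := d1
  obtain ⟨b, hb⟩ := d2
  have e1 := congrArg Polynomial.derivative hA1
  have e2 := congrArg Polynomial.derivative hB1
  rw [Polynomial.derivative_mul] at e1 e2
  obtain ⟨x, y, hxy⟩ := hcop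
  have hgg : g ∣ g.derivative := ⟨x * (a - A1.derivative) + y * (b - B1.derivative), by
    linear_combination -g.derivative * hxy - x * e1 - y * e2 + x * ha + y * hb⟩
  have hg' : g.derivative = 0 := by
    by_contra h0
    have := Polynomial.degree_le_of_dvd hgg h0
    exact absurd (Polynomial.degree_derivative_lt hg0) (not_lt.2 this)
  have hdeg : g.natDegree = 0 := by
    by_contra hn
    obtain ⟨n, hn⟩ := Nat.exists_eq_succ_of_ne_zero hn
    have hc := Polynomial.coeff_derivative g n
    rw [hg', Polynomial.coeff_zero, ← Nat.succ_eq_add_one, ← hn, Polynomial.coeff_natDegree] at hc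
    have hle : g.natDegree ≤ A.natDegree := Polynomial.natDegree_le_of_dvd ⟨A1, hA1⟩ hA0
    have := hd g.natDegree (by omega) hle
    rw [hn, Nat.succ_eq_add_one] at this
    push_cast at this
    exact (mul_ne_zero (Polynomial.leadingCoeff_ne_zero.2 hg0) this) hc.symm
  rw [← EuclideanDomain.gcd_isUnit_iff, ← hg, Polynomial.isUnit_iff_degree_eq_zero,
    Polynomial.degree_eq_natDegree hg0, hdeg]
  rfl

variable {l : ℕ} [hl : Fact l.Prime]

theorem exists_hasse (h5 : 5 ≤ l) (h6 : (6 : ZMod l) ≠ 0) : ∃ A B : Polynomial (ZMod l),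
    kqr (ZMod l) h6 ^ (l / 2) * evs (ZMod l) h6 A = 1 ∧
    eisP (ZMod l) * evs (ZMod l) h6 A = kqr (ZMod l) h6 * evs (ZMod l) h6 B ∧
    B = Polynomial.X * A + 6 * (Polynomial.X ^ 2 - 1) * A.derivative ∧
    IsCoprime A B ∧ l ≤ 6 * A.natDegree + 5 ∧ A.eval 1 = 1 ∧
    A.comp (-Polynomial.X) = (-1) ^ (l / 2) * A := by
  have hm := two_mul_half h5
  set m := l / 2 with hmdef
  have hone := one_mem_Mf_sub_one h5 h6
  rw [show l - 1 = 2 * m by omega] at hone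
  obtain ⟨A, hA1, hAdeg, hApar⟩ := exists_isForm _ h6 hone
  have hAe : A.eval 1 = 1 := by
    have := congrArg constantCoeff hA1
    rw [map_mul, map_pow, constantCoeff_kqr, constantCoeff_evs] at this
    simpa using this.symm
  have hA0 : A ≠ 0 := by rintro rfl; simp at hAe
  have hAe' : A.eval (-1) ≠ 0 := by
    have := congrArg (Polynomial.eval 1) hApar
    rw [Polynomial.eval_comp, Polynomial.eval_neg, Polynomial.eval_X, Polynomial.eval_mul,
      hAe, Polynomial.eval_pow] at this
    rw [this]
    simp
  set κ := kqr (ZMod l) h6 with hκ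
  set P := eisP (ZMod l) with hP
  set ev := evs (ZMod l) h6 with hev
  set s := ssr (ZMod l) h6 with hs
  have hκ0 : κ ≠ 0 := kqr_ne_zero _ _
  have hmk : (2 * (m : (ZMod l)⟦X⟧) + 1) = 0 := by
    have : ((l : ℕ) : (ZMod l)⟦X⟧) = 0 := by
      rw [← map_natCast (C (R := ZMod l)), CharP.cast_eq_zero, map_zero]
    have h' := congrArg (fun n : ℕ => (n : (ZMod l)⟦X⟧)) hm
    push_cast at h'
    rw [h', this]
  set B : Polynomial (ZMod l) := Polynomial.X * A + 6 * (Polynomial.X ^ 2 - 1) * A.derivative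
    with hB
  have hevB : ev B = s * ev A + 6 * (s ^ 2 - 1) * ev A.derivative := by
    rw [hB]
    simp only [map_add, map_mul, map_sub, map_pow, map_one, map_ofNat, hev, evs_X]
    rfl
  have hdA : 2 * qD (ev A) = κ * ((s ^ 2 - 1) * ev A.derivative) := by
    rw [hev, two_mul_qD_evs, map_mul, map_sub, map_pow, evs_X, map_one]
  have hdB : 2 * qD (ev B) = κ * ((s ^ 2 - 1) * ev B.derivative) := by
    rw [hev, two_mul_qD_evs, map_mul, map_sub, map_pow, evs_X, map_one]
  have hdκ : 6 * qD κ = κ * (P - s * κ) := six_mul_qD_kqr _ h6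
  have hPA : P * ev A = κ * ev B := by
    have h := congrArg qD hA1
    rw [Derivation.map_one_eq_zero, qD_mul, qD_pow] at h
    have hm1 : κ ^ m = κ ^ (m - 1) * κ := by rw [← pow_succ]; congr 1; omega
    refine mul_left_cancel₀ (pow_ne_zero m hκ0) ?_
    rw [hevB]
    linear_combination 12 * h + 2 * (m : (ZMod l)⟦X⟧) * κ ^ (m - 1) * ev A * hdκ
      + 6 * κ ^ m * hdA + hmk * (κ ^ m * ev A * (P - s * κ)) 
      - 2 * m * (P - s * κ) * ev A * hm1
  have hBder : 6 * (Polynomial.X ^ 2 - 1) * B.derivative = Polynomial.X * B - A := by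
    apply evs_injective _ h6
    rw [← hev]
    simp only [map_mul, map_sub, map_pow, map_one, map_ofNat, hev, evs_X]
    rw [← hev, ← hs]
    have h := congrArg qD hPA
    rw [qD_mul, qD_mul] at h
    have hQ := kqr_sq (ZMod l) h6
    have hdP := qD_eisP (ZMod l) h6
    rw [← hQ, ← hP, ← hκ] at hdP
    have hA0' : ev A ≠ 0 := fun h0 => by rw [h0, mul_zero] at hA1; exact one_ne_zero hA1
    refine mul_left_cancel₀ hA0' (mul_left_cancel₀ (pow_ne_zero 2 hκ0) ?_)
    linear_combination -12 * ev A * h + ev A ^ 2 * hdP + 6 * ev A * P * hdA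
      - 2 * ev A * ev B * hdκ - 6 * ev A * κ * hdB
      + (P * ev A + κ * ev B + 6 * κ * (s ^ 2 - 1) * ev A.derivative - 2 * κ * ev B) * hPA
      - κ ^ 2 * ev B * hevB
  have hcop : IsCoprime A B := by
    refine isCoprime_of_system h6 hB hBder (by rw [hAe]; exact one_ne_zero) hAe' fun n h0 hn => ?_
    exact natCast_ne_zero_of_lt h0 (by omega)
  refine ⟨A, B, hA1.symm, hPA, hB, hcop, ?_, hAe, hApar⟩
  have c1 : B.coeff (A.natDegree + 1) = (6 * A.natDegree + 1 : ZMod l) * A.leadingCoeff := by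
    rw [hB, Polynomial.coeff_add, Polynomial.coeff_X_mul, Polynomial.coeff_natDegree, mul_assoc,
      ← map_ofNat (Polynomial.C (R := ZMod l)), Polynomial.coeff_C_mul,
      coeff_succ_sq_sub_one_mul_derivative le_rfl, Polynomial.coeff_natDegree]
    ring
  have hBdeg : B.natDegree ≤ A.natDegree + 1 := by
    rw [hB]
    refine Polynomial.natDegree_add_le_of_degree_le ?_ ?_
    · refine Polynomial.natDegree_mul_le.trans ?_
      rw [Polynomial.natDegree_X]; omega
    · rw [mul_assoc, ← map_ofNat (Polynomial.C (R := ZMod l))]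
      refine (Polynomial.natDegree_C_mul_le _ _).trans ?_
      by_cases hz : A.natDegree = 0
      · rw [Polynomial.derivative_of_natDegree_zero hz]; simp
      refine Polynomial.natDegree_mul_le.trans ?_
      have h1 := Polynomial.natDegree_derivative_lt hz
      have h2 : (Polynomial.X ^ 2 - 1 : Polynomial (ZMod l)).natDegree ≤ 2 := by
        compute_degree
      omega
  have c2 := congrArg (fun p : Polynomial (ZMod l) => p.coeff (A.natDegree + 1 + 1)) hBder
  beta_reduce at c2
  rw [mul_assoc, ← map_ofNat (Polynomial.C (R := ZMod l)), Polynomial.coeff_C_mul,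
    coeff_succ_sq_sub_one_mul_derivative hBdeg, Polynomial.coeff_sub, Polynomial.coeff_X_mul,
    Polynomial.coeff_eq_zero_of_natDegree_lt (show A.natDegree < A.natDegree + 1 + 1 by omega),
    c1] at c2
  push_cast at c2
  have h0 : (6 * A.natDegree + 5 : ZMod l) * (6 * A.natDegree + 1) = 0 := by
    refine (mul_eq_zero.1 ?_).resolve_right (Polynomial.leadingCoeff_ne_zero.2 hA0)
    linear_combination c2
  by_contra hlt
  rcases mul_eq_zero.1 h0 with h | h
  · exact natCast_ne_zero_of_lt (l := l) (n := 6 * A.natDegree + 5) (by omega) (by omega)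
      (by exact_mod_cast h)
  · exact natCast_ne_zero_of_lt (l := l) (n := 6 * A.natDegree + 1) (by omega) (by omega)
      (by exact_mod_cast h)

end HassePoly

section Filtration

/-- The twisted derivation `q d/dq - eisP / 24`, up to the factor `24`. -/
noncomputable def nabla (k : Type*) [Field k] (f : k⟦X⟧) : k⟦X⟧ := 24 * qD f - eisP k * f

theorem nabla_euler_mul {k : Type*} [Field k] (f : k⟦X⟧) :
    nabla k (euler k * f) = euler k * (24 * qD f - f) := by
  rw [nabla, qD_mul]
  linear_combination f * two_mul_qD_euler (k := k)

theorem nabla_iterate_euler_mul {k : Type*} [Field k] (f : k⟦X⟧) (i : ℕ) :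
    (nabla k)^[i] (euler k * f) = euler k * mk fun n => (24 * (n : k) - 1) ^ i * coeff n f := by
  induction i with
  | zero =>
    rw [Function.iterate_zero_apply]
    congr 1
    ext n
    simp
  | succ i ih =>
    rw [Function.iterate_succ_apply', ih, nabla_euler_mul]
    congr 1
    ext n
    rw [map_sub, ← map_ofNat (C (R := k)), coeff_C_mul, coeff_qD, coeff_mk, coeff_mk]
    ring

variable {l : ℕ} [hl : Fact l.Prime]

theorem eq_zero_of_nabla_iterate (h5 : 5 ≤ l) (h6 : (6 : ZMod l) ≠ 0) {G : (ZMod l)⟦X⟧}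
    (hG : G ∈ Mf (ZMod l) h6 (l + 1)) (hG0 : constantCoeff G = 0) {c : ZMod l}
    (hc : (nabla (ZMod l))^[l / 2] G = C c * G) : G = 0 := by
  have hm := two_mul_half h5
  obtain ⟨A, B, hA1, hPA, hB, hcop, hdeg, hAe, hApar⟩ := exists_hasse h5 h6
  set m := l / 2 with hmdef
  rw [show l + 1 = 2 * (m + 1) by omega] at hG
  obtain ⟨f, hGf, hfdeg, hfpar⟩ := exists_isForm _ h6 hG
  set κ := kqr (ZMod l) h6 with hκ
  set P := eisP (ZMod l) with hP
  set ev := evs (ZMod l) h6 with hev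
  set s := ssr (ZMod l) h6 with hs
  have hκ0 : κ ≠ 0 := kqr_ne_zero _ _
  have hdκ : 6 * qD κ = κ * (P - s * κ) := six_mul_qD_kqr _ h6
  have hl0 : ((l : ℕ) : (ZMod l)⟦X⟧) = 0 := by
    rw [← map_natCast (C (R := ZMod l)), CharP.cast_eq_zero, map_zero]
  have hmk : (2 * (m : (ZMod l)⟦X⟧) + 1) = 0 := by
    have h' := congrArg (fun n : ℕ => (n : (ZMod l)⟦X⟧)) hm
    push_cast at h'
    rw [h', hl0]
  have hX : ev Polynomial.X = s := evs_X _ _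
  have hd : ∀ p, 2 * qD (ev p) = κ * ((s ^ 2 - 1) * ev p.derivative) := fun p => by
    rw [hev, two_mul_qD_evs, map_mul, map_sub, map_pow, evs_X, map_one]
  have hA0 : A ≠ 0 := by rintro rfl; simp at hAe
  have hevA0 : ev A ≠ 0 := fun h => by rw [h, mul_zero] at hA1; exact zero_ne_one hA1
  have hevB : ev B = s * ev A + 6 * (s ^ 2 - 1) * ev A.derivative := by
    rw [hB]
    simp only [map_add, map_mul, map_sub, map_pow, map_one, map_ofNat, hX]
  have key : ∀ i ≤ m, ∃ (g : Polynomial (ZMod l)) (a : ZMod l), a ≠ 0 ∧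
      ev A ^ i * (nabla (ZMod l))^[i] G = κ ^ (m + 1 + i) * ev g ∧
      A ∣ g - Polynomial.C a * (B ^ i * f) := by
    intro i
    induction i with
    | zero => exact fun _ => ⟨f, 1, one_ne_zero, by simpa using hGf, by simp⟩
    | succ i ih =>
      intro hi
      obtain ⟨g, a, ha, hg, u, hu⟩ := ih (by omega)
      refine ⟨((2 * i + 1 : ℕ) : Polynomial (ZMod l)) * B * g + A * (12 * (Polynomial.X ^ 2 - 1) * g.derivative
          - ((2 + 2 * i : ℕ) : Polynomial (ZMod l)) * Polynomial.X * g), (2 * i + 1 : ℕ) * a,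
        mul_ne_zero (natCast_ne_zero_of_lt (by omega) (by omega)) ha, ?_, ?_⟩
      · rw [Function.iterate_succ_apply']
        set H := (nabla (ZMod l))^[i] G with hH
        have h := congrArg qD hg
        rw [qD_mul, qD_mul, qD_pow, qD_pow] at h
        simp only [map_add, map_mul, map_sub, map_pow, map_one, map_ofNat, hX, map_natCast]
        rw [nabla, ← hP]
        rw [show m + 1 + i - 1 = m + i by omega] at h
        have hi1 : (i : (ZMod l)⟦X⟧) * ev A ^ (i - 1) * ev A = i * ev A ^ i := by
          cases i with
          | zero => simp
          | succ i => rw [Nat.add_sub_cancel, mul_assoc, ← pow_succ]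
        push_cast at h ⊢
        linear_combination 24 * ev A * h - 24 * qD (ev A) * H * hi1
          - 24 * i * qD (ev A) * hg - 12 * i * κ ^ (m + 1 + i) * ev g * hd A
          + 4 * ev A * (m + 1 + i) * κ ^ (m + i) * ev g * hdκ + 12 * ev A * κ ^ (m + 1 + i) * hd g
          + 4 * (m + 1 + i) * κ ^ (m + 1 + i) * ev g * hPA - P * ev A * hg
          - κ ^ (m + 1 + i) * ev g * hPA + 2 * i * κ ^ (m + 1 + i + 1) * ev g * hevB
          + 2 * κ ^ (m + 1 + i + 1) * ev g * (ev B - s * ev A) * hmk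
      · rw [map_mul, map_natCast]
        refine ⟨((2 * i + 1 : ℕ) : Polynomial (ZMod l)) * B * u + (12 * (Polynomial.X ^ 2 - 1) * g.derivative
          - ((2 + 2 * i : ℕ) : Polynomial (ZMod l)) * Polynomial.X * g), ?_⟩
        linear_combination ((2 * i + 1 : ℕ) : Polynomial (ZMod l)) * B * hu
  obtain ⟨g, a, ha, hg, hdvd⟩ := key m le_rfl
  have hAg : A ∣ g := by
    refine ⟨Polynomial.C c * A ^ m * f, ?_⟩
    apply evs_injective _ h6
    rw [← hev, map_mul, map_mul, map_mul, map_pow,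
      show ev (Polynomial.C c) = C c from evs_C _ _ _]
    rw [hc, hGf] at hg
    refine mul_left_cancel₀ (pow_ne_zero (m + 1 + m) hκ0) ?_
    linear_combination -hg - C c * ev A ^ m * κ ^ (m + 1) * ev f * hA1
  have hAf : A ∣ f := by
    have h1 : A ∣ Polynomial.C a * (B ^ m * f) := by
      have := dvd_sub hAg hdvd
      rwa [sub_sub_cancel] at this
    rw [(Polynomial.isUnit_C.2 ha.isUnit).dvd_mul_left] at h1
    exact hcop.pow_right.dvd_of_dvd_mul_left h1
  obtain ⟨p, hp⟩ := hAf
  have hppar : p.comp (-Polynomial.X) = -p := by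
    have h := hfpar
    rw [hp, Polynomial.mul_comp, hApar] at h
    refine mul_left_cancel₀ (mul_ne_zero (pow_ne_zero m (neg_ne_zero.2 one_ne_zero)) hA0) ?_
    rw [h]; ring
  have hf1 : f.eval 1 = 0 := by
    have := congrArg constantCoeff hGf
    rw [hG0, map_mul, map_pow, constantCoeff_kqr, constantCoeff_evs] at this
    simpa using this.symm
  have hp1 : p.eval 1 = 0 := by
    rw [hp, Polynomial.eval_mul, hAe, one_mul] at hf1; exact hf1
  have hp0 : p.coeff 0 = 0 := by
    have h := congrArg (Polynomial.eval 0) hppar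
    rw [Polynomial.eval_comp] at h
    simp only [Polynomial.eval_neg, Polynomial.eval_X, neg_zero] at h
    have h2 : (6 : ZMod l) * p.eval 0 = 0 := by linear_combination 3 * h
    rw [Polynomial.coeff_zero_eq_eval_zero]
    exact (mul_eq_zero.1 h2).resolve_left h6
  have hpz : p = 0 := by
    by_contra hp0'
    have hdl : p.natDegree ≤ 1 := by
      rw [hp, Polynomial.natDegree_mul hA0 hp0'] at hfdeg
      omega
    have he := Polynomial.eq_X_add_C_of_natDegree_le_one hdl
    rw [hp0, map_zero, add_zero] at he
    rw [he] at hp1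
    simp only [Polynomial.eval_mul, Polynomial.eval_C, Polynomial.eval_X, mul_one] at hp1
    rw [hp1, map_zero, zero_mul] at he
    exact hp0' he
  rw [hGf, hp, hpz, mul_zero, map_zero, mul_zero]

theorem gform_eq_zero (h5 : 5 ≤ l) {c : ZMod l}
    (h : ∀ n : ℕ, resPoly l n * coeff n (aSeries (ZMod l)) ≠ 0 →
      (24 * (n : ZMod l) - 1) ^ (l / 2) = c) : gform l = 0 := by
  refine eq_zero_of_nabla_iterate (c := c) h5 (six_ne_zero_of_le h5) (gform_mem_Mf h5 _)
    (constantCoeff_gform h5) ?_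
  rw [gform, nabla_iterate_euler_mul, mul_left_comm]
  congr 1
  ext n
  rw [coeff_C_mul, coeff_mk, coeff_mk]
  by_cases h0 : resPoly l n * coeff n (aSeries (ZMod l)) = 0
  · rw [h0, mul_zero, mul_zero]
  · rw [h n h0]

theorem resPoly_ne_zero (h5 : 5 ≤ l) {n : ZMod l} (h : ¬ IsSquare (1 - 24 * n)) :
    resPoly l n ≠ 0 := by
  rw [resPoly, prod_ne_zero_iff]
  intro j _ h0
  have h6 := six_ne_zero_of_le h5
  refine h ⟨2 * j + 1, ?_⟩
  have h1 : 6 * n + j * (j + 1) = 0 := by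
    have := congrArg (6 * ·) h0
    beta_reduce at this
    rw [mul_add, mul_div_cancel₀ _ h6, mul_zero] at this
    exact this
  linear_combination -4 * h1

theorem resPoly_eq_zero (h5 : 5 ≤ l) {n : ZMod l} (h : IsSquare (1 - 24 * n))
    (h0 : 24 * n ≠ 1) : resPoly l n = 0 := by
  have hm := two_mul_half h5
  have h6 := six_ne_zero_of_le h5
  obtain ⟨x, hx⟩ := h
  obtain ⟨j, hj, hjx⟩ : ∃ j < l / 2, (2 * (j : ZMod l) + 1) ^ 2 = x ^ 2 := by
    have hx0 : x ≠ 0 := by rintro rfl; exact h0 (by linear_combination -hx)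
    have hv : 0 < x.val := Nat.pos_of_ne_zero fun h => hx0 ((ZMod.val_eq_zero x).1 h)
    have hv' := ZMod.val_lt x
    have hxc : (x.val : ZMod l) = x := ZMod.natCast_zmod_val x
    obtain ⟨t, ht | ht⟩ := Nat.even_or_odd' x.val
    · refine ⟨l / 2 - t, by omega, ?_⟩
      have h1 : ((2 * (l / 2 - t) + 1 + x.val : ℕ) : ZMod l) = 0 := by
        rw [show 2 * (l / 2 - t) + 1 + x.val = l by omega, CharP.cast_eq_zero]
      rw [Nat.cast_add, hxc] at h1
      push_cast at h1 ⊢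
      linear_combination (2 * ((l / 2 - t : ℕ) : ZMod l) + 1 - x) * h1
    · refine ⟨t, by omega, ?_⟩
      rw [ht] at hxc
      push_cast at hxc
      rw [hxc]
  rw [resPoly, prod_eq_zero_iff]
  refine ⟨j, mem_range.2 hj, mul_left_cancel₀ h6 (mul_left_cancel₀ h6
    (mul_left_cancel₀ h6 ?_))⟩
  rw [mul_add, mul_div_cancel₀ _ h6]
  linear_combination 9 * hjx - 9 * hx

/-- A congruence for `spt` at `l` forces the divisibility of the nonresidue coefficients. -/
theorem dvd_of_congruence (hcong : sptHasCongruenceAt l) {n : ℕ}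
    (hn : ¬ IsSquare ((1 : ZMod l) - 24 * n)) :
    (12 * (spt n : ZMod l) + (24 * n - 1) * (Fintype.card (Nat.Partition n) : ZMod l)) = 0 := by
  obtain ⟨h5, hcong⟩ := hcong
  have ha : ∀ n : ℕ, coeff n (aSeries (ZMod l)) =
      12 * (spt n : ZMod l) + (24 * n - 1) * (Fintype.card (Nat.Partition n) : ZMod l) := fun n => by
    rw [aSeries, map_sub, map_add, ← map_ofNat (C (R := ZMod l)) 12,
      ← map_ofNat (C (R := ZMod l)) 24, coeff_C_mul, coeff_C_mul, coeff_qD, sptSeries, partSeries,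
      coeff_mk, coeff_mk]
    ring
  have hG : gform l = 0 := by
    refine gform_eq_zero (c := (-1) ^ (l / 2) * -1) h5 fun n h => ?_
    have hr := left_ne_zero_of_mul h
    have ha' := right_ne_zero_of_mul h
    have h1 : 24 * (n : ZMod l) ≠ 1 := by
      intro h1
      refine ha' ?_
      rw [ha, h1]
      have hn0 : n ≠ 0 := by rintro rfl; simp at h1
      have hdvd : l ∣ 24 * n - 1 := by
        rw [← ZMod.natCast_eq_zero_iff, Nat.cast_sub (by omega)]
        push_cast
        rw [h1, sub_self]
      obtain ⟨N, hN⟩ := hdvd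
      have h2 := hcong N ⟨n, by omega⟩
      rw [show (l * N + 1) / 24 = n by omega, ← ZMod.natCast_eq_zero_iff] at h2
      rw [h2]; ring
    have hns : ¬ IsSquare (1 - 24 * (n : ZMod l)) := fun hs => hr (resPoly_eq_zero h5 hs h1)
    have h0 : 1 - 24 * (n : ZMod l) ≠ 0 := fun h0 => h1 (by linear_combination -h0)
    have hE := ZMod.pow_div_two_eq_neg_one_or_one l h0
    rw [ZMod.euler_criterion l h0] at hns
    rw [show 24 * (n : ZMod l) - 1 = -1 * (1 - 24 * n) by ring, mul_pow, hE.resolve_left hns]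
  have h0 : (mk fun n : ℕ => resPoly l n * coeff n (aSeries (ZMod l))) = 0 := by
    rw [gform, mul_eq_zero] at hG
    exact hG.resolve_left fun h => by simpa [h] using constantCoeff_euler (ZMod l)
  have h1 := congrArg (coeff n) h0
  rw [coeff_mk, map_zero, mul_eq_zero] at h1
  rw [← ha]
  exact h1.resolve_left (resPoly_ne_zero h5 hn)

end Filtration

end SptRare

namespace SptRare

section Counting

/-- The positive integer `12 spt(n) + (24 n - 1) p(n)`. -/
def aNum (n : ℕ) : ℕ := 12 * spt n + (24 * n - 1) * Fintype.card (Nat.Partition n)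

theorem aNum_pos {n : ℕ} (hn : 0 < n) : 0 < aNum n := by
  have : 0 < Fintype.card (Nat.Partition n) := Fintype.card_pos
  have : 0 < (24 * n - 1) * Fintype.card (Nat.Partition n) := Nat.mul_pos (by omega) this
  rw [aNum]; omega

theorem card_partition_le (n : ℕ) : Fintype.card (Nat.Partition n) ≤ 2 ^ n := by
  refine (Fintype.card_le_of_surjective _ (Nat.Partition.ofComposition_surj (n := n))).trans ?_
  rw [composition_card]
  exact Nat.pow_le_pow_right (by norm_num) (Nat.sub_le n 1)

theorem spt_le (n : ℕ) : spt n ≤ n * Fintype.card (Nat.Partition n) := by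
  rw [spt, mul_comm, ← smul_eq_mul, Fintype.card]
  refine sum_le_card_nsmul _ _ _ fun p _ => ?_
  refine (Multiset.card_le_card (Multiset.filter_le _ _)).trans ?_
  have := Multiset.card_nsmul_le_sum (s := p.parts) (a := 1) fun x hx => p.parts_pos hx
  rwa [smul_eq_mul, mul_one, p.parts_sum] at this

theorem aNum_le (n : ℕ) : aNum n ≤ 2 ^ (2 * n + 6) := by
  have h1 := card_partition_le n
  have h2 := spt_le n
  have h3 : n ≤ 2 ^ n := Nat.lt_two_pow_self.le
  have h4 : n * Fintype.card (Nat.Partition n) ≤ 2 ^ n * 2 ^ n := Nat.mul_le_mul h3 h1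
  have h5 : (24 * n - 1) * Fintype.card (Nat.Partition n) ≤
      24 * n * Fintype.card (Nat.Partition n) := Nat.mul_le_mul_right _ (Nat.sub_le _ _)
  rw [aNum, pow_add, two_mul, pow_add]
  rw [mul_assoc] at h5
  omega

theorem card_primeFactors_le {a b : ℕ} (ha : 0 < a) (h : a ≤ 2 ^ b) : a.primeFactors.card ≤ b := by
  rw [← Nat.pow_le_pow_iff_right (a := 2) (by norm_num)]
  calc 2 ^ a.primeFactors.card ≤ ∏ p ∈ a.primeFactors, p :=
        pow_card_le_prod _ _ _ fun p hp => (Nat.prime_of_mem_primeFactors hp).two_le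
    _ ≤ a := Nat.le_of_dvd ha (Nat.prod_primeFactors_dvd a)
    _ ≤ 2 ^ b := h

/-- A prime at which `spt` has a congruence is a quadratic residue modulo `24 n - 1` in the sense
of the Jacobi symbol, with finitely many exceptions. -/
theorem jacobiSym_eq_one_of_congruence {l n : ℕ} (hl : l.Prime) (hc : sptHasCongruenceAt l)
    (hn : 0 < n) (hd : ¬ l ∣ 24 * n - 1) (ha : ¬ l ∣ aNum n) : jacobiSym l (24 * n - 1) = 1 := by
  have : Fact l.Prime := ⟨hl⟩
  have hlo : Odd l := hl.odd_of_ne_two (by have := hc.1; omega)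
  have hsq : IsSquare ((1 : ZMod l) - 24 * n) := by
    by_contra h
    refine ha ?_
    have := dvd_of_congruence hc h
    rw [← ZMod.natCast_eq_zero_iff, aNum]
    push_cast [Nat.cast_sub (show 1 ≤ 24 * n by omega)]
    exact this
  have hne : ((-((24 * n - 1 : ℕ) : ℤ) : ℤ) : ZMod l) ≠ 0 := by
    push_cast
    rw [neg_ne_zero, Ne, ZMod.natCast_eq_zero_iff]
    exact hd
  have h1 : jacobiSym (-((24 * n - 1 : ℕ) : ℤ)) l = 1 := by
    rw [← jacobiSym.legendreSym.to_jacobiSym, legendreSym.eq_one_iff l hne]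
    push_cast [Nat.cast_sub (show 1 ≤ 24 * n by omega)]
    rwa [neg_sub]
  rw [jacobiSym.neg _ hlo] at h1
  have h3 : (24 * n - 1) % 4 = 3 := by omega
  rcases Nat.odd_mod_four_iff.1 (Nat.odd_iff.1 hlo) with h | h
  · rw [jacobiSym.quadratic_reciprocity_one_mod_four h (Nat.odd_iff.2 (by omega)), ← h1,
      ZMod.χ₄_nat_one_mod_four h, one_mul]
  · rw [jacobiSym.quadratic_reciprocity_three_mod_four h h3, ← h1,
      ZMod.χ₄_nat_three_mod_four h, neg_one_mul]

theorem two_mul_card_jacobiSym_le {d : ℕ} (hd : d % 4 = 3) [NeZero d] :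
    2 * (univ.filter fun u : ZMod d => jacobiSym u.val d = 1).card ≤ d := by
  classical
  set T := univ.filter fun u : ZMod d => jacobiSym u.val d = 1 with hT
  have hneg : ∀ u : ZMod d, jacobiSym (-u).val d = -jacobiSym u.val d := fun u => by
    have h1 : jacobiSym (-u).val d = jacobiSym (-(u.val : ℤ)) d := by
      refine jacobiSym.mod_left' ((ZMod.intCast_eq_intCast_iff' _ _ _).1 ?_)
      push_cast
      rw [ZMod.natCast_zmod_val, ZMod.natCast_zmod_val]
    rw [h1, jacobiSym.neg _ (Nat.odd_iff.2 (by omega)), ZMod.χ₄_nat_three_mod_four hd, neg_one_mul]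
  have hdisj : Disjoint T (T.image fun u => -u) := by
    rw [disjoint_left]
    intro u hu hu'
    obtain ⟨v, hv, rfl⟩ := mem_image.1 hu'
    have h1 := (mem_filter.1 hu).2
    have h2 := (mem_filter.1 hv).2
    rw [hneg, h2] at h1
    norm_num at h1
  have := card_le_univ (T ∪ T.image fun u => -u)
  rw [card_union_of_disjoint hdisj, card_image_of_injective _ neg_injective, ZMod.card] at this
  omega

/-- Integers restricted to half of the residue classes modulo each of several pairwise coprime
moduli. -/
theorem card_filter_residues_le {K : ℕ} (d : Fin K → ℕ) (hd : ∀ i, d i % 4 = 3)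
    (hcop : Pairwise fun i j => (d i).Coprime (d j)) (Y : ℕ) :
    2 ^ K * ((range (Y + 1)).filter fun n : ℕ => ∀ i, jacobiSym n (d i) = 1).card ≤ Y + ∏ i, d i := by
  classical
  have : ∀ i, NeZero (d i) := fun i => ⟨fun h => by have := hd i; omega⟩
  set M := ∏ i, d i with hM
  set T : ∀ i, Finset (ZMod (d i)) := fun i => univ.filter fun u => jacobiSym u.val (d i) = 1
    with hT
  have hcard : ((range (Y + 1)).filter fun n : ℕ => ∀ i, jacobiSym n (d i) = 1).card ≤
      (range (Y / M + 1) ×ˢ Fintype.piFinset T).card := by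
    refine card_le_card_of_injOn (fun n : ℕ => (n / M, fun i => (n : ZMod (d i)))) ?_ ?_
    · intro n hn
      obtain ⟨hn1, hn2⟩ := mem_filter.1 hn
      refine mem_product.2 ⟨mem_range.2 (Nat.lt_succ_of_le (Nat.div_le_div_right
        (Nat.le_of_lt_succ (mem_range.1 hn1)))), Fintype.mem_piFinset.2 fun i => ?_⟩
      refine mem_filter.2 ⟨mem_univ _, ?_⟩
      rw [← hn2 i]
      refine jacobiSym.mod_left' ((ZMod.intCast_eq_intCast_iff' _ _ _).1 ?_)
      push_cast
      rw [ZMod.natCast_zmod_val]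
    · intro n _ n' _ h
      obtain ⟨h1, h2⟩ := Prod.mk.inj h
      have h3 : (n : ℤ) ≡ n' [ZMOD M] := by
        rw [Int.modEq_iff_dvd, hM, Nat.cast_prod]
        refine prod_dvd_of_coprime (fun i _ j _ hij => ?_) fun i _ => ?_
        · exact (hcop hij).isCoprime
        · rw [← Int.modEq_iff_dvd]
          exact (ZMod.intCast_eq_intCast_iff _ _ _).1 (by exact_mod_cast congrFun h2 i)
      have h4 : n % M = n' % M := (Int.natCast_modEq_iff.1 h3)
      rw [← Nat.div_add_mod n M, ← Nat.div_add_mod n' M, h1, h4]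
  rw [card_product, card_range, Fintype.card_piFinset] at hcard
  have hprod : 2 ^ K * ∏ i, (T i).card ≤ M := by
    have : (2 : ℕ) ^ K = ∏ _i : Fin K, 2 := by simp
    rw [this, ← prod_mul_distrib]
    exact prod_le_prod' fun i _ => two_mul_card_jacobiSym_le (hd i)
  calc _ ≤ 2 ^ K * ((Y / M + 1) * ∏ i, (T i).card) := Nat.mul_le_mul_left _ hcard
    _ = (Y / M + 1) * (2 ^ K * ∏ i, (T i).card) := by ring
    _ ≤ (Y / M + 1) * M := Nat.mul_le_mul_left _ hprod
    _ ≤ Y + M := by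
      rw [add_mul, one_mul]
      exact Nat.add_le_add_right (Nat.div_mul_le_self Y M) M

theorem coprime_moduli {K i j : ℕ} (hi : i < j) (hj : j < K) :
    (24 * ((i + 1) * K.factorial) - 1).Coprime (24 * ((j + 1) * K.factorial) - 1) := by
  have hK := K.factorial_pos
  have hpos : ∀ t, 0 < (t + 1) * K.factorial := fun t => Nat.mul_pos (by omega) hK
  refine Nat.Coprime.symm (Nat.coprime_of_dvd fun p hp h1 h2 => ?_)
  have h3 : ¬ p ∣ 24 * K.factorial := by
    intro h
    have h4 : p ∣ 24 * ((i + 1) * K.factorial) := h.trans ⟨i + 1, by ring⟩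
    have h5 := (Nat.dvd_sub h4 h2)
    have := hpos i
    rw [show 24 * ((i + 1) * K.factorial) - (24 * ((i + 1) * K.factorial) - 1) = 1 by omega] at h5
    exact hp.one_lt.ne' (Nat.dvd_one.1 h5)
  have h6 := Nat.dvd_sub h1 h2
  have e : 24 * ((j + 1) * K.factorial) - 1 - (24 * ((i + 1) * K.factorial) - 1)
      = (j - i) * (24 * K.factorial) := by
    obtain ⟨t, rfl⟩ := Nat.exists_eq_add_of_lt hi
    rw [show i + t + 1 - i = t + 1 by omega]
    have h7 : 24 * ((i + t + 1 + 1) * K.factorial)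
      = (t + 1) * (24 * K.factorial) + 24 * ((i + 1) * K.factorial) := by ring
    have := hpos i
    omega
  rw [e] at h6
  rcases hp.dvd_mul.1 h6 with h | h
  · exact h3 (((hp.dvd_factorial).2 ((Nat.le_of_dvd (by omega) h).trans (by omega))).mul_left 24)
  · exact h3 h

/-- The size of the auxiliary moduli. -/
def modBound (K : ℕ) : ℕ := 24 * (K * K.factorial)

open Classical in
theorem card_congruence_primes_le (K Y : ℕ) :
    2 ^ K * ((range (Y + 1)).filter fun l => l.Prime ∧ sptHasCongruenceAt l).card ≤
      2 ^ K * (modBound K + 1 + K * modBound K) + (Y + modBound K ^ K) := by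
  have hK := K.factorial_pos
  set D := modBound K with hD
  set n : Fin K → ℕ := fun i => (i + 1) * K.factorial with hn
  have hnpos : ∀ i, 0 < n i := fun i => Nat.mul_pos (by omega) hK
  have hnD : ∀ i, 24 * n i ≤ D := fun i =>
    Nat.mul_le_mul_left 24 (Nat.mul_le_mul_right _ i.2)
  set d : Fin K → ℕ := fun i => 24 * n i - 1 with hd
  have hcop : Pairwise fun i j => (d i).Coprime (d j) := by
    intro i j hij
    rcases lt_or_gt_of_ne (Fin.val_ne_of_ne hij) with h | h
    · exact coprime_moduli h j.2
    · exact (coprime_moduli h i.2).symm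
  have hcount := card_filter_residues_le d (fun i => by
    have := hnpos i
    change (24 * n i - 1) % 4 = 3
    omega) hcop Y
  have hprod : ∏ i, d i ≤ D ^ K := by
    refine (prod_le_pow_card univ d D fun i _ => (Nat.sub_le _ _).trans (hnD i)).trans_eq ?_
    rw [card_univ, Fintype.card_fin]
  have hsub : ((range (Y + 1)).filter fun l => l.Prime ∧ sptHasCongruenceAt l) ⊆
      (range (D + 1) ∪ univ.biUnion fun i => (aNum (n i)).primeFactors) ∪
        (range (Y + 1)).filter fun n : ℕ => ∀ i, jacobiSym n (d i) = 1 := by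
    intro l hl
    obtain ⟨hlY, hl, hc⟩ := mem_filter.1 hl
    by_contra hnot
    rw [mem_union, mem_union, not_or, not_or, mem_range, mem_biUnion] at hnot
    obtain ⟨⟨h1, h2⟩, h3⟩ := hnot
    refine h3 (mem_filter.2 ⟨hlY, fun i => ?_⟩)
    have := hnpos i
    refine jacobiSym_eq_one_of_congruence hl hc (hnpos i) (fun h => h1 ?_) fun h => h2 ?_
    · have := Nat.le_of_dvd (by omega) h
      have := hnD i
      omega
    · exact ⟨i, mem_univ _, Nat.mem_primeFactors.2 ⟨hl, h, (aNum_pos (hnpos i)).ne'⟩⟩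
  have hbi : (univ.biUnion fun i => (aNum (n i)).primeFactors).card ≤ K * D := by
    refine (card_biUnion_le_card_mul _ _ D fun i _ => ?_).trans_eq ?_
    · refine card_primeFactors_le (aNum_pos (hnpos i)) ((aNum_le (n i)).trans ?_)
      refine Nat.pow_le_pow_right (by norm_num) ?_
      have := hnpos i
      have := hnD i
      omega
    · rw [card_univ, Fintype.card_fin]
  have hU := (card_le_card hsub).trans (card_union_le _ _)
  have hU' := card_union_le (range (D + 1)) (univ.biUnion fun i => (aNum (n i)).primeFactors)
  rw [card_range] at hU'
  calc _ ≤ 2 ^ K * ((D + 1 + K * D) + _) :=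
        Nat.mul_le_mul_left _ (hU.trans (Nat.add_le_add_right (by omega) _))
    _ = 2 ^ K * (D + 1 + K * D) + 2 ^ K * _ := mul_add _ _ _
    _ ≤ _ := Nat.add_le_add_left (hcount.trans (by omega)) _

end Counting

section Limit

theorem modBound_le (K : ℕ) : (modBound K : ℝ) ≤ Real.exp (4 * (K + 1) ^ 2) := by
  have hK : (K : ℝ) ≤ Real.exp K := (by linarith : (K : ℝ) ≤ K + 1).trans (Real.add_one_le_exp _)
  have h24 : (24 : ℝ) ≤ Real.exp 4 := by
    have h1 : (2.7 : ℝ) ≤ Real.exp 1 := by have := Real.exp_one_gt_d9; linarith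
    have h2 : Real.exp 4 = Real.exp 1 ^ 4 := by rw [← Real.exp_nat_mul]; norm_num
    rw [h2]
    calc (24 : ℝ) ≤ 2.7 ^ 4 := by norm_num
      _ ≤ _ := by gcongr
  have hfac : (K.factorial : ℝ) ≤ Real.exp (K * K) := by
    calc (K.factorial : ℝ) ≤ (K : ℝ) ^ K := by exact_mod_cast Nat.factorial_le_pow K
      _ ≤ Real.exp K ^ K := by gcongr
      _ = _ := by rw [← Real.exp_nat_mul]
  rw [modBound]
  push_cast
  calc (24 : ℝ) * (K * K.factorial) ≤ Real.exp 4 * (Real.exp K * Real.exp (K * K)) := by gcongr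
    _ = Real.exp (4 + (K + K * K)) := by rw [Real.exp_add, Real.exp_add]
    _ ≤ _ := Real.exp_le_exp.2 (by nlinarith [(Nat.cast_nonneg K : (0 : ℝ) ≤ K)])

theorem exceptions_le (K : ℕ) : (modBound K + 1 + K * modBound K + modBound K ^ K : ℝ) ≤
    Real.exp (7 * (K + 1) ^ 3) := by
  have hK0 : (0 : ℝ) ≤ K := Nat.cast_nonneg K
  have hK : (K : ℝ) ≤ Real.exp K := (by linarith : (K : ℝ) ≤ K + 1).trans (Real.add_one_le_exp _)
  have hD := modBound_le K
  have h4 : (4 : ℝ) ≤ Real.exp 2 := by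
    have h1 : (2.7 : ℝ) ≤ Real.exp 1 := by have := Real.exp_one_gt_d9; linarith
    have h2 : Real.exp 2 = Real.exp 1 ^ 2 := by rw [← Real.exp_nat_mul]; norm_num
    rw [h2]; nlinarith
  set E := Real.exp (5 * ((K : ℝ) + 1) ^ 3) with hE
  have e1 : (modBound K : ℝ) ≤ E := hD.trans (Real.exp_le_exp.2 (by
    nlinarith [mul_nonneg hK0 hK0, mul_nonneg hK0 (mul_nonneg hK0 hK0)]))
  have e2 : 1 ≤ E := Real.one_le_exp (by positivity)
  have e3 : (K : ℝ) * modBound K ≤ E := by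
    calc (K : ℝ) * modBound K ≤ Real.exp K * Real.exp (4 * (K + 1) ^ 2) := by gcongr
      _ = Real.exp (K + 4 * (K + 1) ^ 2) := by rw [Real.exp_add]
      _ ≤ E := Real.exp_le_exp.2 (by
        nlinarith [mul_nonneg hK0 hK0, mul_nonneg hK0 (mul_nonneg hK0 hK0)])
  have e4 : (modBound K : ℝ) ^ K ≤ E := by
    calc (modBound K : ℝ) ^ K ≤ Real.exp (4 * (K + 1) ^ 2) ^ K := by gcongr
      _ = Real.exp (K * (4 * (K + 1) ^ 2)) := by rw [← Real.exp_nat_mul]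
      _ ≤ E := Real.exp_le_exp.2 (by
        nlinarith [mul_nonneg hK0 hK0, mul_nonneg hK0 (mul_nonneg hK0 hK0)])
  calc (modBound K + 1 + K * modBound K + modBound K ^ K : ℝ) ≤ 4 * E := by linarith
    _ ≤ Real.exp 2 * E := by gcongr
    _ = Real.exp (2 + 5 * (K + 1) ^ 3) := by rw [Real.exp_add]
    _ ≤ _ := Real.exp_le_exp.2 (by
      nlinarith [mul_nonneg hK0 hK0, mul_nonneg hK0 (mul_nonneg hK0 hK0)])

theorem ncard_congruence_primes_le (K : ℕ) {X : ℝ} (hX : 0 ≤ X) :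
    ({l : ℕ | l.Prime ∧ (l : ℝ) ≤ X ∧ sptHasCongruenceAt l}.ncard : ℝ) ≤
      Real.exp (7 * (K + 1) ^ 3) + X / 2 ^ K := by
  classical
  have h1 : {l : ℕ | l.Prime ∧ (l : ℝ) ≤ X ∧ sptHasCongruenceAt l}.ncard ≤
      ((range (⌊X⌋₊ + 1)).filter fun l => l.Prime ∧ sptHasCongruenceAt l).card := by
    rw [← Set.ncard_coe_finset]
    refine Set.ncard_le_ncard (fun l hl => ?_) (finite_toSet _)
    obtain ⟨hl, hlX, hc⟩ := hl
    exact mem_coe.2 (mem_filter.2 ⟨mem_range.2 (Nat.lt_succ_of_le (Nat.le_floor hlX)), hl, hc⟩)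
  have h2 := card_congruence_primes_le K ⌊X⌋₊
  set c := ((range (⌊X⌋₊ + 1)).filter fun l => l.Prime ∧ sptHasCongruenceAt l).card
  have h3 : (2 : ℝ) ^ K * c ≤ 2 ^ K * (modBound K + 1 + K * modBound K) +
      (⌊X⌋₊ + modBound K ^ K) := by exact_mod_cast h2
  have h4 : (⌊X⌋₊ : ℝ) ≤ X := Nat.floor_le hX
  have h5 : (1 : ℝ) ≤ 2 ^ K := one_le_pow₀ (by norm_num)
  have h6 := exceptions_le K
  have h7 : (modBound K : ℝ) ^ K ≤ 2 ^ K * modBound K ^ K :=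
    le_mul_of_one_le_left (by positivity) h5
  have h8 : (c : ℝ) ≤ (modBound K + 1 + K * modBound K + modBound K ^ K) + X / 2 ^ K := by
    rw [← sub_le_iff_le_add', le_div_iff₀ (by positivity)]
    linarith
  have h9 : ({l : ℕ | l.Prime ∧ (l : ℝ) ≤ X ∧ sptHasCongruenceAt l}.ncard : ℝ) ≤ c := by
    exact_mod_cast h1
  linarith

theorem sq_le_two_pow_ceil {y : ℝ} (hy : 1 ≤ y) : y ^ 2 ≤ 2 ^ ⌈3 * Real.log y⌉₊ := by
  have hL : 0 ≤ Real.log y := Real.log_nonneg hy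
  have h1 := Nat.le_ceil (3 * Real.log y)
  have h2 := Real.log_two_gt_d9
  rw [← Real.log_le_log_iff (by positivity) (by positivity), Real.log_pow, Real.log_pow]
  push_cast
  nlinarith

theorem eventually_congruence_primes_le : ∀ᶠ X : ℝ in atTop,
    ({l : ℕ | l.Prime ∧ (l : ℝ) ≤ X ∧ sptHasCongruenceAt l}.ncard : ℝ) * Real.log X / X ≤
      Real.exp (-(Real.log X / 2)) + (Real.log X)⁻¹ := by
  have hlog : ∀ᶠ y : ℝ in atTop, 1 ≤ Real.log y ∧ 1 ≤ y ∧ 876 * Real.log y ^ 3 ≤ y / 2 := by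
    have h := (Real.isLittleO_pow_log_id_atTop (n := 3)).bound (show (0 : ℝ) < 1 / 1752 by norm_num)
    filter_upwards [h, Real.tendsto_log_atTop.eventually_ge_atTop 1, eventually_ge_atTop 1]
      with y h1 h2 h3
    refine ⟨h2, h3, ?_⟩
    rw [Real.norm_eq_abs, id, Real.norm_eq_abs, abs_of_nonneg (by positivity),
      abs_of_nonneg (by linarith)] at h1
    linarith
  filter_upwards [Real.tendsto_log_atTop.eventually hlog, eventually_gt_atTop 0] with X hy hX
  set y := Real.log X with hydef
  obtain ⟨hL, hy1, hb⟩ := hy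
  set K := ⌈3 * Real.log y⌉₊ with hK
  have hy0 : 0 < y := by linarith
  have hXy : X = Real.exp y := (Real.exp_log hX).symm
  have hsq : y ^ 2 ≤ 2 ^ K := sq_le_two_pow_ceil hy1
  have hKL : (K : ℝ) + 1 ≤ 5 * Real.log y := by
    have := Nat.ceil_lt_add_one (show 0 ≤ 3 * Real.log y by linarith)
    linarith
  have h1 : Real.exp (7 * (K + 1) ^ 3) * y ≤ X * Real.exp (-(y / 2)) := by
    calc Real.exp (7 * (K + 1) ^ 3) * y = Real.exp (7 * (K + 1) ^ 3 + Real.log y) := by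
          rw [Real.exp_add, Real.exp_log hy0]
      _ ≤ Real.exp (y + -(y / 2)) := by
          refine Real.exp_le_exp.2 ?_
          have : ((K : ℝ) + 1) ^ 3 ≤ (5 * Real.log y) ^ 3 := by gcongr
          have h3 : Real.log y ≤ Real.log y ^ 3 := le_self_pow₀ hL (by norm_num)
          linarith
      _ = X * Real.exp (-(y / 2)) := by rw [Real.exp_add, ← hXy]
  have h2 : X / 2 ^ K * y ≤ X * y⁻¹ := by
    rw [div_mul_eq_mul_div, div_le_iff₀ (by positivity), mul_assoc]
    gcongr
    rw [inv_mul_eq_div, le_div_iff₀ hy0]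
    linarith
  rw [div_le_iff₀ hX]
  calc _ ≤ (Real.exp (7 * (K + 1) ^ 3) + X / 2 ^ K) * y := by
        gcongr; exact ncard_congruence_primes_le K hX.le
    _ ≤ _ := by linarith

end Limit

end SptRare

/-- Congruences for `spt` are rare: if `N(X)` counts the primes `ℓ ≤ X` at which `spt`
has a congruence, then `N(X) log X / X → 0` as `X → ∞`. -/
theorem spt_congruences_rare :
    Tendsto
      (fun X : ℝ =>
        (({ℓ : ℕ | ℓ.Prime ∧ (ℓ : ℝ) ≤ X ∧ sptHasCongruenceAt ℓ}.ncard : ℝ))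
          * Real.log X / X)
      atTop (nhds 0) := by
  have h0 : Tendsto (fun X : ℝ => Real.exp (-(Real.log X / 2)) + (Real.log X)⁻¹) atTop (nhds 0) := by
    rw [← add_zero (0 : ℝ)]
    exact (Real.tendsto_exp_neg_atTop_nhds_zero.comp
      (Real.tendsto_log_atTop.atTop_div_const (by norm_num))).add
      (tendsto_inv_atTop_zero.comp Real.tendsto_log_atTop)
  refine tendsto_of_tendsto_of_tendsto_of_le_of_le' tendsto_const_nhds h0 ?_
    SptRare.eventually_congruence_primes_le
  filter_upwards [eventually_ge_atTop 1] with X hX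
  have := Real.log_nonneg hX
  positivity
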